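/- Let n ≥ 3 and fix 0 < ε < 1. Let γ := {t·e₁ : ε/2 ≤ t ≤ 1} ⊆ ℝⁿ, let A_ε := {x ∈ ℝⁿ : ε < ‖x‖ < 1}, and for δ > 0 let Ω_δ := {x ∈ A_ε : dist(x, γ) > δ}. Then for all sufficiently small δ > 0 the set Ω_δ is a nonempty contractible open set, and lim_{δ → 0⁺} σ₁(Ω_δ) = σ₁(A_ε) and lim_{δ → 0⁺} H^{n−1}(∂Ω_δ) = H^{n−1}(∂A_ε). -/

import Mathlib

open MeasureTheory Filter

/-- The first nonzero Steklov eigenvalue of a domain `Ω ⊆ ℝⁿ`, defined variationally. -/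
noncomputable def stekSigma1 {n : ℕ} (Ω : Set (EuclideanSpace ℝ (Fin n))) : ℝ :=
  sInf { q : ℝ | ∃ f : EuclideanSpace ℝ (Fin n) → ℝ, ContDiff ℝ (⊤ : ℕ∞) f ∧
    (∫ x in frontier Ω, f x ∂(μH[(n : ℝ) - 1])) = 0 ∧
    (0 < ∫ x in frontier Ω, (f x) ^ 2 ∂(μH[(n : ℝ) - 1])) ∧
    q = (∫ x in Ω, ‖gradient f x‖ ^ 2) /
        (∫ x in frontier Ω, (f x) ^ 2 ∂(μH[(n : ℝ) - 1])) }

section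

open Set
open scoped ENNReal NNReal Topology

theorem exists_cover_tsum_ediam_le {X : Type*} [EMetricSpace X] [MeasurableSpace X] [BorelSpace X]
    {d : ℝ} (hd : 0 < d) {A : Set X} (hA : μH[d] A ≠ ∞) {r η : ℝ≥0∞} (hr : 0 < r) (hη : η ≠ 0) :
    ∃ t : ℕ → Set X, A ⊆ ⋃ i, t i ∧ (∀ i, Metric.ediam (t i) ≤ r) ∧
      ∑' i, Metric.ediam (t i) ^ d ≤ μH[d] A + η := by
  have h1 : (⨅ (t : ℕ → Set X) (_ : A ⊆ ⋃ n, t n) (_ : ∀ n, Metric.ediam (t n) ≤ r),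
          ∑' n, ⨆ _ : (t n).Nonempty, Metric.ediam (t n) ^ d) < μH[d] A + η := by
    refine lt_of_le_of_lt ?_ (ENNReal.lt_add_right hA hη)
    conv_rhs => rw [Measure.hausdorffMeasure_apply]
    exact le_iSup₂ (f := fun (r : ℝ≥0∞) (_ : 0 < r) =>
      ⨅ (t : ℕ → Set X) (_ : A ⊆ ⋃ n, t n) (_ : ∀ n, Metric.ediam (t n) ≤ r),
          ∑' n, ⨆ _ : (t n).Nonempty, Metric.ediam (t n) ^ d) r hr
  simp only [iInf_lt_iff] at h1
  obtain ⟨t, h, h', h''⟩ := h1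
  refine ⟨t, h, h', le_trans (ENNReal.tsum_le_tsum fun i => ?_) h''.le⟩
  rcases (t i).eq_empty_or_nonempty with h0 | h0
  · simp [h0, hd]
  · exact le_iSup (fun _ : (t i).Nonempty => Metric.ediam (t i) ^ d) h0

/-- The Eilenberg inequality for a real-valued 1-Lipschitz function. -/
theorem lintegral_hausdorffMeasure_fiber_le {X : Type*} [EMetricSpace X] [MeasurableSpace X]
    [BorelSpace X] {f : X → ℝ} (hf : LipschitzWith 1 f) {d : ℝ} (hd : 0 < d) (A : Set X) :
    ∫⁻ y, μH[d] (A ∩ f ⁻¹' {y}) ≤ μH[d + 1] A := by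
  by_cases hA : μH[d + 1] A = ∞
  · simp [hA]
  have key : ∀ j : ℕ, ∃ t : ℕ → Set X, A ⊆ ⋃ i, t i ∧
      (∀ i, Metric.ediam (t i) ≤ ((j : ℝ≥0∞) + 1)⁻¹) ∧
      ∑' i, Metric.ediam (t i) ^ (d + 1) ≤ μH[d + 1] A + ((j : ℝ≥0∞) + 1)⁻¹ := fun j =>
    exists_cover_tsum_ediam_le (by linarith) hA
      (by simp [ENNReal.inv_pos]) (by simp)
  choose t ht1 ht2 ht3 using key
  have hlim : Tendsto (fun j : ℕ => ((j : ℝ≥0∞) + 1)⁻¹) atTop (𝓝 0) := by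
    have := ENNReal.tendsto_inv_nat_nhds_zero.comp (tendsto_add_atTop_nat 1)
    refine this.congr fun j => ?_
    simp
  set g : ℕ → ℝ → ℝ≥0∞ := fun j y =>
    ∑' i, (closure (f '' (t j i))).indicator (fun _ => Metric.ediam (t j i) ^ d) y with hg
  have hgm : ∀ j, Measurable (g j) := fun j =>
    Measurable.tsum fun i => measurable_const.indicator isClosed_closure.measurableSet
  have hpt : ∀ y, μH[d] (A ∩ f ⁻¹' {y}) ≤ liminf (fun j => g j y) atTop := by
    intro y
    have h1 := Measure.hausdorffMeasure_le_liminf_tsum (ι := fun _ : ℕ => ℕ) d (A ∩ f ⁻¹' {y})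
      (fun j : ℕ => ((j : ℝ≥0∞) + 1)⁻¹) hlim (fun j i => t j i ∩ f ⁻¹' {y})
      (Eventually.of_forall fun j i => (Metric.ediam_mono inter_subset_left).trans (ht2 j i))
      (Eventually.of_forall fun j => by
        rw [← iUnion_inter]
        exact inter_subset_inter_left _ (ht1 j))
    refine h1.trans (liminf_le_liminf (Eventually.of_forall fun j => ?_))
    refine ENNReal.tsum_le_tsum fun i => ?_
    rcases (t j i ∩ f ⁻¹' {y}).eq_empty_or_nonempty with h0 | ⟨x, hx, hxy⟩
    · rw [h0]; simp [hd]
    · have : y ∈ closure (f '' (t j i)) := subset_closure ⟨x, hx, hxy⟩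
      rw [indicator_of_mem this]
      exact ENNReal.rpow_le_rpow (Metric.ediam_mono inter_subset_left) hd.le
  calc ∫⁻ y, μH[d] (A ∩ f ⁻¹' {y}) ≤ ∫⁻ y, liminf (fun j => g j y) atTop := lintegral_mono hpt
    _ ≤ liminf (fun j => ∫⁻ y, g j y) atTop := lintegral_liminf_le hgm
    _ ≤ liminf (fun j : ℕ => μH[d + 1] A + ((j : ℝ≥0∞) + 1)⁻¹) atTop := by
        refine liminf_le_liminf (Eventually.of_forall fun j => ?_)
        refine le_trans (le_of_eq (b := ∑' i, Metric.ediam (t j i) ^ d *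
          volume (closure (f '' (t j i)))) ?_) ((ENNReal.tsum_le_tsum fun i => ?_).trans (ht3 j))
        · rw [hg]
          simp only
          rw [lintegral_tsum fun i => (measurable_const.indicator
            isClosed_closure.measurableSet).aemeasurable]
          congr 1 with i
          rw [lintegral_indicator_const isClosed_closure.measurableSet]
        · rw [ENNReal.rpow_add_of_nonneg _ _ hd.le zero_le_one, ENNReal.rpow_one]
          gcongr
          refine (Real.volume_le_diam _).trans ?_
          rw [Metric.ediam_closure]
          simpa using hf.ediam_image_le (t j i)
    _ = μH[d + 1] A := by
        have : Tendsto (fun j : ℕ => μH[d + 1] A + ((j : ℝ≥0∞) + 1)⁻¹) atTop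
            (𝓝 (μH[d + 1] A + 0)) := tendsto_const_nhds.add hlim
        rw [this.liminf_eq, add_zero]

/-- The restriction of `μH[d]` to a Lipschitz image is dominated by the push-forward of `μH[d]`. -/
theorem LipschitzOnWith.restrict_hausdorffMeasure_image_le {X Y : Type*} [EMetricSpace X]
    [MeasurableSpace X] [BorelSpace X] [EMetricSpace Y] [MeasurableSpace Y] [BorelSpace Y]
    {Φ : X → Y} {K : ℝ≥0} {P : Set X} (hΦ : LipschitzOnWith K Φ P) (hm : Measurable Φ)
    {d : ℝ} (hd : 0 ≤ d) {T : Set Y} (hT : T ⊆ Φ '' P) :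
    (μH[d] : Measure Y).restrict T ≤ ((K : ℝ≥0∞) ^ d) • (((μH[d] : Measure X).restrict P).map Φ) := by
  refine Measure.le_iff.2 fun S hS => ?_
  rw [Measure.restrict_apply hS, Measure.smul_apply, Measure.map_apply hm hS,
    Measure.restrict_apply (hm hS), smul_eq_mul]
  refine le_trans (measure_mono ?_)
    ((hΦ.mono (inter_subset_right (s := Φ ⁻¹' S))).hausdorffMeasure_image_le hd)
  rintro y ⟨hyS, hyT⟩
  obtain ⟨x, hx, rfl⟩ := hT hyT
  exact ⟨x, ⟨hyS, hx⟩, rfl⟩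

/-- Euclidean space of dimension `k`. -/
abbrev Euc (k : ℕ) := EuclideanSpace ℝ (Fin k)

/-- The linear map `ℝ × ℝᵐ → ℝᵐ⁺¹` adjoining a first coordinate. -/
noncomputable def econsL (m : ℕ) : (ℝ × Euc m) →L[ℝ] Euc (m + 1) :=
  LinearMap.toContinuousLinearMap
    { toFun := fun p => WithLp.toLp 2 (Fin.cons p.1 p.2)
      map_add' := fun p q => by
        ext i; refine Fin.cases ?_ (fun j => ?_) i <;> simp
      map_smul' := fun c p => by
        ext i; refine Fin.cases ?_ (fun j => ?_) i <;> simp }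

/-- The vector with first coordinate `t` and remaining coordinates `z`. -/
noncomputable def econs {m : ℕ} (t : ℝ) (z : Euc m) : Euc (m + 1) := econsL m (t, z)

/-- The projection `ℝᵐ⁺¹ → ℝᵐ` forgetting the first coordinate. -/
noncomputable def etail {m : ℕ} : Euc (m + 1) →L[ℝ] Euc m :=
  LinearMap.toContinuousLinearMap
    { toFun := fun x => WithLp.toLp 2 (fun i => x i.succ)
      map_add' := fun p q => by ext i; simp
      map_smul' := fun c p => by ext i; simp }

section
variable {m : ℕ}

@[simp] theorem econs_zero (t : ℝ) (z : Euc m) : econs t z 0 = t := rfl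
@[simp] theorem econs_succ (t : ℝ) (z : Euc m) (i : Fin m) : econs t z i.succ = z i := rfl
@[simp] theorem etail_apply (x : Euc (m + 1)) (i : Fin m) : etail x i = x i.succ := rfl
@[simp] theorem etail_econs (t : ℝ) (z : Euc m) : etail (econs t z) = z := by ext i; simp
@[simp] theorem econs_etail (x : Euc (m + 1)) : econs (x 0) (etail x) = x := by
  ext i; refine Fin.cases ?_ (fun j => ?_) i <;> simp

theorem norm_sq_eq_add (x : Euc (m + 1)) : ‖x‖ ^ 2 = x 0 ^ 2 + ‖etail x‖ ^ 2 := by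
  rw [EuclideanSpace.norm_sq_eq, EuclideanSpace.norm_sq_eq, Fin.sum_univ_succ]
  simp

theorem norm_econs_sq (t : ℝ) (z : Euc m) : ‖econs t z‖ ^ 2 = t ^ 2 + ‖z‖ ^ 2 := by
  rw [norm_sq_eq_add]; simp

theorem norm_etail_le (x : Euc (m + 1)) : ‖etail x‖ ≤ ‖x‖ := by
  have := norm_sq_eq_add x
  exact le_of_sq_le_sq (by nlinarith [sq_nonneg (x 0)]) (norm_nonneg _)

theorem lipschitzWith_etail : LipschitzWith 1 (etail : Euc (m + 1) → Euc m) :=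
  LipschitzWith.of_dist_le_mul fun x y => by
    rw [dist_eq_norm, dist_eq_norm, ← map_sub]
    simpa using norm_etail_le (x - y)

theorem lipschitzWith_norm_etail : LipschitzWith 1 (fun x : Euc (m + 1) => ‖etail x‖) := by
  have := lipschitzWith_one_norm.comp (lipschitzWith_etail (m := m))
  rwa [one_mul] at this

@[fun_prop] theorem continuous_econs : Continuous fun p : ℝ × Euc m => econs p.1 p.2 :=
  (econsL m).continuous

theorem econs_sub (t s : ℝ) (z w : Euc m) : econs t z - econs s w = econs (t - s) (z - w) :=
  ((econsL m).map_sub (t, z) (s, w)).symm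

theorem lintegral_euc_succ {h : Euc (m + 1) → ℝ≥0∞} (hh : Measurable h) :
    ∫⁻ x, h x = ∫⁻ z : Euc m, ∫⁻ t : ℝ, h (econs t z) := by
  have e1 := (EuclideanSpace.volume_preserving_symm_measurableEquiv_toLp (Fin (m + 1))).symm
  have e2 := (volume_preserving_piFinSuccAbove (fun _ : Fin (m + 1) => ℝ) 0).symm
  have e3 := (EuclideanSpace.volume_preserving_symm_measurableEquiv_toLp (Fin m))
  have hF : Measurable fun p : ℝ × (Fin m → ℝ) => h (econs p.1 (WithLp.toLp 2 p.2)) :=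
    hh.comp (by fun_prop)
  have h1 : ∫⁻ x, h x = ∫⁻ p : ℝ × (Fin m → ℝ), h (econs p.1 (WithLp.toLp 2 p.2)) := by
    rw [← (e1.comp e2).lintegral_comp hh]
    refine lintegral_congr fun p => ?_
    congr 1
    ext i
    refine Fin.cases ?_ (fun j => ?_) i <;> rfl
  have hG : Measurable fun z : Euc m => ∫⁻ t : ℝ, h (econs t z) :=
    Measurable.lintegral_prod_left' (f := fun p : ℝ × Euc m => h (econs p.1 p.2))
      (hh.comp (by fun_prop))
  rw [h1, Measure.volume_eq_prod, lintegral_prod_symm _ hF.aemeasurable, ← e3.symm.lintegral_comp hG]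
  rfl

/-- Polar coordinates for the lower Lebesgue integral. -/
theorem lintegral_euc_polar (hm : m ≠ 0) {h : Euc m → ℝ≥0∞} (hh : Measurable h) :
    ∫⁻ z, h z = ∫⁻ ρ in Ioi (0 : ℝ), ENNReal.ofReal (ρ ^ (m - 1)) *
      ∫⁻ ω : Metric.sphere (0 : Euc m) 1, h (ρ • (ω : Euc m)) ∂(volume : Measure (Euc m)).toSphere := by
  have : Nonempty (Fin m) := ⟨⟨0, Nat.pos_of_ne_zero hm⟩⟩
  have e := (volume : Measure (Euc m)).measurePreserving_homeomorphUnitSphereProd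
  have hd : Module.finrank ℝ (Euc m) - 1 = m - 1 := by simp
  rw [hd] at e
  have h1 : ∫⁻ z, h z = ∫⁻ z : ({0}ᶜ : Set (Euc m)), h z ∂(Measure.comap Subtype.val volume) := by
    rw [lintegral_subtype_comap (measurableSet_singleton _).compl, restrict_compl_singleton]
  have e' := e.symm (homeomorphUnitSphereProd (Euc m)).toMeasurableEquiv
  have hc : Measurable fun z : ({0}ᶜ : Set (Euc m)) => h z := hh.comp measurable_subtype_coe
  rw [h1, ← e'.lintegral_comp hc]
  erw [lintegral_prod_symm _ (hc.comp e'.measurable).aemeasurable]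
  have hmeas : Measurable fun ρ : ℝ => ∫⁻ ω : Metric.sphere (0 : Euc m) 1, h (ρ • (ω : Euc m))
      ∂(volume : Measure (Euc m)).toSphere := by
    refine Measurable.lintegral_prod_right' (f := fun p : ℝ × Metric.sphere (0 : Euc m) 1 =>
      h (p.1 • (p.2 : Euc m))) (hh.comp (by fun_prop))
  rw [Measure.volumeIoiPow, lintegral_withDensity_eq_lintegral_mul _ (by fun_prop)]
  · simp only [Pi.mul_apply]
    rw [← lintegral_subtype_comap measurableSet_Ioi (fun ρ : ℝ => ENNReal.ofReal (ρ ^ (m - 1)) *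
      ∫⁻ ω : Metric.sphere (0 : Euc m) 1, h (ρ • (ω : Euc m)) ∂(volume : Measure (Euc m)).toSphere)]
    rfl
  · exact hmeas.comp measurable_subtype_coe

/-- On `ℝᵐ` the Hausdorff measure of dimension `m` is a positive multiple of Lebesgue measure. -/
theorem exists_hausdorffMeasure_eq_smul_volume (m : ℕ) : ∃ c : ℝ≥0∞, c ≠ 0 ∧ c ≠ ∞ ∧
    (μH[(m : ℝ)] : Measure (Euc m)) = c • volume := by
  have : (μH[(m : ℝ)] : Measure (Euc m)).IsAddHaarMeasure := by
    have := MeasureTheory.isAddHaarMeasure_hausdorffMeasure (E := Euc m)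
    simpa using this
  refine ⟨(μH[(m : ℝ)] : Measure (Euc m)).addHaarScalarFactor volume, ?_, by simp,
    ?_⟩
  · simpa using (Measure.addHaarScalarFactor_pos_of_isAddHaarMeasure _ _).ne'
  · exact Measure.isAddLeftInvariant_eq_smul _ _
/-- The hemisphere of radius `κ` as a graph over the equatorial hyperplane. -/
noncomputable def egraph (s κ : ℝ) (z : Euc m) : Euc (m + 1) :=
  econs (s * √(κ ^ 2 - ‖z‖ ^ 2)) z

@[fun_prop] theorem continuous_egraph (s κ : ℝ) : Continuous (egraph s κ : Euc m → Euc (m + 1)) := by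
  unfold egraph; fun_prop

theorem lipschitzOnWith_egraph {s κ : ℝ} (hs : s = 1 ∨ s = -1) (hκ : 0 < κ) :
    LipschitzOnWith 2 (egraph s κ : Euc m → Euc (m + 1)) (Metric.closedBall 0 (κ / 2)) := by
  refine LipschitzOnWith.of_dist_le_mul fun z hz w hw => ?_
  rw [mem_closedBall_zero_iff] at hz hw
  rw [dist_eq_norm, dist_eq_norm, egraph, egraph, econs_sub]
  refine le_of_sq_le_sq ?_ (by positivity)
  rw [norm_econs_sq]
  have hss : s ^ 2 = 1 := by rcases hs with rfl | rfl <;> norm_num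
  have hz0 := norm_nonneg z
  have hw0 := norm_nonneg w
  have hd := abs_norm_sub_norm_le z w
  have ha : (κ / 2) ≤ √(κ ^ 2 - ‖z‖ ^ 2) := Real.le_sqrt_of_sq_le (by nlinarith)
  have hb : (κ / 2) ≤ √(κ ^ 2 - ‖w‖ ^ 2) := Real.le_sqrt_of_sq_le (by nlinarith)
  have ha2 := Real.sq_sqrt (show 0 ≤ κ ^ 2 - ‖z‖ ^ 2 by nlinarith)
  have hb2 := Real.sq_sqrt (show 0 ≤ κ ^ 2 - ‖w‖ ^ 2 by nlinarith)
  set A := √(κ ^ 2 - ‖z‖ ^ 2)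
  set B := √(κ ^ 2 - ‖w‖ ^ 2)
  have h1 : (A - B) * (A + B) = (‖w‖ - ‖z‖) * (‖w‖ + ‖z‖) := by nlinarith
  have h2 : |A - B| * (A + B) = |‖z‖ - ‖w‖| * (‖w‖ + ‖z‖) := by
    rw [← abs_of_nonneg (show 0 ≤ A + B by linarith), ← abs_mul, h1, abs_mul, abs_sub_comm,
      abs_of_nonneg (show 0 ≤ ‖w‖ + ‖z‖ by linarith)]
  have h3 : |A - B| ≤ ‖z - w‖ := by
    have : |A - B| * κ ≤ ‖z - w‖ * κ := by
      calc |A - B| * κ ≤ |A - B| * (A + B) := by gcongr; linarith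
        _ = |‖z‖ - ‖w‖| * (‖w‖ + ‖z‖) := h2
        _ ≤ ‖z - w‖ * κ := by gcongr; linarith
    exact le_of_mul_le_mul_right this hκ
  have h4 : (s * A - s * B) ^ 2 = |A - B| ^ 2 := by rw [sq_abs]; linear_combination (A - B) ^ 2 * hss
  rw [h4]
  have := abs_nonneg (A - B)
  have h5 : |A - B| ^ 2 ≤ ‖z - w‖ ^ 2 := by gcongr
  rw [NNReal.coe_ofNat]
  nlinarith [sq_nonneg ‖z - w‖]

theorem exists_lintegral_egraph_image_le (m : ℕ) : ∃ C : ℝ≥0∞, C ≠ ∞ ∧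
    ∀ {s κ : ℝ}, (s = 1 ∨ s = -1) → 0 < κ → ∀ {P : Set (Euc m)},
      P ⊆ Metric.closedBall 0 (κ / 2) → ∀ {h : Euc (m + 1) → ℝ≥0∞}, Measurable h →
      ∫⁻ x in egraph s κ '' P, h x ∂μH[m] ≤ C * ∫⁻ z in P, h (egraph s κ z) := by
  obtain ⟨c, hc0, hc, hcv⟩ := exists_hausdorffMeasure_eq_smul_volume m
  refine ⟨2 ^ (m : ℝ) * c, by finiteness, fun {s κ} hs hκ {P} hP {h} hh => ?_⟩
  have hm := (continuous_egraph (m := m) s κ).measurable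
  have h1 := ((lipschitzOnWith_egraph hs hκ).mono hP).restrict_hausdorffMeasure_image_le hm
    (d := m) (by positivity) subset_rfl
  refine (lintegral_mono' h1 le_rfl).trans_eq ?_
  rw [lintegral_smul_measure, lintegral_map hh hm, hcv, Measure.restrict_smul,
    lintegral_smul_measure]
  simp [mul_assoc]

theorem exists_lintegral_egraph_le (m : ℕ) : ∃ C : ℝ≥0∞, C ≠ ∞ ∧
    ∀ {s κ : ℝ} {P : Set (Euc m)} {T : Set (Euc (m + 1))}, egraph s κ '' P ⊆ T →
      ∀ {h : Euc (m + 1) → ℝ≥0∞}, Measurable h →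
      ∫⁻ z in P, h (egraph s κ z) ≤ C * ∫⁻ x in T, h x ∂μH[m] := by
  obtain ⟨c, hc0, hc, hcv⟩ := exists_hausdorffMeasure_eq_smul_volume m
  refine ⟨c⁻¹, by simpa using hc0, fun {s κ P T} hT {h} hh => ?_⟩
  have hm := (continuous_egraph (m := m) s κ).measurable
  have h0 : (volume : Measure (Euc m)) = c⁻¹ • (μH[(m : ℝ)] : Measure (Euc m)) := by
    rw [hcv, smul_smul, ENNReal.inv_mul_cancel hc0 hc, one_smul]
  have h1 : ((μH[(m : ℝ)] : Measure (Euc m)).restrict P).map (egraph s κ) ≤ μH[(m : ℝ)].restrict T := by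
    refine Measure.le_iff.2 fun S hS => ?_
    rw [Measure.map_apply hm hS, Measure.restrict_apply (hm hS), Measure.restrict_apply hS]
    have h2 := (lipschitzWith_etail (m := m)).hausdorffMeasure_image_le (d := m) (by positivity)
      (S ∩ T)
    simp only [ENNReal.coe_one, ENNReal.one_rpow, one_mul] at h2
    refine le_trans (measure_mono ?_) h2
    rintro z ⟨hz, hzP⟩
    exact ⟨egraph s κ z, ⟨hz, hT ⟨z, hzP, rfl⟩⟩, by simp [egraph]⟩
  rw [h0, Measure.restrict_smul, lintegral_smul_measure, smul_eq_mul]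
  gcongr
  rw [← lintegral_map hh hm]
  exact lintegral_mono' h1 le_rfl

theorem hausdorffMeasure_sphere_lt_top (hm : m ≠ 0) {κ : ℝ} (hκ : 0 < κ) :
    μH[(m : ℝ)] (Metric.sphere (0 : Euc (m + 1)) κ) < ∞ := by
  obtain ⟨c, hc0, hc, hcv⟩ := exists_hausdorffMeasure_eq_smul_volume (m + 1)
  have hm' : (0 : ℝ) < m := by positivity
  have h1 := lintegral_hausdorffMeasure_fiber_le (lipschitzWith_one_norm (E := Euc (m + 1)))
    hm' (Metric.closedBall 0 (2 * κ))
  have h2 : μH[(m : ℝ) + 1] (Metric.closedBall (0 : Euc (m + 1)) (2 * κ)) < ∞ := by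
    have : ((m : ℝ) + 1) = ((m + 1 : ℕ) : ℝ) := by push_cast; rfl
    rw [this, hcv, Measure.smul_apply, smul_eq_mul]
    exact ENNReal.mul_lt_top hc.lt_top measure_closedBall_lt_top
  have h3 : ∫⁻ y in Ioo κ (2 * κ), μH[(m : ℝ)] (Metric.sphere (0 : Euc (m + 1)) κ) ≤
      ∫⁻ y, μH[(m : ℝ)] (Metric.closedBall (0 : Euc (m + 1)) (2 * κ) ∩ norm ⁻¹' {y}) := by
    refine le_trans (setLIntegral_mono' measurableSet_Ioo fun y hy => ?_) (setLIntegral_le_lintegral _ _)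
    have hy0 : 0 < y := hκ.trans hy.1
    have hL : LipschitzWith 1 (fun x : Euc (m + 1) => (κ / y) • x) := by
      refine (lipschitzWith_smul (κ / y)).weaken ?_
      rw [← NNReal.coe_le_coe, coe_nnnorm, Real.norm_of_nonneg (by positivity)]
      exact (div_le_one hy0).2 hy.1.le
    have h4 := hL.hausdorffMeasure_image_le (d := m) hm'.le
      (Metric.closedBall (0 : Euc (m + 1)) (2 * κ) ∩ norm ⁻¹' {y})
    simp only [ENNReal.coe_one, ENNReal.one_rpow, one_mul] at h4
    refine le_trans (measure_mono fun x hx => ?_) h4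
    rw [mem_sphere_zero_iff_norm] at hx
    have hn : ‖(y / κ) • x‖ = y := by
      rw [norm_smul, Real.norm_of_nonneg (by positivity), hx]; field_simp
    refine ⟨(y / κ) • x, ⟨?_, hn⟩, ?_⟩
    · rw [mem_closedBall_zero_iff, hn]; exact hy.2.le
    · simp only [smul_smul]
      rw [show κ / y * (y / κ) = 1 by field_simp, one_smul]
  have h5 := (h3.trans h1).trans_lt h2
  rw [setLIntegral_const, Real.volume_Ioo] at h5
  by_contra h6
  rw [not_lt, top_le_iff] at h6
  rw [h6, ENNReal.top_mul] at h5
  · exact lt_irrefl _ h5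
  · simp; linarith

theorem exists_lintegral_cylinder_le (hm : m ≠ 0) : ∃ C : ℝ≥0∞, C ≠ ∞ ∧ ∀ {δ : ℝ}, 0 < δ →
    ∀ {h : Euc (m + 1) → ℝ≥0∞}, Measurable h →
      ∫⁻ x in {x | ‖etail x‖ = δ}, h x ∂μH[m] ≤ C * ENNReal.ofReal (δ ^ (m - 1)) *
        ∫⁻ t : ℝ, ∫⁻ ω : Metric.sphere (0 : Euc m) 1, h (econs t (δ • (ω : Euc m)))
          ∂(volume : Measure (Euc m)).toSphere := by
  obtain ⟨c, hc0, hc, hcv⟩ := exists_hausdorffMeasure_eq_smul_volume (m + 1)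
  have hm' : (0 : ℝ) < m := by positivity
  refine ⟨2 ^ (m : ℝ) * c, by finiteness, fun {δ} hδ {h} hh => ?_⟩
  set σ := (volume : Measure (Euc m)).toSphere with hσ
  have hphi : Measurable fun p : ℝ × Metric.sphere (0 : Euc m) 1 => econs p.1 (δ • (p.2 : Euc m)) :=
    (continuous_econs.comp (by fun_prop : Continuous fun p : ℝ × Metric.sphere (0 : Euc m) 1 =>
      (p.1, δ • (p.2 : Euc m)))).measurable
  suffices H : (μH[(m : ℝ)] : Measure (Euc (m + 1))).restrict {x | ‖etail x‖ = δ} ≤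
      (2 ^ (m : ℝ) * c * ENNReal.ofReal (δ ^ (m - 1))) • ((volume : Measure ℝ).prod σ).map
        (fun p : ℝ × Metric.sphere (0 : Euc m) 1 => econs p.1 (δ • (p.2 : Euc m))) by
    refine (lintegral_mono' H le_rfl).trans_eq ?_
    rw [lintegral_smul_measure, lintegral_map hh hphi, smul_eq_mul,
      lintegral_prod _ (show Measurable fun p : ℝ × Metric.sphere (0 : Euc m) 1 =>
        h (econs p.1 (δ • (p.2 : Euc m))) from hh.comp hphi).aemeasurable]
  refine Measure.le_iff.2 fun S hS => ?_
  rw [Measure.restrict_apply hS, Measure.smul_apply, Measure.map_apply hphi hS, smul_eq_mul]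
  set N := ((volume : Measure ℝ).prod σ)
    ((fun p : ℝ × Metric.sphere (0 : Euc m) 1 => econs p.1 (δ • (p.2 : Euc m))) ⁻¹' S) with hN
  set sc : ℝ → Euc (m + 1) → Euc (m + 1) := fun lam x => econs (x 0) (lam • etail x) with hsc
  set Ahat : Set (Euc (m + 1)) := {x | ‖etail x‖ ∈ Ioo (δ / 2) δ ∧ sc (δ / ‖etail x‖) x ∈ S} with hAhat
  have hscm : Measurable fun x : Euc (m + 1) => sc (δ / ‖etail x‖) x := by
    have h0 : Measurable fun x : Euc (m + 1) => etail x := etail.continuous.measurable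
    have h1 : Measurable fun x : Euc (m + 1) => (δ / ‖etail x‖) • etail x :=
      (measurable_const.div h0.norm).smul h0
    have h2 : Measurable fun x : Euc (m + 1) => x 0 := by fun_prop
    exact continuous_econs.measurable.comp (h2.prodMk h1)
  have hAm : MeasurableSet Ahat :=
    (measurableSet_Ioo.preimage (by fun_prop : Measurable fun x : Euc (m + 1) => ‖etail x‖)).inter
      (hscm hS)
  have hvol : volume Ahat ≤ ENNReal.ofReal (δ / 2) * ENNReal.ofReal (δ ^ (m - 1)) * N := by
    have hind : Measurable (Ahat.indicator (fun _ => (1 : ℝ≥0∞))) := measurable_const.indicator hAm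
    rw [← lintegral_indicator_one hAm]
    have hG : Measurable fun z : Euc m => ∫⁻ t : ℝ, Ahat.indicator (fun _ => (1 : ℝ≥0∞)) (econs t z) :=
      Measurable.lintegral_prod_left' (f := fun p : ℝ × Euc m =>
        Ahat.indicator (fun _ => (1 : ℝ≥0∞)) (econs p.1 p.2)) (hind.comp (by fun_prop))
    change ∫⁻ x, Ahat.indicator (fun _ => (1 : ℝ≥0∞)) x ≤ _
    rw [lintegral_euc_succ hind, lintegral_euc_polar hm hG]
    have hle : ∀ ρ ∈ Ioi (0 : ℝ), ENNReal.ofReal (ρ ^ (m - 1)) *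
        ∫⁻ ω : Metric.sphere (0 : Euc m) 1, ∫⁻ t : ℝ,
          Ahat.indicator (fun _ => (1 : ℝ≥0∞)) (econs t (ρ • (ω : Euc m))) ∂volume ∂σ ≤
        (Ioo (δ / 2) δ).indicator (fun _ => ENNReal.ofReal (δ ^ (m - 1)) * N) ρ := by
      intro ρ hρ
      rw [mem_Ioi] at hρ
      have hnorm : ∀ ω : Metric.sphere (0 : Euc m) 1, ‖ρ • (ω : Euc m)‖ = ρ := fun ω => by
        rw [norm_smul, norm_eq_of_mem_sphere, mul_one, Real.norm_of_nonneg hρ.le]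
      by_cases hρ' : ρ ∈ Ioo (δ / 2) δ
      · rw [indicator_of_mem hρ']
        have hNeq : N = ∫⁻ ω : Metric.sphere (0 : Euc m) 1, ∫⁻ t : ℝ,
            Ahat.indicator (fun _ => (1 : ℝ≥0∞)) (econs t (ρ • (ω : Euc m))) ∂volume ∂σ := by
          rw [hN, ← lintegral_indicator_one (hphi hS), lintegral_prod_symm _
            (measurable_one.indicator (hphi hS)).aemeasurable]
          refine lintegral_congr fun ω => lintegral_congr fun t => ?_
          have : econs t (ρ • (ω : Euc m)) ∈ Ahat ↔ econs t (δ • (ω : Euc m)) ∈ S := by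
            simp only [hAhat, hsc, mem_ofPred_eq, etail_econs, econs_zero, hnorm, hρ', true_and,
              smul_smul]
            rw [div_mul_cancel₀ _ hρ.ne']
          by_cases h' : econs t (δ • (ω : Euc m)) ∈ S
          · rw [indicator_of_mem (this.2 h'), indicator_of_mem (by exact h')]; rfl
          · rw [indicator_of_notMem (fun h => h' (this.1 h)), indicator_of_notMem (by exact h')]
        rw [← hNeq]
        gcongr
        exact hρ'.2.le
      · rw [indicator_of_notMem hρ']
        have : ∀ (ω : Metric.sphere (0 : Euc m) 1) (t : ℝ),
            Ahat.indicator (fun _ => (1 : ℝ≥0∞)) (econs t (ρ • (ω : Euc m))) = 0 := fun ω t => by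
          rw [indicator_of_notMem]
          intro h'
          have := h'.1
          rw [etail_econs, hnorm] at this
          exact hρ' this
        simp [this]
    refine (setLIntegral_mono' measurableSet_Ioi hle).trans ?_
    refine (setLIntegral_le_lintegral _ _).trans_eq ?_
    rw [lintegral_indicator_const measurableSet_Ioo, Real.volume_Ioo]
    rw [show δ - δ / 2 = δ / 2 by ring]; ring
  have heil := lintegral_hausdorffMeasure_fiber_le (lipschitzWith_norm_etail (m := m)) hm' Ahat
  have hcast : ((m : ℝ) + 1) = ((m + 1 : ℕ) : ℝ) := by push_cast; rfl
  rw [hcast, hcv, Measure.smul_apply, smul_eq_mul] at heil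
  have h3 : ∫⁻ y in Ioo (δ / 2) δ, μH[(m : ℝ)] (S ∩ {x | ‖etail x‖ = δ}) ≤
      ∫⁻ y, 2 ^ (m : ℝ) * μH[(m : ℝ)] (Ahat ∩ (fun x : Euc (m + 1) => ‖etail x‖) ⁻¹' {y}) := by
    refine le_trans (setLIntegral_mono' measurableSet_Ioo fun y hy => ?_) (setLIntegral_le_lintegral _ _)
    have hy0 : 0 < y := (half_pos hδ).trans hy.1
    have hL : LipschitzWith 2 (sc (δ / y)) := by
      refine LipschitzWith.of_dist_le_mul fun x w => ?_
      rw [dist_eq_norm, dist_eq_norm, hsc]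
      simp only [econs_sub]
      refine le_of_sq_le_sq ?_ (by positivity)
      rw [norm_econs_sq, ← smul_sub, norm_smul, Real.norm_of_nonneg (by positivity), mul_pow,
        mul_pow, norm_sq_eq_add (x - w), map_sub]
      have h6 : δ / y ≤ 2 := by rw [div_le_iff₀ hy0]; linarith [hy.1]
      have h7 : (δ / y) ^ 2 ≤ 2 ^ 2 := by gcongr
      have h8 : (x - w) 0 = x 0 - w 0 := rfl
      rw [h8, NNReal.coe_ofNat]
      nlinarith [sq_nonneg (x 0 - w 0), sq_nonneg ‖etail x - etail w‖]
    have h4 := hL.hausdorffMeasure_image_le (d := m) hm'.le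
      (Ahat ∩ (fun x : Euc (m + 1) => ‖etail x‖) ⁻¹' {y})
    refine le_trans (measure_mono fun x hx => ?_) h4
    obtain ⟨hxS, hxd⟩ := hx
    simp only [mem_ofPred_eq] at hxd
    have hn : ‖etail (sc (y / δ) x)‖ = y := by
      rw [hsc]; simp only [etail_econs]
      rw [norm_smul, Real.norm_of_nonneg (by positivity), hxd]; field_simp
    have hback : sc (δ / y) (sc (y / δ) x) = x := by
      simp only [hsc, etail_econs, econs_zero, smul_smul]
      rw [show δ / y * (y / δ) = 1 by field_simp, one_smul, econs_etail]
    refine ⟨sc (y / δ) x, ⟨⟨by rw [hn]; exact hy, ?_⟩, hn⟩, hback⟩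
    rw [hn, hback]; exact hxS
  rw [setLIntegral_const, Real.volume_Ioo, lintegral_const_mul' _ _ (by finiteness),
    show δ - δ / 2 = δ / 2 by ring] at h3
  have h5 : ENNReal.ofReal (δ / 2) * μH[(m : ℝ)] (S ∩ {x | ‖etail x‖ = δ}) ≤
      ENNReal.ofReal (δ / 2) * (2 ^ (m : ℝ) * c * ENNReal.ofReal (δ ^ (m - 1)) * N) := by
    calc _ ≤ 2 ^ (m : ℝ) * (c * (ENNReal.ofReal (δ / 2) * ENNReal.ofReal (δ ^ (m - 1)) * N)) := by
          rw [mul_comm (ENNReal.ofReal (δ / 2))]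
          exact h3.trans (mul_le_mul_right (heil.trans (mul_le_mul_right hvol _)) _)
      _ = _ := by ring
  exact (ENNReal.mul_le_mul_iff_right (by simpa using hδ) ENNReal.ofReal_ne_top).1 h5
theorem sq_lintegral_mul_le {α : Type*} [MeasurableSpace α] {μ : Measure α} {f g : α → ℝ≥0∞}
    (hf : AEMeasurable f μ) (hg : AEMeasurable g μ) :
    (∫⁻ x, f x * g x ∂μ) ^ 2 ≤ (∫⁻ x, f x ^ 2 ∂μ) * ∫⁻ x, g x ^ 2 ∂μ := by
  have h := ENNReal.lintegral_mul_le_Lp_mul_Lq μ Real.HolderConjugate.two_two hf hg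
  simp only [Pi.mul_apply, ENNReal.rpow_two] at h
  refine (pow_le_pow_left₀ zero_le h 2).trans_eq ?_
  rw [mul_pow, ← ENNReal.rpow_natCast, ← ENNReal.rpow_natCast, ← ENNReal.rpow_mul,
    ← ENNReal.rpow_mul]
  norm_num

theorem sq_lintegral_le_weight {α : Type*} [MeasurableSpace α] {μ : Measure α} {w g : α → ℝ≥0∞}
    (hw : AEMeasurable w μ) (hg : AEMeasurable g μ) (h0 : ∀ᵐ x ∂μ, w x ≠ 0)
    (h1 : ∀ᵐ x ∂μ, w x ≠ ∞) :
    (∫⁻ x, g x ∂μ) ^ 2 ≤ (∫⁻ x, (w x)⁻¹ ∂μ) * ∫⁻ x, w x * g x ^ 2 ∂μ := by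
  have h := sq_lintegral_mul_le (μ := μ) (f := fun x => (w x)⁻¹ ^ (1 / 2 : ℝ))
    (g := fun x => w x ^ (1 / 2 : ℝ) * g x) (hw.inv.pow_const _) ((hw.pow_const _).mul hg)
  have e : ∀ c : ℝ≥0∞, (c ^ (1 / 2 : ℝ)) ^ 2 = c := fun c => by
    rw [← ENNReal.rpow_natCast, ← ENNReal.rpow_mul]; norm_num
  simp only [mul_pow, e] at h
  refine le_trans (le_of_eq ?_) h
  congr 1
  refine lintegral_congr_ae ?_
  filter_upwards [h0, h1] with x hx0 hx1
  rw [← mul_assoc, ← ENNReal.mul_rpow_of_nonneg _ _ (by norm_num), ENNReal.inv_mul_cancel hx0 hx1]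
  simp

theorem enorm_add_sq_le (a b : ℝ) : ‖a + b‖ₑ ^ 2 ≤ 2 * ‖a‖ₑ ^ 2 + 2 * ‖b‖ₑ ^ 2 := by
  rw [← ofReal_norm, ← ofReal_norm, ← ofReal_norm, ← ENNReal.ofReal_pow (norm_nonneg _),
    ← ENNReal.ofReal_pow (norm_nonneg _), ← ENNReal.ofReal_pow (norm_nonneg _), ← ENNReal.ofReal_ofNat 2,
    ← ENNReal.ofReal_mul (by norm_num), ← ENNReal.ofReal_mul (by norm_num),
    ← ENNReal.ofReal_add (by positivity) (by positivity)]
  refine ENNReal.ofReal_le_ofReal ?_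
  simp only [Real.norm_eq_abs, sq_abs]
  nlinarith [sq_nonneg (a - b)]

theorem enorm_sq_le_of_sub (a b : ℝ) : ‖a‖ₑ ^ 2 ≤ 2 * ‖b‖ₑ ^ 2 + 2 * ‖a - b‖ₑ ^ 2 := by
  have := enorm_add_sq_le b (a - b)
  simpa using this

theorem continuous_gradient {k : ℕ} {f : Euc k → ℝ} (hf : ContDiff ℝ 1 f) :
    Continuous (gradient f) :=
  (InnerProductSpace.toDual ℝ (Euc k)).symm.continuous.comp (hf.continuous_fderiv one_ne_zero)

theorem norm_gradient_eq {k : ℕ} (f : Euc k → ℝ) (x : Euc k) : ‖gradient f x‖ = ‖fderiv ℝ f x‖ := by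
  simp [gradient]

theorem enorm_sub_comp_le {k : ℕ} {f : Euc k → ℝ} (hf : ContDiff ℝ 1 f) {p : ℝ → Euc k} {x y : ℝ}
    (hxy : x ≤ y) (hp : ContDiffOn ℝ 1 p (Icc x y)) {K : ℝ≥0}
    (hK : ∀ r ∈ Ioo x y, ‖deriv p r‖₊ ≤ K) :
    ‖f (p y) - f (p x)‖ₑ ≤ K * ∫⁻ r in Ioo x y, ‖gradient f (p r)‖ₑ := by
  refine (enorm_sub_le_lintegral_deriv_of_contDiffOn_Icc (f := fun r => f (p r))
    (hf.comp_contDiffOn hp) hxy).trans ?_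
  rw [← restrict_Ioo_eq_restrict_Icc, ← lintegral_const_mul' _ _ (by finiteness)]
  refine setLIntegral_mono' measurableSet_Ioo fun r hr => ?_
  have hd : DifferentiableAt ℝ p r :=
    ((hp.differentiableOn one_ne_zero) r (Ioo_subset_Icc_self hr)).differentiableAt
      (Icc_mem_nhds hr.1 hr.2)
  have h2 := ((hf.differentiable one_ne_zero (p r)).hasFDerivAt.comp_hasDerivAt r hd.hasDerivAt).deriv
  change deriv (fun r => f (p r)) r = _ at h2
  rw [h2]
  have : ‖fderiv ℝ f (p r) (deriv p r)‖ ≤ K * ‖gradient f (p r)‖ := by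
    rw [norm_gradient_eq, mul_comm]
    refine (ContinuousLinearMap.le_opNorm _ _).trans ?_
    gcongr
    exact hK r hr
  rw [← ofReal_norm, ← ofReal_norm]
  refine (ENNReal.ofReal_le_ofReal this).trans_eq ?_
  rw [ENNReal.ofReal_mul (by positivity), ENNReal.ofReal_coe_nnreal]

/-- Affine change of variables on the unit interval. -/
theorem lintegral_unit_affine {h : ℝ → ℝ≥0∞} (s : ℝ) (hs : s = 1 ∨ s = -1) (c b : ℝ) (hb : 0 < b) :
    ∫⁻ t in {t | s * t ∈ Ioo c (c + b)}, h t =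
      ENNReal.ofReal b * ∫⁻ τ in Ioo (0 : ℝ) 1, h (s * (c + τ * b)) := by
  have hss : s * s = 1 := by rcases hs with rfl | rfl <;> norm_num
  have him : {t | s * t ∈ Ioo c (c + b)} = (fun τ => s * (c + τ * b)) '' Ioo (0 : ℝ) 1 := by
    ext t
    constructor
    · rintro ⟨h1, h2⟩
      refine ⟨(s * t - c) / b, ⟨div_pos (by linarith) hb, (div_lt_one hb).2 (by linarith)⟩, ?_⟩
      simp only
      rw [div_mul_cancel₀ _ hb.ne', add_sub_cancel, ← mul_assoc, hss, one_mul]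
    · rintro ⟨τ, ⟨h1, h2⟩, rfl⟩
      change s * (s * (c + τ * b)) ∈ Ioo c (c + b)
      rw [← mul_assoc, hss, one_mul]
      constructor <;> nlinarith
  have hs0 : s ≠ 0 := by rintro rfl; simp at hss
  have habs : |s * b| = b := by
    rw [abs_mul, abs_of_pos hb]; rcases hs with rfl | rfl <;> simp
  rw [him, lintegral_image_eq_lintegral_abs_deriv_mul (f' := fun _ => s * b) measurableSet_Ioo]
  · rw [habs, lintegral_const_mul' _ _ ENNReal.ofReal_ne_top]
  · intro τ _
    have := (((hasDerivAt_id τ).mul_const b).const_add c).const_mul s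
    simpa using this.hasDerivWithinAt
  · intro τ _ τ' _ h
    have := mul_left_cancel₀ hs0 h
    have : τ * b = τ' * b := by linarith
    exact mul_right_cancel₀ hb.ne' this
/-- The parametrization of the half annulus by segments joining the two hemispheres over the same
point of the equatorial hyperplane. -/
noncomputable def gmap (ε s τ : ℝ) (z : Euc m) : Euc (m + 1) :=
  (1 - τ) • egraph s ε z + τ • egraph s 1 z

@[simp] theorem gmap_zero (ε s : ℝ) (z : Euc m) : gmap ε s 0 z = egraph s ε z := by simp [gmap]
@[simp] theorem gmap_one (ε s : ℝ) (z : Euc m) : gmap ε s 1 z = egraph s 1 z := by simp [gmap]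

theorem continuous_gmap (ε s : ℝ) : Continuous fun p : ℝ × Euc m => gmap ε s p.1 p.2 := by
  unfold gmap
  have h1 := (continuous_egraph (m := m) s ε).comp (continuous_snd (X := ℝ))
  have h2 := (continuous_egraph (m := m) s 1).comp (continuous_snd (X := ℝ))
  exact ((continuous_const.sub continuous_fst).smul h1).add (continuous_fst.smul h2)

theorem egraph_zero (s κ : ℝ) (z : Euc m) : egraph s κ z 0 = s * √(κ ^ 2 - ‖z‖ ^ 2) := rfl

@[simp] theorem etail_egraph (s κ : ℝ) (z : Euc m) : etail (egraph s κ z) = z := etail_econs _ _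

@[simp] theorem etail_gmap (ε s τ : ℝ) (z : Euc m) : etail (gmap ε s τ z) = z := by
  simp [gmap, ← add_smul]

theorem gmap_eq_econs (ε s τ : ℝ) (z : Euc m) : gmap ε s τ z =
    econs (s * (√(ε ^ 2 - ‖z‖ ^ 2) + τ * (√(1 ^ 2 - ‖z‖ ^ 2) - √(ε ^ 2 - ‖z‖ ^ 2)))) z := by
  rw [← econs_etail (gmap ε s τ z), etail_gmap]
  congr 1
  simp only [gmap, PiLp.add_apply, PiLp.smul_apply, egraph_zero, smul_eq_mul]
  ring

theorem sqrt_gap_bounds {ε r : ℝ} (hr : 0 ≤ r) (hrε : r ≤ ε) (hε1 : ε < 1) :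
    1 - ε ≤ √(1 ^ 2 - r ^ 2) - √(ε ^ 2 - r ^ 2) ∧ √(1 ^ 2 - r ^ 2) - √(ε ^ 2 - r ^ 2) ≤ 1 := by
  have hB0 := Real.sqrt_nonneg (1 ^ 2 - r ^ 2)
  have hA0 := Real.sqrt_nonneg (ε ^ 2 - r ^ 2)
  have hB2 := Real.sq_sqrt (show 0 ≤ 1 ^ 2 - r ^ 2 by nlinarith)
  have hA2 := Real.sq_sqrt (show 0 ≤ ε ^ 2 - r ^ 2 by nlinarith)
  set A := √(ε ^ 2 - r ^ 2)
  set B := √(1 ^ 2 - r ^ 2)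
  have hB1 : B ≤ 1 := by nlinarith
  have hAε : A ≤ ε := by nlinarith
  refine ⟨?_, by linarith⟩
  have h : (B - A) * (A + B) = (1 - ε) * (1 + ε) := by nlinarith
  by_contra hlt
  rw [not_le] at hlt
  have hAB : 0 < A + B := by
    rcases (add_nonneg hA0 hB0).lt_or_eq with h' | h'
    · exact h'
    · rw [← h'] at h; nlinarith
  nlinarith

theorem segment_fiber_eq {ε s : ℝ} (hε : 0 < ε) (z : Euc m) (hs : s = 1 ∨ s = -1) :
    {t | s * t ∈ Ioo (√(ε ^ 2 - ‖z‖ ^ 2)) (√(ε ^ 2 - ‖z‖ ^ 2) +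
      (√(1 ^ 2 - ‖z‖ ^ 2) - √(ε ^ 2 - ‖z‖ ^ 2)))} =
    {t | 0 < s * t ∧ ε < ‖econs t z‖ ∧ ‖econs t z‖ < 1} := by
  ext t
  have hss : s ^ 2 = 1 := by rcases hs with rfl | rfl <;> norm_num
  have h1 : ε < ‖econs t z‖ ↔ ε ^ 2 < t ^ 2 + ‖z‖ ^ 2 := by
    rw [← norm_econs_sq]; exact (sq_lt_sq₀ hε.le (norm_nonneg _)).symm
  have h2 : ‖econs t z‖ < 1 ↔ t ^ 2 + ‖z‖ ^ 2 < 1 := by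
    rw [← norm_econs_sq, sq_lt_one_iff₀ (norm_nonneg _)]
  have h0 := norm_nonneg z
  have hst : (s * t) ^ 2 = t ^ 2 := by rw [mul_pow, hss, one_mul]
  simp only [mem_ofPred_eq, add_sub_cancel, mem_Ioo]
  rw [h1, h2, ← hst]
  constructor
  · rintro ⟨h3, h4⟩
    have h5 : 0 < s * t := lt_of_le_of_lt (Real.sqrt_nonneg _) h3
    rw [Real.sqrt_lt' h5] at h3
    rw [Real.lt_sqrt h5.le] at h4
    exact ⟨h5, by linarith, by linarith⟩
  · rintro ⟨h5, h3, h4⟩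
    rw [Real.sqrt_lt' h5, Real.lt_sqrt h5.le]
    exact ⟨by linarith, by linarith⟩

theorem lintegral_fiber_le {ε s : ℝ} (hε : 0 < ε) (hε1 : ε < 1) (hs : s = 1 ∨ s = -1)
    (z : Euc m) (hz : ‖z‖ < ε) (h : Euc (m + 1) → ℝ≥0∞) :
    ∫⁻ t in {t | 0 < s * t ∧ ε < ‖econs t z‖ ∧ ‖econs t z‖ < 1}, h (econs t z) ≤
      ∫⁻ τ in Ioo (0 : ℝ) 1, h (gmap ε s τ z) := by
  have hb := sqrt_gap_bounds (norm_nonneg z) hz.le hε1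
  rw [← segment_fiber_eq hε z hs,
    lintegral_unit_affine (h := fun t => h (econs t z)) s hs _ _ (by linarith [hb.1])]
  simp_rw [← gmap_eq_econs]
  calc _ ≤ 1 * ∫⁻ τ in Ioo (0 : ℝ) 1, h (gmap ε s τ z) := by
        gcongr
        rw [← ENNReal.ofReal_one]
        exact ENNReal.ofReal_le_ofReal hb.2
    _ = _ := one_mul _

theorem le_lintegral_fiber {ε s : ℝ} (hε : 0 < ε) (hε1 : ε < 1) (hs : s = 1 ∨ s = -1)
    (z : Euc m) (hz : ‖z‖ < ε) (h : Euc (m + 1) → ℝ≥0∞) :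
    ∫⁻ τ in Ioo (0 : ℝ) 1, h (gmap ε s τ z) ≤ (ENNReal.ofReal (1 - ε))⁻¹ *
      ∫⁻ t in {t | 0 < s * t ∧ ε < ‖econs t z‖ ∧ ‖econs t z‖ < 1}, h (econs t z) := by
  have hb := sqrt_gap_bounds (norm_nonneg z) hz.le hε1
  rw [← segment_fiber_eq hε z hs,
    lintegral_unit_affine (h := fun t => h (econs t z)) s hs _ _ (by linarith [hb.1])]
  simp_rw [← gmap_eq_econs]
  have h0 : ENNReal.ofReal (1 - ε) ≠ 0 := by simpa using hε1
  rw [← mul_assoc]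
  calc _ = 1 * ∫⁻ τ in Ioo (0 : ℝ) 1, h (gmap ε s τ z) := (one_mul _).symm
    _ = ((ENNReal.ofReal (1 - ε))⁻¹ * ENNReal.ofReal (1 - ε)) * _ := by
        rw [ENNReal.inv_mul_cancel h0 ENNReal.ofReal_ne_top]
    _ ≤ _ := by
        exact mul_le_mul_left (mul_le_mul_right (ENNReal.ofReal_le_ofReal hb.1) _) _

theorem gmap_mem {ε s τ : ℝ} (hε : 0 < ε) (hε1 : ε < 1) (hs : s = 1 ∨ s = -1)
    {z : Euc m} (hz : ‖z‖ < ε) (hτ : τ ∈ Ioo (0 : ℝ) 1) :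
    0 < s * gmap ε s τ z 0 ∧ ε < ‖gmap ε s τ z‖ ∧ ‖gmap ε s τ z‖ < 1 := by
  have hb := sqrt_gap_bounds (norm_nonneg z) hz.le hε1
  have hss : s * s = 1 := by rcases hs with rfl | rfl <;> norm_num
  rw [gmap_eq_econs, econs_zero]
  set t := s * (√(ε ^ 2 - ‖z‖ ^ 2) + τ * (√(1 ^ 2 - ‖z‖ ^ 2) - √(ε ^ 2 - ‖z‖ ^ 2))) with ht
  have : t ∈ {t | 0 < s * t ∧ ε < ‖econs t z‖ ∧ ‖econs t z‖ < 1} := by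
    rw [← segment_fiber_eq hε z hs]
    change s * t ∈ Ioo (√(ε ^ 2 - ‖z‖ ^ 2)) _
    rw [ht, ← mul_assoc, hss, one_mul]
    constructor <;> nlinarith [hτ.1, hτ.2]
  exact this

theorem lintegral_gmap_le {ε s : ℝ} (hε : 0 < ε) (hε1 : ε < 1) (hs : s = 1 ∨ s = -1)
    {P : Set (Euc m)} (hPm : MeasurableSet P) (hP : ∀ z ∈ P, ‖z‖ < ε) {T : Set (Euc (m + 1))}
    (hTm : MeasurableSet T) (hT : ∀ z ∈ P, ∀ τ ∈ Ioo (0 : ℝ) 1, gmap ε s τ z ∈ T)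
    {h : Euc (m + 1) → ℝ≥0∞} (hh : Measurable h) :
    ∫⁻ z in P, ∫⁻ τ in Ioo (0 : ℝ) 1, h (gmap ε s τ z) ≤
      (ENNReal.ofReal (1 - ε))⁻¹ * ∫⁻ x in T, h x := by
  have h0 : ENNReal.ofReal (1 - ε) ≠ 0 := by simpa using hε1
  rw [← lintegral_indicator hTm, lintegral_euc_succ (hh.indicator hTm),
    ← lintegral_const_mul' _ _ (by simpa using h0)]
  refine le_trans (setLIntegral_mono' hPm fun z hz => ?_) (setLIntegral_le_lintegral _ _)
  have h1 : ∫⁻ τ in Ioo (0 : ℝ) 1, h (gmap ε s τ z) =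
      ∫⁻ τ in Ioo (0 : ℝ) 1, T.indicator h (gmap ε s τ z) :=
    setLIntegral_congr_fun measurableSet_Ioo fun τ hτ => by
      simp only [indicator_of_mem (hT z hz τ hτ)]
  rw [h1]
  refine (le_lintegral_fiber hε hε1 hs z (hP z hz) _).trans ?_
  exact mul_le_mul_right (setLIntegral_le_lintegral _ _) _

theorem lintegral_le_gmap {ε s : ℝ} (hε : 0 < ε) (hε1 : ε < 1) (hs : s = 1 ∨ s = -1)
    {P : Set (Euc m)} (hPm : MeasurableSet P) (hP : ∀ z ∈ P, ‖z‖ < ε) {T : Set (Euc (m + 1))}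
    (hTm : MeasurableSet T)
    (hT : ∀ x ∈ T, etail x ∈ P ∧ 0 < s * x 0 ∧ ε < ‖x‖ ∧ ‖x‖ < 1)
    {h : Euc (m + 1) → ℝ≥0∞} (hh : Measurable h) :
    ∫⁻ x in T, h x ≤ ∫⁻ z in P, ∫⁻ τ in Ioo (0 : ℝ) 1, h (gmap ε s τ z) := by
  rw [← lintegral_indicator hTm, lintegral_euc_succ (hh.indicator hTm), ← lintegral_indicator hPm]
  refine lintegral_mono fun z => ?_
  by_cases hz : z ∈ P
  · rw [indicator_of_mem hz]
    refine le_trans ?_ (lintegral_fiber_le hε hε1 hs z (hP z hz) h)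
    have hmeas : MeasurableSet {t : ℝ | 0 < s * t ∧ ε < ‖econs t z‖ ∧ ‖econs t z‖ < 1} := by
      rw [← segment_fiber_eq hε z hs]
      exact measurableSet_Ioo.preimage (by fun_prop)
    rw [← lintegral_indicator hmeas]
    refine lintegral_mono fun t => ?_
    by_cases ht : econs t z ∈ T
    · rw [indicator_of_mem ht, indicator_of_mem]
      simpa using (hT _ ht).2
    · rw [indicator_of_notMem ht]; exact zero_le
  · rw [indicator_of_notMem hz, le_zero_iff]
    refine (lintegral_congr fun t => ?_).trans lintegral_zero
    rw [indicator_of_notMem]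
    intro ht
    simpa using hz (by simpa using (hT _ ht).1)

theorem enorm_sub_gmap_sq_le {ε s : ℝ} (hε1 : ε < 1) (hs : s = 1 ∨ s = -1) {z : Euc m}
    (hz : ‖z‖ ≤ ε) {f : Euc (m + 1) → ℝ} (hf : ContDiff ℝ 1 f) {τ₁ τ₂ : ℝ} (h12 : τ₁ ≤ τ₂) :
    ‖f (gmap ε s τ₂ z) - f (gmap ε s τ₁ z)‖ₑ ^ 2 ≤
      ENNReal.ofReal (τ₂ - τ₁) * ∫⁻ τ in Ioo τ₁ τ₂, ‖gradient f (gmap ε s τ z)‖ₑ ^ 2 := by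
  have hd : ∀ τ, HasDerivAt (fun τ => gmap ε s τ z) (egraph s 1 z - egraph s ε z) τ := fun τ => by
    unfold gmap
    have h1 := (((hasDerivAt_id τ).const_sub 1).smul_const (egraph s ε z)).add
      ((hasDerivAt_id τ).smul_const (egraph s 1 z))
    refine h1.congr_deriv ?_
    rw [one_smul, neg_one_smul]; abel
  have hK : ‖egraph s 1 z - egraph s ε z‖ ≤ 1 := by
    have hb := sqrt_gap_bounds (norm_nonneg z) hz hε1
    have hss : s ^ 2 = 1 := by rcases hs with rfl | rfl <;> norm_num
    refine le_of_sq_le_sq ?_ zero_le_one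
    rw [egraph, egraph, econs_sub, norm_econs_sq, sub_self, norm_zero, ← mul_sub, mul_pow, hss]
    nlinarith
  have hc : ContDiff ℝ 1 (fun τ => gmap ε s τ z) := by unfold gmap; fun_prop
  have h := enorm_sub_comp_le hf h12 hc.contDiffOn (K := 1) fun r _ => by
    rw [(hd r).deriv]; exact hK
  rw [ENNReal.coe_one, one_mul] at h
  refine (pow_le_pow_left₀ zero_le h 2).trans ?_
  have hm : Continuous fun τ => ‖gradient f (gmap ε s τ z)‖ₑ :=
    ((continuous_gradient hf).comp ((continuous_gmap ε s).comp (by fun_prop :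
      Continuous fun τ : ℝ => (τ, z)))).enorm
  have h2 := sq_lintegral_le_weight (μ := volume.restrict (Ioo τ₁ τ₂)) (w := fun _ => 1)
    (g := fun τ => ‖gradient f (gmap ε s τ z)‖ₑ) aemeasurable_const hm.aemeasurable (by simp) (by simp)
  simpa using h2

theorem contDiffAt_egraph_ray {s κ : ℝ} (hκ : 0 < κ) {ω : Euc m} (hω : ‖ω‖ = 1) {r : ℝ}
    (hr0 : 0 ≤ r) (hr : r < κ / 2) : ContDiffAt ℝ 1 (fun r : ℝ => egraph s κ (r • ω)) r := by
  have h1 : ContDiffAt ℝ 1 (fun r : ℝ => √(κ ^ 2 - r ^ 2)) r := by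
    refine ContDiffAt.sqrt (by fun_prop) ?_
    nlinarith
  have h2 : ContDiffAt ℝ 1 (fun r : ℝ => econsL m (s * √(κ ^ 2 - r ^ 2), r • ω)) r :=
    (econsL m).contDiff.contDiffAt.comp r ((contDiffAt_const.mul h1).prodMk (by fun_prop))
  have h3 : (fun r : ℝ => egraph s κ (r • ω)) = fun r : ℝ => econsL m (s * √(κ ^ 2 - r ^ 2), r • ω) := by
    funext r
    simp [egraph, econs, norm_smul, hω]
  rw [h3]; exact h2

theorem norm_deriv_egraph_ray_le {s κ : ℝ} (hs : s = 1 ∨ s = -1) (hκ : 0 < κ) {ω : Euc m}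
    (hω : ‖ω‖ = 1) {r : ℝ} (hr0 : 0 < r) (hr : r < κ / 2) :
    ‖deriv (fun r : ℝ => egraph s κ (r • ω)) r‖ ≤ 2 := by
  have := norm_deriv_le_of_lipschitzOn (f := fun r : ℝ => egraph s κ (r • ω)) (x₀ := r)
    (s := Ioo 0 (κ / 2)) (C := 2) (Ioo_mem_nhds hr0 hr) ?_
  · simpa using this
  · refine LipschitzOnWith.of_dist_le_mul fun x hx y hy => ?_
    have h := (lipschitzOnWith_egraph (m := m) hs hκ).dist_le_mul (x • ω) ?_ (y • ω) ?_
    · refine h.trans_eq ?_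
      rw [dist_eq_norm, ← sub_smul, norm_smul, hω, mul_one, dist_eq_norm]
    all_goals rw [mem_closedBall_zero_iff, norm_smul, hω, mul_one, Real.norm_eq_abs, abs_of_pos]
    exacts [hx.2.le, hx.1, hy.2.le, hy.1]

theorem enorm_sub_gmap_ray_sq_le {ε s : ℝ} (hε : 0 < ε) (hε1 : ε < 1) (hs : s = 1 ∨ s = -1)
    {ω : Euc m} (hω : ‖ω‖ = 1) {f : Euc (m + 1) → ℝ} (hf : ContDiff ℝ 1 f) {τ : ℝ}
    (hτ : τ ∈ Ioo (0 : ℝ) 1) {ρ ρ₁ : ℝ} (hρ : 0 < ρ) (h1 : ρ ≤ ρ₁) (hρ₁ : ρ₁ < ε / 2) :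
    ‖f (gmap ε s τ (ρ₁ • ω)) - f (gmap ε s τ (ρ • ω))‖ₑ ^ 2 ≤
      4 * (∫⁻ r in Ioo ρ ρ₁, (ENNReal.ofReal r)⁻¹) *
        ∫⁻ r in Ioo ρ ρ₁, ENNReal.ofReal r * ‖gradient f (gmap ε s τ (r • ω))‖ₑ ^ 2 := by
  have hcd : ∀ r ∈ Icc ρ ρ₁, ContDiffAt ℝ 1 (fun r : ℝ => gmap ε s τ (r • ω)) r := fun r hr => by
    have h2 := contDiffAt_egraph_ray (s := s) hε hω (hρ.le.trans hr.1) (hr.2.trans_lt hρ₁)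
    have h3 := contDiffAt_egraph_ray (s := s) one_pos hω (hρ.le.trans hr.1)
      (hr.2.trans_lt (by linarith))
    exact (h2.const_smul (1 - τ)).add (h3.const_smul τ)
  have h := enorm_sub_comp_le hf h1 (p := fun r : ℝ => gmap ε s τ (r • ω)) (K := 2)
    (fun r hr => (hcd r hr).contDiffWithinAt) fun r hr => by
      have hr0 : 0 < r := hρ.trans hr.1
      have hd1 := ((contDiffAt_egraph_ray (s := s) hε hω hr0.le
        (hr.2.trans hρ₁)).differentiableAt one_ne_zero).hasDerivAt
      have hd2 := ((contDiffAt_egraph_ray (s := s) one_pos hω hr0.le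
        (hr.2.trans (by linarith))).differentiableAt one_ne_zero).hasDerivAt
      have hd := ((hd1.const_smul (1 - τ)).add (hd2.const_smul τ)).deriv
      change deriv (fun r : ℝ => gmap ε s τ (r • ω)) r = _ at hd
      rw [hd, ← NNReal.coe_le_coe, coe_nnnorm]
      have e1 := norm_deriv_egraph_ray_le hs hε hω hr0 (hr.2.trans hρ₁)
      have e2 := norm_deriv_egraph_ray_le hs one_pos hω hr0 (hr.2.trans (by linarith))
      refine (norm_add_le _ _).trans ?_
      rw [norm_smul, norm_smul, Real.norm_of_nonneg hτ.1.le,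
        Real.norm_of_nonneg (sub_nonneg.2 hτ.2.le), NNReal.coe_ofNat]
      nlinarith [hτ.1, hτ.2]
  refine (pow_le_pow_left₀ zero_le h 2).trans ?_
  have hm : Continuous fun r : ℝ => ‖gradient f (gmap ε s τ (r • ω))‖ₑ :=
    ((continuous_gradient hf).comp ((continuous_gmap ε s).comp (by fun_prop :
      Continuous fun r : ℝ => (τ, r • ω)))).enorm
  have h2 := sq_lintegral_le_weight (μ := volume.restrict (Ioo ρ ρ₁)) (w := fun r => ENNReal.ofReal r)
    (g := fun r => ‖gradient f (gmap ε s τ (r • ω))‖ₑ) (by fun_prop) hm.aemeasurable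
    ((ae_restrict_mem measurableSet_Ioo).mono fun r hr => by simpa using hρ.trans hr.1) (by simp)
  rw [mul_pow, mul_assoc]
  have h4 : ((2 : ℝ≥0) : ℝ≥0∞) ^ 2 = 4 := by norm_num
  rw [h4]
  gcongr

theorem lintegral_inv_ofReal_eq {ρ ρ₁ : ℝ} (hρ : 0 < ρ) (h1 : ρ ≤ ρ₁) :
    ∫⁻ r in Ioo ρ ρ₁, (ENNReal.ofReal r)⁻¹ = ENNReal.ofReal (Real.log (ρ₁ / ρ)) := by
  rw [← integral_inv_of_pos hρ (hρ.trans_le h1), intervalIntegral.integral_of_le h1,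
    integral_Ioc_eq_integral_Ioo, ofReal_integral_eq_lintegral_ofReal]
  · exact setLIntegral_congr_fun measurableSet_Ioo fun r hr =>
      (ENNReal.ofReal_inv_of_pos (hρ.trans hr.1)).symm
  · have : IntervalIntegrable (fun x : ℝ => x⁻¹) volume ρ ρ₁ :=
      intervalIntegral.intervalIntegrable_inv (fun x hx => by
        rw [uIcc_of_le h1] at hx; exact (hρ.trans_le hx.1).ne') continuousOn_id
    exact ((intervalIntegrable_iff_integrableOn_Ioc_of_le h1).1 this).mono_set Ioo_subset_Ioc_self
  · exact (ae_restrict_mem measurableSet_Ioo).mono fun r hr => inv_nonneg.2 (hρ.trans hr.1).le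
/-- The Dirichlet energy of `f` on `Ω`. -/
noncomputable def ener (Ω : Set (Euc (m + 1))) (f : Euc (m + 1) → ℝ) : ℝ≥0∞ :=
  ∫⁻ x in Ω, ‖gradient f x‖ₑ ^ 2

/-- The square of the `L²` norm of `f` on the frontier of `Ω`. -/
noncomputable def bdry (Ω : Set (Euc (m + 1))) (f : Euc (m + 1) → ℝ) : ℝ≥0∞ :=
  ∫⁻ x in frontier Ω, ‖f x‖ₑ ^ 2 ∂μH[m]

/-- `Ω` contains the part of the half annulus of sign `s` lying over `ρ₀ < ‖z‖ < ε / 2`, and its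
frontier contains the two spherical caps bounding this part. -/
structure ContainsShell (ε s ρ₀ : ℝ) (Ω : Set (Euc (m + 1))) : Prop where
  meas : MeasurableSet Ω
  mem : ∀ z : Euc m, ρ₀ < ‖z‖ → ‖z‖ < ε / 2 → ∀ τ ∈ Ioo (0 : ℝ) 1, gmap ε s τ z ∈ Ω
  cap : ∀ z : Euc m, ρ₀ < ‖z‖ → ‖z‖ < ε / 2 → ∀ κ, κ = ε ∨ κ = 1 → egraph s κ z ∈ frontier Ω

/-- The mean of `h` over the unit segment of parameters and the sphere of radius `ρ`. -/
noncomputable def ringInt (ε s : ℝ) (h : Euc (m + 1) → ℝ≥0∞) (ρ : ℝ) : ℝ≥0∞ :=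
  ∫⁻ ω : Metric.sphere (0 : Euc m) 1, ∫⁻ τ in Ioo (0 : ℝ) 1, h (gmap ε s τ (ρ • (ω : Euc m)))
    ∂(volume : Measure ℝ) ∂(volume : Measure (Euc m)).toSphere

theorem lintegral_polar_set (hm : m ≠ 0) {I : Set ℝ} (hI : MeasurableSet I) (hI0 : I ⊆ Ioi 0)
    {g : Euc m → ℝ≥0∞} (hg : Measurable g) :
    ∫⁻ z in {z | ‖z‖ ∈ I}, g z = ∫⁻ ρ in I, ENNReal.ofReal (ρ ^ (m - 1)) *
      ∫⁻ ω : Metric.sphere (0 : Euc m) 1, g (ρ • (ω : Euc m)) ∂(volume : Measure (Euc m)).toSphere := by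
  have hP : MeasurableSet {z : Euc m | ‖z‖ ∈ I} := measurable_norm hI
  rw [← lintegral_indicator hP, lintegral_euc_polar hm (hg.indicator hP), ← lintegral_indicator hI,
    ← lintegral_indicator measurableSet_Ioi]
  refine lintegral_congr fun ρ => ?_
  by_cases h0 : ρ ∈ Ioi (0 : ℝ)
  · have hn : ∀ ω : Metric.sphere (0 : Euc m) 1, ‖ρ • (ω : Euc m)‖ = ρ := fun ω => by
      rw [norm_smul, norm_eq_of_mem_sphere, mul_one, Real.norm_of_nonneg (le_of_lt h0)]
    rw [indicator_of_mem h0]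
    by_cases hρ : ρ ∈ I
    · rw [indicator_of_mem hρ]
      congr 1
      refine lintegral_congr fun ω => indicator_of_mem ?_ _
      rw [mem_ofPred_eq, hn]; exact hρ
    · rw [indicator_of_notMem hρ]
      refine mul_eq_zero.2 (Or.inr ((lintegral_congr fun ω => ?_).trans lintegral_zero))
      refine indicator_of_notMem (fun h => hρ ?_) _
      rw [mem_ofPred_eq, hn] at h; exact h
  · rw [indicator_of_notMem h0, indicator_of_notMem fun h => h0 (hI0 h)]

theorem measurable_lintegral_gmap (ε s : ℝ) {h : Euc (m + 1) → ℝ≥0∞} (hh : Measurable h) :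
    Measurable fun z : Euc m => ∫⁻ τ in Ioo (0 : ℝ) 1, h (gmap ε s τ z) :=
  Measurable.lintegral_prod_left' (f := fun p : ℝ × Euc m => h (gmap ε s p.1 p.2))
    (hh.comp (continuous_gmap ε s).measurable)

theorem lintegral_gmap_polar (hm : m ≠ 0) (ε s : ℝ) {I : Set ℝ} (hI : MeasurableSet I)
    (hI0 : I ⊆ Ioi 0) {h : Euc (m + 1) → ℝ≥0∞} (hh : Measurable h) :
    ∫⁻ z in {z : Euc m | ‖z‖ ∈ I}, ∫⁻ τ in Ioo (0 : ℝ) 1, h (gmap ε s τ z) =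
      ∫⁻ ρ in I, ENNReal.ofReal (ρ ^ (m - 1)) * ringInt ε s h ρ :=
  lintegral_polar_set hm hI hI0 (measurable_lintegral_gmap ε s hh)

theorem measurable_ringInt (ε s : ℝ) {h : Euc (m + 1) → ℝ≥0∞} (hh : Measurable h) :
    Measurable (ringInt ε s h) :=
  Measurable.lintegral_prod_right' (f := fun p : ℝ × Metric.sphere (0 : Euc m) 1 =>
    ∫⁻ τ in Ioo (0 : ℝ) 1, h (gmap ε s τ (p.1 • (p.2 : Euc m))))
    ((measurable_lintegral_gmap ε s hh).comp (by fun_prop))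

theorem exists_mul_le_setLIntegral_Ioo {g : ℝ → ℝ≥0∞} (hg : Measurable g) {x y : ℝ} (hxy : x < y) :
    ∃ r ∈ Ioo x y, ENNReal.ofReal (y - x) * g r ≤ ∫⁻ u in Ioo x y, g u := by
  have h0 : ENNReal.ofReal (y - x) ≠ 0 := by simpa using hxy
  obtain ⟨r, hr, h⟩ := exists_le_setLAverage (μ := volume) (s := Ioo x y) (f := g)
    (by rw [Real.volume_Ioo]; exact h0) (by simp) hg.aemeasurable
  rw [setLAverage_eq, Real.volume_Ioo] at h
  refine ⟨r, hr, ?_⟩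
  rw [mul_comm]
  exact (ENNReal.le_div_iff_mul_le (Or.inl h0) (Or.inl ENNReal.ofReal_ne_top)).1 h

theorem measurable_enorm_sq {f : Euc (m + 1) → ℝ} (hf : ContDiff ℝ 1 f) :
    Measurable fun x => ‖f x‖ₑ ^ 2 := hf.continuous.enorm.measurable.pow_const 2

theorem measurable_enorm_gradient_sq {f : Euc (m + 1) → ℝ} (hf : ContDiff ℝ 1 f) :
    Measurable fun x => ‖gradient f x‖ₑ ^ 2 := (continuous_gradient hf).enorm.measurable.pow_const 2

/-- Control of `f` away from the axis by its energy and its boundary values. -/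
theorem exists_far_le (m : ℕ) {ε : ℝ} (hε : 0 < ε) (hε1 : ε < 1) : ∃ C : ℝ≥0∞, C ≠ ∞ ∧
    ∀ {s ρ₀ : ℝ} {Ω : Set (Euc (m + 1))} {f : Euc (m + 1) → ℝ}, (s = 1 ∨ s = -1) → ρ₀ ≤ ε / 4 →
      ContainsShell ε s ρ₀ Ω → ContDiff ℝ 1 f →
      ∫⁻ z in {z : Euc m | ‖z‖ ∈ Ioo (ε / 4) (ε / 2)}, ∫⁻ τ in Ioo (0 : ℝ) 1,
        ‖f (gmap ε s τ z)‖ₑ ^ 2 ≤ C * (ener Ω f + bdry Ω f) := by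
  obtain ⟨C1, hC1, hcap⟩ := exists_lintegral_egraph_le m
  have h0 : (ENNReal.ofReal (1 - ε))⁻¹ ≠ ∞ := by simpa using hε1
  refine ⟨2 * C1 + 2 * (ENNReal.ofReal (1 - ε))⁻¹, by finiteness, ?_⟩
  intro s ρ₀ Ω f hs hρ₀ hΩ hf
  set P := {z : Euc m | ‖z‖ ∈ Ioo (ε / 4) (ε / 2)} with hPdef
  have hPm : MeasurableSet P := measurable_norm measurableSet_Ioo
  have hmf : Measurable fun z : Euc m => 2 * ‖f (egraph s 1 z)‖ₑ ^ 2 :=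
    ((measurable_enorm_sq hf).comp (continuous_egraph s 1).measurable).const_mul _
  have h1 : ∀ z ∈ P, ∫⁻ τ in Ioo (0 : ℝ) 1, ‖f (gmap ε s τ z)‖ₑ ^ 2 ≤
      2 * ‖f (egraph s 1 z)‖ₑ ^ 2 +
        2 * ∫⁻ τ in Ioo (0 : ℝ) 1, ‖gradient f (gmap ε s τ z)‖ₑ ^ 2 := by
    intro z hz
    calc _ ≤ ∫⁻ τ in Ioo (0 : ℝ) 1, (2 * ‖f (egraph s 1 z)‖ₑ ^ 2 +
        2 * ∫⁻ τ in Ioo (0 : ℝ) 1, ‖gradient f (gmap ε s τ z)‖ₑ ^ 2) := by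
          refine setLIntegral_mono' measurableSet_Ioo fun τ hτ => ?_
          refine (enorm_sq_le_of_sub _ (f (egraph s 1 z))).trans ?_
          have h2 := enorm_sub_gmap_sq_le hε1 hs (z := z) (by linarith [hz.2]) hf hτ.2.le
          rw [gmap_one] at h2
          rw [enorm_sub_rev]
          gcongr
          refine h2.trans ?_
          calc _ ≤ 1 * ∫⁻ τ in Ioo (0 : ℝ) 1, ‖gradient f (gmap ε s τ z)‖ₑ ^ 2 := by
                refine mul_le_mul' ?_ (lintegral_mono_set (Ioo_subset_Ioo_left hτ.1.le))
                rw [← ENNReal.ofReal_one]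
                exact ENNReal.ofReal_le_ofReal (by linarith [hτ.1])
            _ = _ := one_mul _
      _ = _ := by simp
  refine (setLIntegral_mono' hPm h1).trans ?_
  rw [lintegral_add_left hmf, lintegral_const_mul' _ _ (by simp), lintegral_const_mul' _ _ (by simp)]
  have hz1 : ∀ z ∈ P, ρ₀ < ‖z‖ := fun z hz => hρ₀.trans_lt hz.1
  have h3 := hcap (s := s) (κ := 1) (P := P) (T := frontier Ω)
    (by rintro _ ⟨z, hz, rfl⟩; exact hΩ.cap z (hz1 z hz) hz.2 1 (Or.inr rfl)) (measurable_enorm_sq hf)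
  have h4 := lintegral_gmap_le hε hε1 hs hPm (fun z hz => by linarith [hz.2]) hΩ.meas
    (fun z hz => hΩ.mem z (hz1 z hz) hz.2) (measurable_enorm_gradient_sq hf)
  calc _ ≤ 2 * (C1 * bdry Ω f) + 2 * ((ENNReal.ofReal (1 - ε))⁻¹ * ener Ω f) := by
        unfold bdry ener; gcongr
    _ ≤ 2 * (C1 * (ener Ω f + bdry Ω f)) +
        2 * ((ENNReal.ofReal (1 - ε))⁻¹ * (ener Ω f + bdry Ω f)) := by
        gcongr
        · exact le_add_self
        · exact le_self_add
    _ = _ := by ring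

theorem one_le_one_add_log {ε ρ : ℝ} (hρ : 0 < ρ) (h : ρ ≤ ε) : 1 ≤ 1 + Real.log (ε / ρ) := by
  linarith [Real.log_nonneg ((one_le_div hρ).2 h)]

theorem mul_one_add_log_le {ε ρ : ℝ} (hρ : 0 < ρ) (hε : 0 < ε) : ρ * (1 + Real.log (ε / ρ)) ≤ ε := by
  have h := Real.log_le_sub_one_of_pos (div_pos hε hρ)
  calc _ ≤ ρ * (ε / ρ) := by gcongr; linarith
    _ = ε := by field_simp

theorem lintegral_rotate {α β γ : Type*} [MeasurableSpace α] [MeasurableSpace β]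
    [MeasurableSpace γ] {μ : Measure α} {ν : Measure β} {κ : Measure γ} [SFinite μ] [SFinite ν]
    [SFinite κ] {F : α → β → γ → ℝ≥0∞}
    (hF : Measurable fun p : (α × γ) × β => F p.1.1 p.2 p.1.2) :
    ∫⁻ x, ∫⁻ y, ∫⁻ z, F x y z ∂κ ∂ν ∂μ = ∫⁻ z, ∫⁻ x, ∫⁻ y, F x y z ∂ν ∂μ ∂κ := by
  rw [lintegral_lintegral_swap (μ := κ)]
  · refine lintegral_congr fun x => lintegral_lintegral_swap (Measurable.aemeasurable ?_)
    exact hF.comp (by fun_prop : Measurable fun p : β × γ => ((x, p.2), p.1))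
  · have h : Measurable fun p : α × γ => ∫⁻ y, F p.1 y p.2 ∂ν := hF.lintegral_prod_right'
    exact (h.comp measurable_swap).aemeasurable

theorem lintegral_ray_eq (ε s : ℝ) {h : Euc (m + 1) → ℝ≥0∞} (hh : Measurable h) (I : Set ℝ) :
    ∫⁻ ω : Metric.sphere (0 : Euc m) 1, ∫⁻ τ in Ioo (0 : ℝ) 1, ∫⁻ u in I,
      ENNReal.ofReal u * h (gmap ε s τ (u • (ω : Euc m)))
      ∂(volume : Measure ℝ) ∂(volume : Measure ℝ) ∂(volume : Measure (Euc m)).toSphere =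
    ∫⁻ u in I, ENNReal.ofReal u * ringInt ε s h u := by
  rw [lintegral_rotate]
  · refine lintegral_congr fun u => ?_
    rw [ringInt, ← lintegral_const_mul' _ _ ENNReal.ofReal_ne_top]
    refine lintegral_congr fun ω => ?_
    rw [lintegral_const_mul' _ _ ENNReal.ofReal_ne_top]
  · have h1 : Continuous fun p : (Metric.sphere (0 : Euc m) 1 × ℝ) × ℝ =>
        (p.2, p.1.2 • (p.1.1 : Euc m)) := by fun_prop
    have h2 : Measurable fun p : (Metric.sphere (0 : Euc m) 1 × ℝ) × ℝ => ENNReal.ofReal p.1.2 := by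
      fun_prop
    exact h2.mul (hh.comp ((continuous_gmap ε s).comp h1).measurable)

theorem ringInt_le_add {ε s : ℝ} (hε : 0 < ε) (hε1 : ε < 1) (hs : s = 1 ∨ s = -1)
    {f : Euc (m + 1) → ℝ} (hf : ContDiff ℝ 1 f) {ρ r : ℝ} (hρ : 0 < ρ) (hρr : ρ ≤ r)
    (hr : r < ε / 2) :
    ringInt ε s (fun x => ‖f x‖ₑ ^ 2) ρ ≤ 2 * ringInt ε s (fun x => ‖f x‖ₑ ^ 2) r +
      8 * ENNReal.ofReal (Real.log (r / ρ)) *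
      ∫⁻ ω : Metric.sphere (0 : Euc m) 1, ∫⁻ τ in Ioo (0 : ℝ) 1, ∫⁻ u in Ioo ρ r,
      ENNReal.ofReal u * ‖gradient f (gmap ε s τ (u • (ω : Euc m)))‖ₑ ^ 2
      ∂(volume : Measure ℝ) ∂(volume : Measure ℝ) ∂(volume : Measure (Euc m)).toSphere := by
  have hK : 8 * ENNReal.ofReal (Real.log (r / ρ)) ≠ ∞ := by finiteness
  have hc1 : Measurable fun p : Metric.sphere (0 : Euc m) 1 × ℝ =>
      ‖f (gmap ε s p.2 (r • (p.1 : Euc m)))‖ₑ ^ 2 :=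
    (measurable_enorm_sq hf).comp ((continuous_gmap ε s).comp (by fun_prop :
      Continuous fun p : Metric.sphere (0 : Euc m) 1 × ℝ => (p.2, r • (p.1 : Euc m)))).measurable
  have h2 : (2 : ℝ≥0∞) ≠ ∞ := by simp
  have hin : ∀ ω : Metric.sphere (0 : Euc m) 1, ∀ τ ∈ Ioo (0 : ℝ) 1,
      ‖f (gmap ε s τ (ρ • (ω : Euc m)))‖ₑ ^ 2 ≤ 2 * ‖f (gmap ε s τ (r • (ω : Euc m)))‖ₑ ^ 2 +
        8 * ENNReal.ofReal (Real.log (r / ρ)) * ∫⁻ u in Ioo ρ r,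
          ENNReal.ofReal u * ‖gradient f (gmap ε s τ (u • (ω : Euc m)))‖ₑ ^ 2 := by
    intro ω τ hτ
    refine (enorm_sq_le_of_sub _ (f (gmap ε s τ (r • (ω : Euc m))))).trans ?_
    have h6 := enorm_sub_gmap_ray_sq_le hε hε1 hs (norm_eq_of_mem_sphere ω) hf hτ hρ hρr hr
    rw [lintegral_inv_ofReal_eq hρ hρr, enorm_sub_rev] at h6
    refine add_le_add le_rfl ((mul_le_mul_right h6 2).trans_eq ?_)
    rw [← mul_assoc, ← mul_assoc]
    norm_num
  unfold ringInt
  rw [← lintegral_const_mul' _ _ h2, ← lintegral_const_mul' _ _ hK,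
    ← lintegral_add_left (hc1.lintegral_prod_right'.const_mul 2)]
  refine lintegral_mono fun ω => ?_
  have hc2 : Measurable fun τ : ℝ => 2 * ‖f (gmap ε s τ (r • (ω : Euc m)))‖ₑ ^ 2 :=
    (hc1.comp (by fun_prop : Measurable fun τ : ℝ => (ω, τ))).const_mul 2
  change _ ≤ 2 * (∫⁻ τ in Ioo (0 : ℝ) 1, ‖f (gmap ε s τ (r • (ω : Euc m)))‖ₑ ^ 2) + _
  rw [← lintegral_const_mul' _ _ h2, ← lintegral_const_mul' _ _ hK, ← lintegral_add_left hc2]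
  exact setLIntegral_mono' measurableSet_Ioo (hin ω)

/-- Logarithmic bound for the mean square of `f` on thin rings around the axis. -/
theorem exists_ringInt_le (hm : 2 ≤ m) {ε : ℝ} (hε : 0 < ε) (hε1 : ε < 1) : ∃ C : ℝ≥0∞, C ≠ ∞ ∧
    ∀ {s ρ₀ : ℝ} {Ω : Set (Euc (m + 1))} {f : Euc (m + 1) → ℝ}, (s = 1 ∨ s = -1) →
      ContainsShell ε s ρ₀ Ω → ContDiff ℝ 1 f → ∀ {ρ : ℝ}, 0 < ρ → ρ₀ ≤ ρ → ρ ≤ ε / 4 →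
      ENNReal.ofReal (ρ ^ (m - 1)) * ringInt ε s (fun x => ‖f x‖ₑ ^ 2) ρ ≤
        C * ENNReal.ofReal (ρ * (1 + Real.log (ε / ρ))) * (ener Ω f + bdry Ω f) := by
  obtain ⟨C1, hC1, hfar⟩ := exists_far_le m hε hε1
  have h0 : (ENNReal.ofReal (1 - ε))⁻¹ ≠ ∞ := by simpa using hε1
  set D := ENNReal.ofReal (ε / 4 * (ε / 4) ^ (m - 1)) with hD
  have hD0 : D⁻¹ ≠ ∞ := by
    rw [hD, ENNReal.inv_ne_top]
    have : 0 < ε / 4 * (ε / 4) ^ (m - 1) := by positivity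
    simpa using this
  have hD1 : D ≠ 0 := by rwa [ENNReal.inv_ne_top] at hD0
  refine ⟨2 * (D⁻¹ * C1) + 8 * (ENNReal.ofReal (1 - ε))⁻¹, by finiteness, ?_⟩
  intro s ρ₀ Ω f hs hΩ hf ρ hρ hρ₀ hρε
  have hm0 : m ≠ 0 := by omega
  have hsub : Ioo (ε / 4) (ε / 2) ⊆ Ioi 0 := fun r hr => lt_trans (by positivity) hr.1
  have hmsq := measurable_enorm_sq hf
  have hmgr := measurable_enorm_gradient_sq hf
  have h1 := hfar hs (hρ₀.trans hρε) hΩ hf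
  rw [lintegral_gmap_polar (h := fun x => ‖f x‖ₑ ^ 2) hm0 ε s measurableSet_Ioo hsub hmsq] at h1
  obtain ⟨r, hr, h2⟩ := exists_mul_le_setLIntegral_Ioo
    (g := fun ρ => ENNReal.ofReal (ρ ^ (m - 1)) * ringInt ε s (fun x => ‖f x‖ₑ ^ 2) ρ)
    ((by fun_prop : Measurable fun ρ : ℝ => ENNReal.ofReal (ρ ^ (m - 1))).mul
      (measurable_ringInt ε s hmsq)) (show ε / 4 < ε / 2 by linarith)
  set J := ringInt ε s (fun x => ‖f x‖ₑ ^ 2) with hJ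
  set EB := ener Ω f + bdry Ω f with hEB
  have h3 : J r ≤ D⁻¹ * C1 * EB := by
    have h4 : D * J r ≤ C1 * EB := by
      refine le_trans ?_ (h2.trans h1)
      rw [← mul_assoc, ← ENNReal.ofReal_mul (by linarith)]
      refine mul_le_mul_left (ENNReal.ofReal_le_ofReal ?_) _
      rw [show ε / 2 - ε / 4 = ε / 4 by ring]
      gcongr
      exact hr.1.le
    calc J r = D⁻¹ * (D * J r) := by
          rw [← mul_assoc, ENNReal.inv_mul_cancel hD1 ENNReal.ofReal_ne_top, one_mul]
      _ ≤ D⁻¹ * (C1 * EB) := by gcongr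
      _ = _ := by ring
  have hρr : ρ < r := hρε.trans_lt hr.1
  set G : ℝ≥0∞ := ∫⁻ ω : Metric.sphere (0 : Euc m) 1, ∫⁻ τ in Ioo (0 : ℝ) 1, ∫⁻ u in Ioo ρ r,
      ENNReal.ofReal u * ‖gradient f (gmap ε s τ (u • (ω : Euc m)))‖ₑ ^ 2
      ∂(volume : Measure ℝ) ∂(volume : Measure ℝ) ∂(volume : Measure (Euc m)).toSphere with hG
  have h5 : J ρ ≤ 2 * J r + 8 * ENNReal.ofReal (Real.log (r / ρ)) * G :=
    ringInt_le_add hε hε1 hs hf hρ hρr.le hr.2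
  have h6 : ENNReal.ofReal (ρ ^ (m - 1)) * G ≤
      ENNReal.ofReal ρ * ((ENNReal.ofReal (1 - ε))⁻¹ * EB) := by
    have hswap : G = ∫⁻ u in Ioo ρ r, ENNReal.ofReal u *
        ringInt ε s (fun x => ‖gradient f x‖ₑ ^ 2) u := lintegral_ray_eq ε s hmgr _
    have hsub2 : Ioo ρ r ⊆ Ioi 0 := fun u hu => hρ.trans hu.1
    have hP2 : MeasurableSet {z : Euc m | ‖z‖ ∈ Ioo ρ r} := measurable_norm measurableSet_Ioo
    have h7 := lintegral_gmap_le hε hε1 hs hP2 (fun z hz => by linarith [hz.2, hr.2]) hΩ.meas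
      (fun z hz => hΩ.mem z (hρ₀.trans_lt hz.1) (hz.2.trans hr.2)) hmgr
    rw [lintegral_gmap_polar (h := fun x => ‖gradient f x‖ₑ ^ 2) hm0 ε s measurableSet_Ioo hsub2
      hmgr] at h7
    have h8 : ∫⁻ x in Ω, ‖gradient f x‖ₑ ^ 2 ≤ EB := le_self_add
    rw [hswap, ← lintegral_const_mul' _ _ (by finiteness)]
    refine le_trans ?_ (mul_le_mul_right (h7.trans (mul_le_mul_right h8 _)) _)
    rw [← lintegral_const_mul' _ _ (by finiteness)]
    refine setLIntegral_mono' measurableSet_Ioo fun u hu => ?_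
    rw [← mul_assoc, ← mul_assoc, ← ENNReal.ofReal_mul (by positivity), ← ENNReal.ofReal_mul hρ.le]
    refine mul_le_mul_left (ENNReal.ofReal_le_ofReal ?_) _
    obtain ⟨k, rfl⟩ : ∃ k, m = k + 2 := ⟨m - 2, by omega⟩
    simp only [Nat.add_succ_sub_one, pow_succ]
    have : ρ ^ k ≤ u ^ k := pow_le_pow_left₀ hρ.le hu.1.le k
    have hu0 : 0 < u := hρ.trans hu.1
    nlinarith [mul_pos hρ hu0]
  have h9 : ENNReal.ofReal (ρ ^ (m - 1)) ≤ ENNReal.ofReal ρ := by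
    refine ENNReal.ofReal_le_ofReal ?_
    calc ρ ^ (m - 1) ≤ ρ ^ 1 := pow_le_pow_of_le_one hρ.le (by linarith) (by omega)
      _ = ρ := pow_one ρ
  have hρε' : ρ ≤ ε := by linarith
  have hl1 := one_le_one_add_log hρ hρε'
  have h10 : ENNReal.ofReal ρ ≤ ENNReal.ofReal (ρ * (1 + Real.log (ε / ρ))) :=
    ENNReal.ofReal_le_ofReal (by nlinarith)
  have h11 : ENNReal.ofReal (Real.log (r / ρ)) * ENNReal.ofReal ρ ≤
      ENNReal.ofReal (ρ * (1 + Real.log (ε / ρ))) := by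
    rw [mul_comm, ← ENNReal.ofReal_mul hρ.le]
    refine ENNReal.ofReal_le_ofReal ?_
    have : Real.log (r / ρ) ≤ Real.log (ε / ρ) := by
      refine Real.log_le_log (div_pos (hρ.trans hρr) hρ) ?_
      gcongr
      linarith [hr.2]
    gcongr
    linarith
  calc _ ≤ ENNReal.ofReal (ρ ^ (m - 1)) * (2 * J r + 8 * ENNReal.ofReal (Real.log (r / ρ)) * G) := by
        gcongr
    _ = 2 * (ENNReal.ofReal (ρ ^ (m - 1)) * J r) +
        8 * (ENNReal.ofReal (Real.log (r / ρ)) * (ENNReal.ofReal (ρ ^ (m - 1)) * G)) := by ring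
    _ ≤ 2 * (ENNReal.ofReal (ρ * (1 + Real.log (ε / ρ))) * (D⁻¹ * C1 * EB)) +
        8 * (ENNReal.ofReal (Real.log (r / ρ)) *
          (ENNReal.ofReal ρ * ((ENNReal.ofReal (1 - ε))⁻¹ * EB))) := by
        exact add_le_add (mul_le_mul_right (mul_le_mul' (h9.trans h10) h3) _)
          (mul_le_mul_right (mul_le_mul_right h6 _) _)
    _ = 2 * (ENNReal.ofReal (ρ * (1 + Real.log (ε / ρ))) * (D⁻¹ * C1 * EB)) +
        8 * ((ENNReal.ofReal (Real.log (r / ρ)) * ENNReal.ofReal ρ) *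
          ((ENNReal.ofReal (1 - ε))⁻¹ * EB)) := by ring
    _ ≤ 2 * (ENNReal.ofReal (ρ * (1 + Real.log (ε / ρ))) * (D⁻¹ * C1 * EB)) +
        8 * (ENNReal.ofReal (ρ * (1 + Real.log (ε / ρ))) *
          ((ENNReal.ofReal (1 - ε))⁻¹ * EB)) := by gcongr
    _ = _ := by ring
theorem ringInt_mul_radial {ε s ρ : ℝ} (hρ : 0 ≤ ρ) {h : Euc (m + 1) → ℝ≥0∞} (hh : Measurable h)
    (φ : ℝ → ℝ≥0∞) :
    ringInt ε s (fun x => φ ‖etail x‖ * h x) ρ = φ ρ * ringInt ε s h ρ := by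
  have hn : ∀ ω : Metric.sphere (0 : Euc m) 1, ‖ρ • (ω : Euc m)‖ = ρ := fun ω => by
    rw [norm_smul, norm_eq_of_mem_sphere, mul_one, Real.norm_of_nonneg hρ]
  unfold ringInt
  have hc1 : Measurable fun p : Metric.sphere (0 : Euc m) 1 × ℝ =>
      h (gmap ε s p.2 (ρ • (p.1 : Euc m))) :=
    hh.comp ((continuous_gmap ε s).comp (by fun_prop :
      Continuous fun p : Metric.sphere (0 : Euc m) 1 × ℝ => (p.2, ρ • (p.1 : Euc m)))).measurable
  rw [← lintegral_const_mul _ hc1.lintegral_prod_right']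
  refine lintegral_congr fun ω => ?_
  have hc2 : Measurable fun τ : ℝ => h (gmap ε s τ (ρ • (ω : Euc m))) :=
    hc1.comp (by fun_prop : Measurable fun τ : ℝ => (ω, τ))
  rw [← lintegral_const_mul _ hc2]
  refine lintegral_congr fun τ => ?_
  change φ ‖etail (gmap ε s τ (ρ • (ω : Euc m)))‖ * h (gmap ε s τ (ρ • (ω : Euc m))) = _
  rw [etail_gmap, hn]

/-- Weighted mass of `f` near the axis, with a radial weight. -/
theorem exists_weighted_le (hm : 2 ≤ m) {ε : ℝ} (hε : 0 < ε) (hε1 : ε < 1) : ∃ C : ℝ≥0∞, C ≠ ∞ ∧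
    ∀ {s ρ₀ : ℝ} {Ω : Set (Euc (m + 1))} {f : Euc (m + 1) → ℝ}, (s = 1 ∨ s = -1) →
      ContainsShell ε s ρ₀ Ω → ContDiff ℝ 1 f → ∀ {δ₁ R : ℝ}, 0 < δ₁ → ρ₀ ≤ δ₁ → R ≤ ε / 4 →
      ∀ {φ : ℝ → ℝ≥0∞}, Measurable φ →
      ∫⁻ x in {x | ‖etail x‖ ∈ Ioo δ₁ R ∧ 0 < s * x 0 ∧ ε < ‖x‖ ∧ ‖x‖ < 1},
        φ ‖etail x‖ * ‖f x‖ₑ ^ 2 ≤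
        C * (∫⁻ ρ in Ioo δ₁ R, ENNReal.ofReal (ρ * (1 + Real.log (ε / ρ))) * φ ρ) *
          (ener Ω f + bdry Ω f) := by
  obtain ⟨C, hC, H⟩ := exists_ringInt_le hm hε hε1
  refine ⟨C, hC, ?_⟩
  intro s ρ₀ Ω f hs hΩ hf δ₁ R hδ₁ hρ₀ hR φ hφ
  have hmsq := measurable_enorm_sq hf
  have hh : Measurable fun x : Euc (m + 1) => φ ‖etail x‖ * ‖f x‖ₑ ^ 2 :=
    (hφ.comp (by fun_prop : Measurable fun x : Euc (m + 1) => ‖etail x‖)).mul hmsq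
  have hsub : Ioo δ₁ R ⊆ Ioi 0 := fun r hr => hδ₁.trans hr.1
  have hP : MeasurableSet {z : Euc m | ‖z‖ ∈ Ioo δ₁ R} := measurable_norm measurableSet_Ioo
  have hT : MeasurableSet {x : Euc (m + 1) | ‖etail x‖ ∈ Ioo δ₁ R ∧ 0 < s * x 0 ∧ ε < ‖x‖ ∧ ‖x‖ < 1} := by
    refine ((by fun_prop : Measurable fun x : Euc (m + 1) => ‖etail x‖) measurableSet_Ioo).inter ?_
    refine ((by fun_prop : Measurable fun x : Euc (m + 1) => s * x 0) measurableSet_Ioi).inter ?_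
    exact (measurable_norm measurableSet_Ioi).inter (measurable_norm measurableSet_Iio)
  refine (lintegral_le_gmap hε hε1 hs hP (fun z hz => by linarith [hz.2]) hT
    (fun x hx => ⟨hx.1, hx.2⟩) hh).trans ?_
  rw [lintegral_gmap_polar (by omega) ε s measurableSet_Ioo hsub hh]
  have hEB : Measurable fun ρ : ℝ => ENNReal.ofReal (ρ * (1 + Real.log (ε / ρ))) * φ ρ := by
    fun_prop
  rw [mul_right_comm, ← lintegral_const_mul _ hEB]
  refine setLIntegral_mono' measurableSet_Ioo fun ρ hρ => ?_
  have hρ0 : 0 < ρ := hδ₁.trans hρ.1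
  rw [ringInt_mul_radial hρ0.le hmsq, mul_left_comm]
  refine (mul_le_mul_right (H hs hΩ hf hρ0 (hρ₀.trans hρ.1.le) (hρ.2.le.trans hR)) _).trans_eq ?_
  ring

theorem lintegral_fiber_closed_le {ε : ℝ} (hε : 0 < ε) (hε1 : ε < 1)
    (z : Euc m) (hz : ‖z‖ < ε) (h : Euc (m + 1) → ℝ≥0∞) :
    ∫⁻ t in {t | 0 < t ∧ ε ≤ ‖econs t z‖ ∧ ‖econs t z‖ ≤ 1}, h (econs t z) ≤
      ∫⁻ τ in Ioo (0 : ℝ) 1, h (gmap ε 1 τ z) := by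
  refine le_trans ?_ (lintegral_fiber_le hε hε1 (Or.inl rfl) z hz h)
  rw [← segment_fiber_eq hε z (Or.inl rfl)]
  simp only [one_mul, add_sub_cancel]
  change _ ≤ ∫⁻ t in Ioo (√(ε ^ 2 - ‖z‖ ^ 2)) (√(1 ^ 2 - ‖z‖ ^ 2)), h (econs t z)
  rw [restrict_Ioo_eq_restrict_Icc]
  refine lintegral_mono_set ?_
  rintro t ⟨h0, h1, h2⟩
  have h3 := norm_econs_sq t z
  constructor
  · rw [Real.sqrt_le_left h0.le]; nlinarith
  · refine Real.le_sqrt_of_sq_le ?_; nlinarith [norm_nonneg (econs t z)]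

theorem measurableSet_lateral (ε δ : ℝ) : MeasurableSet
    {x : Euc (m + 1) | ‖etail x‖ = δ ∧ 0 < x 0 ∧ ε ≤ ‖x‖ ∧ ‖x‖ ≤ 1} := by
  refine ((by fun_prop : Measurable fun x : Euc (m + 1) => ‖etail x‖) (measurableSet_singleton δ)).inter ?_
  refine ((by fun_prop : Measurable fun x : Euc (m + 1) => x 0) measurableSet_Ioi).inter ?_
  exact (measurable_norm measurableSet_Ici).inter (measurable_norm measurableSet_Iic)

/-- Integrals over the lateral boundary of the tube are controlled by integrals over rings. -/
theorem exists_lateral_le_ringInt (hm : m ≠ 0) {ε : ℝ} (hε : 0 < ε) (hε1 : ε < 1) :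
    ∃ C : ℝ≥0∞, C ≠ ∞ ∧ ∀ {δ : ℝ}, 0 < δ → δ < ε → ∀ {h : Euc (m + 1) → ℝ≥0∞}, Measurable h →
      ∫⁻ x in {x | ‖etail x‖ = δ ∧ 0 < x 0 ∧ ε ≤ ‖x‖ ∧ ‖x‖ ≤ 1}, h x ∂μH[m] ≤
        C * (ENNReal.ofReal (δ ^ (m - 1)) * ringInt ε 1 h δ) := by
  obtain ⟨C, hC, H⟩ := exists_lintegral_cylinder_le hm
  refine ⟨C, hC, ?_⟩
  intro δ hδ hδε h hh
  set Lat := {x : Euc (m + 1) | ‖etail x‖ = δ ∧ 0 < x 0 ∧ ε ≤ ‖x‖ ∧ ‖x‖ ≤ 1} with hLat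
  have hLm : MeasurableSet Lat := measurableSet_lateral ε δ
  have h1 : ∫⁻ x in Lat, h x ∂μH[m] ≤ ∫⁻ x in {x | ‖etail x‖ = δ}, Lat.indicator h x ∂μH[m] := by
    rw [lintegral_indicator hLm, Measure.restrict_restrict hLm]
    exact lintegral_mono_set fun x hx => ⟨hx, hx.1⟩
  refine h1.trans ((H hδ (hh.indicator hLm)).trans ?_)
  rw [mul_assoc]
  refine mul_le_mul_right (mul_le_mul_right ?_ _) _
  rw [lintegral_lintegral_swap]
  · refine lintegral_mono fun ω => ?_
    have hn : ‖δ • (ω : Euc m)‖ = δ := by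
      rw [norm_smul, norm_eq_of_mem_sphere, mul_one, Real.norm_of_nonneg hδ.le]
    refine le_trans ?_ (lintegral_fiber_closed_le hε hε1 (δ • (ω : Euc m)) (hn.trans_lt hδε) h)
    have hc : Measurable fun t : ℝ => econs t (δ • (ω : Euc m)) :=
      (continuous_econs.comp (by fun_prop : Continuous fun t : ℝ => (t, δ • (ω : Euc m)))).measurable
    have hS : MeasurableSet {t : ℝ | 0 < t ∧ ε ≤ ‖econs t (δ • (ω : Euc m))‖ ∧
        ‖econs t (δ • (ω : Euc m))‖ ≤ 1} :=
      measurableSet_Ioi.inter ((hc.norm measurableSet_Ici).inter (hc.norm measurableSet_Iic))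
    rw [← lintegral_indicator hS]
    refine lintegral_mono fun t => ?_
    by_cases ht : econs t (δ • (ω : Euc m)) ∈ Lat
    · rw [indicator_of_mem ht, indicator_of_mem]
      exact ht.2
    · rw [indicator_of_notMem ht]; exact zero_le
  · exact ((hh.indicator hLm).comp (continuous_econs.comp (by fun_prop :
      Continuous fun p : ℝ × Metric.sphere (0 : Euc m) 1 => (p.1, δ • (p.2 : Euc m)))).measurable).aemeasurable

/-- Control of the boundary values on the lateral boundary of the tube. -/
theorem exists_lateral_le (hm : 2 ≤ m) {ε : ℝ} (hε : 0 < ε) (hε1 : ε < 1) : ∃ C : ℝ≥0∞, C ≠ ∞ ∧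
    ∀ {ρ₀ : ℝ} {Ω : Set (Euc (m + 1))} {f : Euc (m + 1) → ℝ},
      ContainsShell ε 1 ρ₀ Ω → ContDiff ℝ 1 f → ∀ {δ : ℝ}, 0 < δ → ρ₀ ≤ δ → δ ≤ ε / 4 →
      ∫⁻ x in {x | ‖etail x‖ = δ ∧ 0 < x 0 ∧ ε ≤ ‖x‖ ∧ ‖x‖ ≤ 1}, ‖f x‖ₑ ^ 2 ∂μH[m] ≤
        C * ENNReal.ofReal (δ * (1 + Real.log (ε / δ))) * (ener Ω f + bdry Ω f) := by
  obtain ⟨C, hC, H⟩ := exists_ringInt_le hm hε hε1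
  obtain ⟨C', hC', H'⟩ := exists_lateral_le_ringInt (m := m) (by omega) hε hε1
  refine ⟨C' * C, by finiteness, ?_⟩
  intro ρ₀ Ω f hΩ hf δ hδ hρ₀ hδε
  refine (H' hδ (by linarith) (measurable_enorm_sq hf)).trans ?_
  refine (mul_le_mul_right (H (Or.inl rfl) hΩ hf hδ hρ₀ hδε) _).trans_eq ?_
  ring

/-- One-dimensional trace inequality along the segments of `gmap`. -/
theorem enorm_gmap_end_sq_le {ε s : ℝ} (hε1 : ε < 1) (hs : s = 1 ∨ s = -1) {z : Euc m}
    (hz : ‖z‖ ≤ ε) {f : Euc (m + 1) → ℝ} (hf : ContDiff ℝ 1 f) {τ₀ ℓ : ℝ} (hτ : τ₀ = 0 ∨ τ₀ = 1)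
    (hℓ : 0 < ℓ) (hℓ1 : ℓ ≤ 1) :
    ‖f (gmap ε s τ₀ z)‖ₑ ^ 2 ≤
      2 * (ENNReal.ofReal ℓ)⁻¹ * (∫⁻ τ in Ioo (0 : ℝ) 1, ‖f (gmap ε s τ z)‖ₑ ^ 2) +
      2 * ENNReal.ofReal ℓ * ∫⁻ τ in Ioo (0 : ℝ) 1, ‖gradient f (gmap ε s τ z)‖ₑ ^ 2 := by
  have hℓ0 : ENNReal.ofReal ℓ ≠ 0 := by simpa using hℓ
  have hg : Measurable fun τ : ℝ => ‖f (gmap ε s τ z)‖ₑ ^ 2 :=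
    (measurable_enorm_sq hf).comp ((continuous_gmap ε s).comp (by fun_prop :
      Continuous fun τ : ℝ => (τ, z))).measurable
  obtain ⟨τ, hτI, h1, h2⟩ : ∃ τ ∈ Ioo (0 : ℝ) 1,
      ENNReal.ofReal ℓ * ‖f (gmap ε s τ z)‖ₑ ^ 2 ≤ ∫⁻ τ in Ioo (0 : ℝ) 1, ‖f (gmap ε s τ z)‖ₑ ^ 2 ∧
      ‖f (gmap ε s τ₀ z) - f (gmap ε s τ z)‖ₑ ^ 2 ≤
        ENNReal.ofReal ℓ * ∫⁻ τ in Ioo (0 : ℝ) 1, ‖gradient f (gmap ε s τ z)‖ₑ ^ 2 := by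
    rcases hτ with rfl | rfl
    · obtain ⟨τ, hτ, h⟩ := exists_mul_le_setLIntegral_Ioo hg (show (0 : ℝ) < ℓ by linarith)
      refine ⟨τ, ⟨hτ.1, hτ.2.trans_le hℓ1⟩, ?_, ?_⟩
      · rw [sub_zero] at h
        exact h.trans (lintegral_mono_set (Ioo_subset_Ioo_right hℓ1))
      · rw [enorm_sub_rev]
        refine (enorm_sub_gmap_sq_le hε1 hs hz hf hτ.1.le).trans ?_
        exact mul_le_mul' (ENNReal.ofReal_le_ofReal (by linarith [hτ.2]))
          (lintegral_mono_set (Ioo_subset_Ioo_right (hτ.2.le.trans hℓ1)))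
    · obtain ⟨τ, hτ, h⟩ := exists_mul_le_setLIntegral_Ioo hg (show 1 - ℓ < 1 by linarith)
      refine ⟨τ, ⟨by linarith [hτ.1], hτ.2⟩, ?_, ?_⟩
      · rw [show 1 - (1 - ℓ) = ℓ by ring] at h
        exact h.trans (lintegral_mono_set (Ioo_subset_Ioo_left (by linarith)))
      · refine (enorm_sub_gmap_sq_le hε1 hs hz hf hτ.2.le).trans ?_
        exact mul_le_mul' (ENNReal.ofReal_le_ofReal (by linarith [hτ.1]))
          (lintegral_mono_set (Ioo_subset_Ioo_left (by linarith [hτ.1])))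
  refine (enorm_sq_le_of_sub _ (f (gmap ε s τ z))).trans ?_
  rw [mul_assoc, mul_assoc]
  refine add_le_add (mul_le_mul_right ?_ _) (mul_le_mul_right h2 _)
  calc ‖f (gmap ε s τ z)‖ₑ ^ 2 = (ENNReal.ofReal ℓ)⁻¹ * (ENNReal.ofReal ℓ * ‖f (gmap ε s τ z)‖ₑ ^ 2) := by
        rw [← mul_assoc, ENNReal.inv_mul_cancel hℓ0 ENNReal.ofReal_ne_top, one_mul]
    _ ≤ _ := mul_le_mul_right h1 _

/-- Control of the boundary values on small spherical caps around the axis. -/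
theorem exists_cap_le (hm : 2 ≤ m) {ε : ℝ} (hε : 0 < ε) (hε1 : ε < 1) : ∃ C : ℝ≥0∞, C ≠ ∞ ∧
    ∀ {s ρ₀ : ℝ} {Ω : Set (Euc (m + 1))} {f : Euc (m + 1) → ℝ}, (s = 1 ∨ s = -1) →
      ContainsShell ε s ρ₀ Ω → ContDiff ℝ 1 f → ∀ {R κ : ℝ}, (κ = ε ∨ κ = 1) → 0 < R → R ≤ ε / 4 →
      ∫⁻ x in egraph s κ '' {z : Euc m | ρ₀ < ‖z‖ ∧ ‖z‖ < R}, ‖f x‖ₑ ^ 2 ∂μH[m] ≤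
        C * ENNReal.ofReal √R * (ener Ω f + bdry Ω f) := by
  obtain ⟨C, hC, H⟩ := exists_ringInt_le hm hε hε1
  obtain ⟨C1, hC1, H1⟩ := exists_lintegral_egraph_image_le m
  have h0 : (ENNReal.ofReal (1 - ε))⁻¹ ≠ ∞ := by simpa using hε1
  refine ⟨C1 * (2 * C + 2 * (ENNReal.ofReal (1 - ε))⁻¹), by finiteness, ?_⟩
  intro s ρ₀ Ω f hs hΩ hf R κ hκ hR hRε
  have hmsq := measurable_enorm_sq hf
  have hmgr := measurable_enorm_gradient_sq hf
  set EB := ener Ω f + bdry Ω f with hEB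
  set I := Ioo (max ρ₀ 0) R with hI
  set P := {z : Euc m | ‖z‖ ∈ I} with hPdef
  have hP : MeasurableSet P := measurable_norm measurableSet_Ioo
  have hIsub : I ⊆ Ioi 0 := fun r hr => (le_max_right _ _).trans_lt hr.1
  have hκε : ε ≤ κ := by rcases hκ with rfl | rfl <;> linarith
  have hsq : √R * √R = R := Real.mul_self_sqrt hR.le
  have hsq0 : 0 < √R := Real.sqrt_pos.2 hR
  have hsq1 : √R ≤ 1 := Real.sqrt_le_one.2 (by linarith)
  refine (H1 hs (hε.trans_le hκε) (fun z hz => by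
    rw [mem_closedBall_zero_iff]; linarith [hz.2]) hmsq).trans ?_
  have hnt : Nontrivial (Euc m) := by
    have : Nonempty (Fin m) := ⟨⟨0, by omega⟩⟩
    infer_instance
  have hae : {z : Euc m | ρ₀ < ‖z‖ ∧ ‖z‖ < R} ≤ᵐ[volume] P := by
    filter_upwards [compl_mem_ae_iff.2 (measure_singleton (μ := (volume : Measure (Euc m))) 0)]
      with z hz hz'
    exact ⟨max_lt hz'.1 (norm_pos_iff.2 hz), hz'.2⟩
  rw [mul_assoc, mul_assoc]
  refine mul_le_mul_right ((lintegral_mono_set' hae).trans ?_) _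
  obtain ⟨τ₀, hτ₀, hτe⟩ : ∃ τ₀, (τ₀ = 0 ∨ τ₀ = 1) ∧ ∀ z : Euc m, egraph s κ z = gmap ε s τ₀ z := by
    rcases hκ with rfl | rfl
    · exact ⟨0, Or.inl rfl, fun z => (gmap_zero _ _ _).symm⟩
    · exact ⟨1, Or.inr rfl, fun z => (gmap_one _ _ _).symm⟩
  have hK1 : 2 * (ENNReal.ofReal √R)⁻¹ ≠ ∞ :=
    ENNReal.mul_ne_top (by simp) (ENNReal.inv_ne_top.2 (by simpa using hsq0))
  have hK2 : 2 * ENNReal.ofReal √R ≠ ∞ := by finiteness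
  have h1 : ∫⁻ z in P, ‖f (egraph s κ z)‖ₑ ^ 2 ≤
      2 * (ENNReal.ofReal √R)⁻¹ * (∫⁻ z in P, ∫⁻ τ in Ioo (0 : ℝ) 1, ‖f (gmap ε s τ z)‖ₑ ^ 2) +
      2 * ENNReal.ofReal √R *
        ∫⁻ z in P, ∫⁻ τ in Ioo (0 : ℝ) 1, ‖gradient f (gmap ε s τ z)‖ₑ ^ 2 := by
    rw [← lintegral_const_mul' _ _ hK1, ← lintegral_const_mul' _ _ hK2, ← lintegral_add_left
      ((measurable_lintegral_gmap (h := fun x => ‖f x‖ₑ ^ 2) ε s hmsq).const_mul _)]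
    refine setLIntegral_mono' hP fun z hz => ?_
    rw [hτe]
    exact enorm_gmap_end_sq_le hε1 hs (by linarith [hz.2]) hf hτ₀ hsq0 hsq1
  have h2 : ∫⁻ z in P, ∫⁻ τ in Ioo (0 : ℝ) 1, ‖f (gmap ε s τ z)‖ₑ ^ 2 ≤
      ENNReal.ofReal R * (C * EB) := by
    rw [lintegral_gmap_polar (h := fun x => ‖f x‖ₑ ^ 2) (by omega) ε s measurableSet_Ioo hIsub hmsq]
    calc _ ≤ ∫⁻ ρ in I, C * EB := by
          refine setLIntegral_mono' measurableSet_Ioo fun ρ hρ => ?_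
          have hρ0 : 0 < ρ := hIsub hρ
          refine (H hs hΩ hf hρ0 ((le_max_left _ _).trans hρ.1.le) (hρ.2.le.trans hRε)).trans ?_
          calc _ ≤ C * 1 * EB := by
                gcongr
                rw [← ENNReal.ofReal_one]
                exact ENNReal.ofReal_le_ofReal ((mul_one_add_log_le hρ0 hε).trans hε1.le)
            _ = _ := by rw [mul_one]
      _ ≤ _ := by
          rw [setLIntegral_const, hI, Real.volume_Ioo, mul_comm]
          gcongr
          linarith [le_max_right ρ₀ 0]
  have h3 : ∫⁻ z in P, ∫⁻ τ in Ioo (0 : ℝ) 1, ‖gradient f (gmap ε s τ z)‖ₑ ^ 2 ≤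
      (ENNReal.ofReal (1 - ε))⁻¹ * EB := by
    refine (lintegral_gmap_le hε hε1 hs hP (fun z hz => by linarith [hz.2]) hΩ.meas
      (fun z hz => hΩ.mem z ((le_max_left _ _).trans_lt hz.1) (by linarith [hz.2])) hmgr).trans ?_
    exact mul_le_mul_right le_self_add _
  have h4 : (ENNReal.ofReal √R)⁻¹ * ENNReal.ofReal R = ENNReal.ofReal √R := by
    have e : ENNReal.ofReal R = ENNReal.ofReal √R * ENNReal.ofReal √R := by
      rw [← ENNReal.ofReal_mul hsq0.le, hsq]
    rw [e, ← mul_assoc, ENNReal.inv_mul_cancel (by simpa using hsq0) ENNReal.ofReal_ne_top, one_mul]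
  calc _ ≤ 2 * (ENNReal.ofReal √R)⁻¹ * (ENNReal.ofReal R * (C * EB)) +
      2 * ENNReal.ofReal √R * ((ENNReal.ofReal (1 - ε))⁻¹ * EB) := by
        refine h1.trans ?_
        gcongr
    _ = 2 * ((ENNReal.ofReal √R)⁻¹ * ENNReal.ofReal R) * (C * EB) +
      2 * ENNReal.ofReal √R * ((ENNReal.ofReal (1 - ε))⁻¹ * EB) := by ring
    _ = _ := by rw [h4]; ring
end

section

theorem exists_norm_deriv_smoothTransition_le :
    ∃ M : ℝ, 0 ≤ M ∧ ∀ t ∈ Icc (0 : ℝ) 1, |deriv Real.smoothTransition t| ≤ M := by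
  have hc : Continuous (deriv Real.smoothTransition) :=
    (Real.smoothTransition.contDiff (n := 1)).continuous_deriv le_rfl
  obtain ⟨M, hM⟩ := isCompact_Icc.exists_bound_of_continuousOn (s := Icc (0 : ℝ) 1) hc.continuousOn
  exact ⟨M, (norm_nonneg _).trans (hM 0 (by simp)), hM⟩

/-- A doubly logarithmic cutoff with small weighted energy. -/
theorem exists_log_cutoff {ε R η : ℝ} (hε : 0 < ε) (hR : 0 < R) (hRε : R ≤ ε / 4) (hη : 0 < η) :
    ∃ (χ : ℝ → ℝ) (δ₁ : ℝ), 0 < δ₁ ∧ δ₁ < R ∧ ContDiff ℝ (⊤ : ℕ∞) χ ∧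
      (∀ ρ, 0 ≤ χ ρ ∧ χ ρ ≤ 1) ∧ (∀ ρ ≤ δ₁, χ ρ = 0) ∧ (∀ ρ, R ≤ ρ → χ ρ = 1) ∧
      ∫⁻ ρ in Ioo δ₁ R, ENNReal.ofReal (ρ * (1 + Real.log (ε / ρ))) * ‖deriv χ ρ‖ₑ ^ 2 ≤
        ENNReal.ofReal η := by
  obtain ⟨M, hM0, hM⟩ := exists_norm_deriv_smoothTransition_le
  set N : ℝ := M ^ 2 / η + 1 with hN
  have hN0 : 0 < N := by positivity
  set L : ℝ → ℝ := fun ρ => 1 + Real.log (ε / ρ) with hL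
  have hL1 : ∀ ρ, 0 < ρ → ρ ≤ ε → 1 ≤ L ρ := fun ρ h0 h1 => by
    have : 0 ≤ Real.log (ε / ρ) := Real.log_nonneg ((one_le_div h0).2 h1)
    simp only [hL]; linarith
  have hLanti : ∀ ρ ρ', 0 < ρ → ρ ≤ ρ' → L ρ' ≤ L ρ := fun ρ ρ' h0 h1 => by
    simp only [hL]
    have : Real.log (ε / ρ') ≤ Real.log (ε / ρ) :=
      Real.log_le_log (div_pos hε (h0.trans_le h1)) (by gcongr)
    linarith
  have hLR : 1 ≤ L R := hL1 R hR (by linarith)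
  set δ₁ : ℝ := ε * Real.exp (1 - Real.exp N * L R) with hδ₁
  have hδ0 : 0 < δ₁ := by positivity
  have hLδ : L δ₁ = Real.exp N * L R := by
    have : ε / δ₁ = Real.exp (-(1 - Real.exp N * L R)) := by
      rw [hδ₁, Real.exp_neg]; field_simp
    simp only [hL] at this ⊢
    rw [this, Real.log_exp]; ring
  have hexp : 1 < Real.exp N := Real.one_lt_exp_iff.2 hN0
  have hδR : δ₁ < R := by
    by_contra! h
    have := hLanti R δ₁ hR h
    rw [hLδ] at this
    nlinarith
  set θ : ℝ → ℝ := fun ρ => 1 + (Real.log (L R) - Real.log (L ρ)) / N with hθ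
  have hθmono : ∀ ρ ρ', 0 < ρ → ρ ≤ ρ' → ρ' ≤ ε → θ ρ ≤ θ ρ' := fun ρ ρ' h0 h1 h2 => by
    have : Real.log (L ρ') ≤ Real.log (L ρ) :=
      Real.log_le_log (by linarith [hL1 ρ' (h0.trans_le h1) h2]) (hLanti _ _ h0 h1)
    simp only [hθ]; gcongr
  have hθR : θ R = 1 := by simp [hθ]
  have hθδ : θ δ₁ = 0 := by
    simp only [hθ]
    rw [hLδ, Real.log_mul (by positivity) (by linarith), Real.log_exp]
    field_simp; ring
  have hd : ∀ ρ, 0 < ρ → ρ ≤ ε → HasDerivAt θ (1 / (N * (ρ * L ρ))) ρ := fun ρ h0 h1 => by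
    have hLp : L ρ ≠ 0 := by linarith [hL1 ρ h0 h1]
    have e1 : HasDerivAt (fun ρ => ε / ρ) (-ε / ρ ^ 2) ρ := by
      refine ((hasDerivAt_const ρ ε).fun_div (hasDerivAt_id' ρ) h0.ne').congr_deriv ?_
      simp
    have e2 : HasDerivAt L (-ε / ρ ^ 2 / (ε / ρ)) ρ :=
      (e1.log (by positivity)).const_add 1
    have e3 := (((e2.log hLp).const_sub (Real.log (L R))).div_const N).const_add 1
    refine e3.congr_deriv ?_
    field_simp
  set χ : ℝ → ℝ := fun ρ => if ρ ≤ δ₁ then 0 else if R ≤ ρ then 1 else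
    Real.smoothTransition (θ ρ) with hχ
  have hχ0 : ∀ ρ ≤ δ₁, χ ρ = 0 := fun ρ h => by simp [hχ, h]
  have hχ1 : ∀ ρ, R ≤ ρ → χ ρ = 1 := fun ρ h => by
    simp [hχ, h, not_le.2 (hδR.trans_le h)]
  have hχm : ∀ ρ ∈ Ioo 0 ε, χ ρ = Real.smoothTransition (θ ρ) := fun ρ h => by
    by_cases h1 : ρ ≤ δ₁
    · rw [hχ0 ρ h1, Real.smoothTransition.zero_of_nonpos]
      exact (hθmono ρ δ₁ h.1 h1 (by linarith)).trans hθδ.le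
    · by_cases h2 : R ≤ ρ
      · rw [hχ1 ρ h2, Real.smoothTransition.one_of_one_le]
        exact hθR.symm.le.trans (hθmono R ρ hR h2 h.2.le)
      · simp [hχ, h1, h2]
  have hsm : ContDiff ℝ (⊤ : ℕ∞) χ := by
    rw [contDiff_iff_contDiffAt]
    intro ρ
    rcases lt_or_ge ρ δ₁ with h | h
    · exact (contDiffAt_const (c := (0 : ℝ))).congr_of_eventuallyEq
        ((Iio_mem_nhds h |> Filter.eventually_of_mem) fun y hy => hχ0 y (le_of_lt hy))
    rcases lt_or_ge R ρ with h' | h'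
    · exact (contDiffAt_const (c := (1 : ℝ))).congr_of_eventuallyEq
        ((Ioi_mem_nhds h' |> Filter.eventually_of_mem) fun y hy => hχ1 y (le_of_lt hy))
    have hρ : ρ ∈ Ioo 0 ε := ⟨hδ0.trans_le h, by linarith⟩
    have hρ0 := hρ.1.ne'
    have hLp : L ρ ≠ 0 := by linarith [hL1 ρ hρ.1 hρ.2.le]
    have hdiv : ε / ρ ≠ 0 := (div_pos hε hρ.1).ne'
    have c1 : ContDiffAt ℝ (⊤ : ℕ∞) L ρ :=
      contDiffAt_const.add ((contDiffAt_const.div contDiffAt_id hρ0).log hdiv)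
    have c2 : ContDiffAt ℝ (⊤ : ℕ∞) θ ρ :=
      contDiffAt_const.add ((contDiffAt_const.sub (c1.log hLp)).div_const N)
    exact (Real.smoothTransition.contDiffAt.comp ρ c2).congr_of_eventuallyEq
      (Filter.eventually_of_mem (Ioo_mem_nhds hρ.1 hρ.2) hχm)
  refine ⟨χ, δ₁, hδ0, hδR, hsm, fun ρ => ?_, hχ0, hχ1, ?_⟩
  · simp only [hχ]
    split_ifs
    · simp
    · simp
    · exact ⟨Real.smoothTransition.nonneg _, Real.smoothTransition.le_one _⟩
  have hint : ∫ ρ in δ₁..R, 1 / (N * (ρ * L ρ)) = 1 := by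
    rw [intervalIntegral.integral_eq_sub_of_hasDerivAt (f := θ), hθR, hθδ, sub_zero]
    · intro ρ hρ
      rw [uIcc_of_le hδR.le] at hρ
      exact hd ρ (hδ0.trans_le hρ.1) (by linarith [hρ.2])
    · refine ContinuousOn.intervalIntegrable ?_
      rw [uIcc_of_le hδR.le]
      intro ρ hρ
      have h0 : 0 < ρ := hδ0.trans_le hρ.1
      have hLp : 0 < L ρ := by linarith [hL1 ρ h0 (by linarith [hρ.2])]
      refine ContinuousAt.continuousWithinAt ?_
      have c1 : ContinuousAt L ρ := continuousAt_const.add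
        ((continuousAt_const.div continuousAt_id h0.ne').log (div_pos hε h0).ne')
      exact continuousAt_const.div (continuousAt_const.mul (continuousAt_id.mul c1)) (by positivity)
  have hpt : ∀ ρ ∈ Ioo δ₁ R, ENNReal.ofReal (ρ * (1 + Real.log (ε / ρ))) * ‖deriv χ ρ‖ₑ ^ 2 ≤
      ENNReal.ofReal (M ^ 2 / N) * ENNReal.ofReal (1 / (N * (ρ * L ρ))) := fun ρ hρ => by
    have h0 : 0 < ρ := hδ0.trans hρ.1
    have h1 : ρ < ε := by linarith [hρ.2]
    have hLp : 0 < L ρ := by linarith [hL1 ρ h0 h1.le]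
    have hder : deriv χ ρ = deriv Real.smoothTransition (θ ρ) * (1 / (N * (ρ * L ρ))) := by
      have : HasDerivAt (fun y => Real.smoothTransition (θ y))
          (deriv Real.smoothTransition (θ ρ) * (1 / (N * (ρ * L ρ)))) ρ :=
        ((Real.smoothTransition.contDiff (n := 1)).differentiable (by simp) _).hasDerivAt.comp ρ
          (hd ρ h0 h1.le)
      exact (this.congr_of_eventuallyEq
        (Filter.eventually_of_mem (Ioo_mem_nhds h0 h1) hχm)).deriv
    have hb : |deriv Real.smoothTransition (θ ρ)| ≤ M :=
      hM _ ⟨hθδ.symm.le.trans (hθmono _ _ hδ0 hρ.1.le h1.le),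
        (hθmono _ _ h0 hρ.2.le (by linarith)).trans hθR.le⟩
    rw [← ofReal_norm, ← ENNReal.ofReal_pow (norm_nonneg _),
      ← ENNReal.ofReal_mul (by positivity), ← ENNReal.ofReal_mul (by positivity)]
    refine ENNReal.ofReal_le_ofReal ?_
    rw [Real.norm_eq_abs, sq_abs, hder, mul_pow]
    have hb2 : deriv Real.smoothTransition (θ ρ) ^ 2 ≤ M ^ 2 := by
      rw [← sq_abs]; gcongr
    calc ρ * L ρ * (deriv Real.smoothTransition (θ ρ) ^ 2 * (1 / (N * (ρ * L ρ))) ^ 2)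
        ≤ ρ * L ρ * (M ^ 2 * (1 / (N * (ρ * L ρ))) ^ 2) := by gcongr
      _ = _ := by field_simp
  calc _ ≤ ∫⁻ ρ in Ioo δ₁ R, ENNReal.ofReal (M ^ 2 / N) * ENNReal.ofReal (1 / (N * (ρ * L ρ))) :=
        setLIntegral_mono' measurableSet_Ioo hpt
    _ = ENNReal.ofReal (M ^ 2 / N) * ∫⁻ ρ in Ioc δ₁ R, ENNReal.ofReal (1 / (N * (ρ * L ρ))) := by
        rw [lintegral_const_mul' _ _ ENNReal.ofReal_ne_top, restrict_Ioo_eq_restrict_Ioc]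
    _ = ENNReal.ofReal (M ^ 2 / N) := by
        rw [← ofReal_integral_eq_lintegral_ofReal, ← intervalIntegral.integral_of_le hδR.le, hint]
        · simp
        · by_contra h
          rw [intervalIntegral.integral_of_le hδR.le, integral_undef h] at hint
          exact zero_ne_one hint
        · refine (ae_restrict_iff' measurableSet_Ioc).2 (Eventually.of_forall fun ρ hρ => ?_)
          have h0 : 0 < ρ := hδ0.trans hρ.1
          have hLp : 0 < L ρ := by linarith [hL1 ρ h0 (by linarith [hρ.2])]
          simp only [Pi.zero_apply]; positivity
    _ ≤ _ := by
        refine ENNReal.ofReal_le_ofReal ?_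
        rw [div_le_iff₀ hN0, hN, mul_add, mul_div_cancel₀ _ hη.ne']
        linarith
/-- The annulus of radii `ε` and `1`. -/
def annu (m : ℕ) (ε : ℝ) : Set (Euc (m + 1)) := {x | ε < ‖x‖ ∧ ‖x‖ < 1}

/-- The annulus with the tube of radius `δ` around the positive first axis removed. -/
def tunnel (m : ℕ) (ε δ : ℝ) : Set (Euc (m + 1)) :=
  {x | ε < ‖x‖ ∧ ‖x‖ < 1 ∧ (x 0 ≤ 0 ∨ δ < ‖etail x‖)}

theorem isOpen_annu (ε : ℝ) : IsOpen (annu m ε) :=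
  (isOpen_lt continuous_const continuous_norm).inter (isOpen_lt continuous_norm continuous_const)

theorem tunnel_eq {ε δ : ℝ} (hε : 0 < ε) (hδ : 0 < δ) (hδε : δ < ε / 4) :
    tunnel m ε δ = {x ∈ annu m ε | δ < Metric.infDist x {x | ∃ t : ℝ, ε / 2 ≤ t ∧ t ≤ 1 ∧
      x = t • EuclideanSpace.single (0 : Fin (m + 1)) (1 : ℝ)}} := by
  set γ : Set (Euc (m + 1)) := {x | ∃ t : ℝ, ε / 2 ≤ t ∧ t ≤ 1 ∧
      x = t • EuclideanSpace.single (0 : Fin (m + 1)) (1 : ℝ)} with hγ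
  have hsingle : ∀ t : ℝ, t • EuclideanSpace.single (0 : Fin (m + 1)) (1 : ℝ) = econs t 0 := by
    intro t; ext i; refine Fin.cases ?_ (fun j => ?_) i <;> simp
  have hdist : ∀ (x : Euc (m + 1)) t, dist x (econs t 0) ^ 2 = (x 0 - t) ^ 2 + ‖etail x‖ ^ 2 := by
    intro x t; rw [dist_eq_norm, norm_sq_eq_add]; simp
  ext x
  simp only [tunnel, annu, mem_ofPred_eq]
  rw [← and_assoc]
  refine and_congr_right fun hx => ⟨fun h => ?_, fun h => ?_⟩
  · have h2 : x ∈ annu m ε := hx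
    have hn := norm_sq_eq_add x
    rcases h with h | h
    · by_cases hne : γ.Nonempty
      · refine lt_of_lt_of_le (by linarith : δ < ε / 2) ((Metric.le_infDist hne).2 ?_)
        rintro y ⟨t, ht, -, rfl⟩
        rw [hsingle]
        refine le_of_sq_le_sq ?_ dist_nonneg
        rw [hdist]
        nlinarith [sq_nonneg ‖etail x‖, mul_nonneg (neg_nonneg.2 h) hε.le]
      · exfalso
        exact hne ⟨_, 1, by linarith [hx.1.trans hx.2], le_rfl, rfl⟩
    · have hne : γ.Nonempty := ⟨_, 1, by linarith [hx.1.trans hx.2], le_rfl, rfl⟩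
      refine lt_of_lt_of_le h ((Metric.le_infDist hne).2 ?_)
      rintro y ⟨t, ht, -, rfl⟩
      rw [hsingle]
      refine le_of_sq_le_sq ?_ dist_nonneg
      rw [hdist]
      nlinarith [sq_nonneg (x 0 - t)]
  · by_contra! hc
    have hn := norm_sq_eq_add x
    have h1 : econs (x 0) 0 ∈ γ := by
      refine ⟨x 0, ?_, ?_, (hsingle _).symm⟩
      · refine le_of_sq_le_sq ?_ hc.1.le
        have h3 : ε ^ 2 < ‖x‖ ^ 2 := by gcongr; exact hx.1
        have h4 : ‖etail x‖ ^ 2 ≤ (ε / 4) ^ 2 := by gcongr; exact hc.2.trans hδε.le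
        nlinarith
      · refine le_of_sq_le_sq ?_ zero_le_one
        have : ‖x‖ ^ 2 < 1 ^ 2 := by gcongr; exact hx.2
        nlinarith [sq_nonneg ‖etail x‖]
    have h2 := Metric.infDist_le_dist_of_mem (x := x) h1
    have h3 : dist x (econs (x 0) 0) ≤ ‖etail x‖ := by
      refine le_of_sq_le_sq ?_ (norm_nonneg _)
      rw [hdist]; simp
    linarith [hc.2]

theorem isOpen_tunnel {ε δ : ℝ} (hε : 0 < ε) (hδ : 0 < δ) (hδε : δ < ε / 4) :
    IsOpen (tunnel m ε δ) := by
  rw [tunnel_eq hε hδ hδε]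
  exact (isOpen_annu ε).inter (isOpen_lt continuous_const (Metric.continuous_infDist_pt _))

theorem mem_closure_annu_inter {ε : ℝ} (hε : 0 < ε) (hε1 : ε < 1) {x : Euc (m + 1)}
    (hx : ε ≤ ‖x‖) (hx1 : ‖x‖ ≤ 1) {T : Set (Euc (m + 1))} (hT : T ∈ 𝓝 x) :
    x ∈ closure (annu m ε ∩ T) := by
  have hx0 : 0 < ‖x‖ := hε.trans_le hx
  set p : ℝ → Euc (m + 1) := fun s => (1 + s * ((1 + ε) / 2 / ‖x‖ - 1)) • x with hp
  have hc : Tendsto p (𝓝[>] 0) (𝓝 x) := by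
    have : Continuous p := by fun_prop
    have h := this.tendsto 0
    simp only [hp, zero_mul, add_zero, one_smul] at h
    exact h.mono_left nhdsWithin_le_nhds
  refine mem_closure_of_tendsto hc ?_
  filter_upwards [hc hT, Ioo_mem_nhdsGT zero_lt_one] with s h1 h2
  refine ⟨?_, h1⟩
  have hn : ‖p s‖ = (1 - s) * ‖x‖ + s * ((1 + ε) / 2) := by
    have e : (1 + s * ((1 + ε) / 2 / ‖x‖ - 1)) * ‖x‖ = (1 - s) * ‖x‖ + s * ((1 + ε) / 2) := by
      field_simp; ring
    rw [hp]
    simp only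
    rw [norm_smul, Real.norm_of_nonneg, e]
    have h3 : 0 ≤ s * ((1 + ε) / 2 / ‖x‖) := mul_nonneg h2.1.le (by positivity)
    nlinarith [h2.2]
  change ε < ‖p s‖ ∧ ‖p s‖ < 1
  rw [hn]
  constructor <;> nlinarith [h2.1, h2.2]

theorem frontier_annu {ε : ℝ} (hε : 0 < ε) (hε1 : ε < 1) :
    frontier (annu m ε) = {x | ‖x‖ = ε ∨ ‖x‖ = 1} := by
  have hcl : closure (annu m ε) = {x | ε ≤ ‖x‖ ∧ ‖x‖ ≤ 1} := by
    refine Subset.antisymm (closure_minimal (fun x hx => ⟨hx.1.le, hx.2.le⟩) ?_) fun x hx => ?_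
    · exact (isClosed_le continuous_const continuous_norm).inter
        (isClosed_le continuous_norm continuous_const)
    · exact closure_mono inter_subset_left
        (mem_closure_annu_inter hε hε1 hx.1 hx.2 Filter.univ_mem)
  rw [frontier, hcl, (isOpen_annu ε).interior_eq]
  ext x
  simp only [annu, Set.mem_sdiff, mem_ofPred_eq, not_and_or, not_lt]
  constructor
  · rintro ⟨⟨h1, h2⟩, h3 | h3⟩
    · exact Or.inl (le_antisymm h3 h1)
    · exact Or.inr (le_antisymm h2 h3)
  · rintro (h | h) <;> rw [h]
    · exact ⟨⟨le_rfl, hε1.le⟩, Or.inl le_rfl⟩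
    · exact ⟨⟨hε1.le, le_rfl⟩, Or.inr le_rfl⟩

theorem frontier_tunnel_subset {ε δ : ℝ} (hε : 0 < ε) (hε1 : ε < 1) (hδ : 0 < δ)
    (hδε : δ < ε / 4) : frontier (tunnel m ε δ) ⊆
      (frontier (annu m ε) ∩ {x | x 0 ≤ 0 ∨ δ ≤ ‖etail x‖}) ∪
        {x | ‖etail x‖ = δ ∧ 0 < x 0 ∧ ε ≤ ‖x‖ ∧ ‖x‖ ≤ 1} := by
  have hc0 : Continuous fun x : Euc (m + 1) => x 0 := by fun_prop
  have hct : Continuous fun x : Euc (m + 1) => ‖etail x‖ := by fun_prop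
  have hcl : closure (tunnel m ε δ) ⊆
      {x | (ε ≤ ‖x‖ ∧ ‖x‖ ≤ 1) ∧ (x 0 ≤ 0 ∨ δ ≤ ‖etail x‖)} := by
    refine closure_minimal (fun x hx => ⟨⟨hx.1.le, hx.2.1.le⟩, hx.2.2.imp_right le_of_lt⟩) ?_
    exact ((isClosed_le continuous_const continuous_norm).inter
      (isClosed_le continuous_norm continuous_const)).inter
      ((isClosed_le hc0 continuous_const).union (isClosed_le continuous_const hct))
  rw [frontier, (isOpen_tunnel hε hδ hδε).interior_eq, frontier_annu hε hε1]
  rintro x ⟨hx, hxn⟩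
  obtain ⟨⟨h1, h2⟩, h3⟩ := hcl hx
  by_cases hb : ‖x‖ = ε ∨ ‖x‖ = 1
  · exact Or.inl ⟨hb, h3⟩
  · rw [not_or] at hb
    have h4 : ¬ (x 0 ≤ 0 ∨ δ < ‖etail x‖) := fun h =>
      hxn ⟨lt_of_le_of_ne h1 (Ne.symm hb.1), lt_of_le_of_ne h2 hb.2, h⟩
    rw [not_or, not_le, not_lt] at h4
    refine Or.inr ⟨le_antisymm h4.2 (h3.resolve_left (not_le.2 h4.1)), h4.1, h1, h2⟩

theorem frontier_annu_inter_subset {ε δ : ℝ} (hε : 0 < ε) (hε1 : ε < 1) (hδ : 0 < δ)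
    (hδε : δ < ε / 4) :
    frontier (annu m ε) ∩ {x | x 0 < 0 ∨ δ < ‖etail x‖} ⊆ frontier (tunnel m ε δ) := by
  have hc0 : Continuous fun x : Euc (m + 1) => x 0 := by fun_prop
  have hct : Continuous fun x : Euc (m + 1) => ‖etail x‖ := by fun_prop
  have hT : IsOpen {x : Euc (m + 1) | x 0 < 0 ∨ δ < ‖etail x‖} :=
    (isOpen_lt hc0 continuous_const).union (isOpen_lt continuous_const hct)
  rintro x ⟨hx, hxT⟩
  rw [frontier_annu hε hε1] at hx
  rw [frontier, (isOpen_tunnel hε hδ hδε).interior_eq]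
  have h1 : ε ≤ ‖x‖ ∧ ‖x‖ ≤ 1 := by rcases hx with h | h <;> rw [h] <;> simp [hε1.le]
  refine ⟨closure_mono ?_ (mem_closure_annu_inter hε hε1 h1.1 h1.2 (hT.mem_nhds hxT)), ?_⟩
  · rintro y ⟨hy, hyT⟩
    exact ⟨hy.1, hy.2, hyT.imp_left le_of_lt⟩
  · rintro ⟨h2, h3, -⟩
    rcases hx with h | h
    · exact h2.ne' h
    · exact h3.ne h

theorem norm_egraph {s κ : ℝ} (hs : s = 1 ∨ s = -1) (hκ : 0 ≤ κ) {z : Euc m} (hz : ‖z‖ ≤ κ) :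
    ‖egraph s κ z‖ = κ := by
  have h : ‖egraph s κ z‖ ^ 2 = κ ^ 2 := by
    rw [egraph, norm_econs_sq, mul_pow, Real.sq_sqrt (sub_nonneg.2 (by gcongr))]
    rcases hs with rfl | rfl <;> ring
  exact (sq_eq_sq₀ (norm_nonneg _) hκ).1 h

theorem egraph_mem_frontier_annu {ε s κ : ℝ} (hε : 0 < ε) (hε1 : ε < 1) (hs : s = 1 ∨ s = -1)
    (hκ : κ = ε ∨ κ = 1) {z : Euc m} (hz : ‖z‖ ≤ ε) : egraph s κ z ∈ frontier (annu m ε) := by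
  rw [frontier_annu hε hε1]
  rcases hκ with rfl | rfl
  · exact Or.inl (norm_egraph hs hε.le hz)
  · exact Or.inr (norm_egraph hs zero_le_one (hz.trans hε1.le))

theorem containsShell_tunnel_one {ε δ : ℝ} (hε : 0 < ε) (hε1 : ε < 1) (hδ : 0 < δ)
    (hδε : δ < ε / 4) : ContainsShell ε 1 δ (tunnel m ε δ) where
  meas := (isOpen_tunnel hε hδ hδε).measurableSet
  mem z hz' hz τ hτ := by
    have h := gmap_mem hε hε1 (Or.inl rfl : (1 : ℝ) = 1 ∨ (1 : ℝ) = -1)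
      (by linarith : ‖z‖ < ε) hτ
    exact ⟨h.2.1, h.2.2, Or.inr (by rwa [etail_gmap])⟩
  cap z hz' hz κ hκ := frontier_annu_inter_subset hε hε1 hδ hδε
    ⟨egraph_mem_frontier_annu hε hε1 (Or.inl rfl) hκ (by linarith),
      Or.inr (by rwa [etail_egraph])⟩

theorem containsShell_tunnel_neg_one {ε δ : ℝ} (hε : 0 < ε) (hε1 : ε < 1) (hδ : 0 < δ)
    (hδε : δ < ε / 4) : ContainsShell ε (-1) (-1) (tunnel m ε δ) where
  meas := (isOpen_tunnel hε hδ hδε).measurableSet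
  mem z _ hz τ hτ := by
    have h := gmap_mem hε hε1 (Or.inr rfl : (-1 : ℝ) = 1 ∨ (-1 : ℝ) = -1)
      (by linarith : ‖z‖ < ε) hτ
    exact ⟨h.2.1, h.2.2, Or.inl (by linarith [h.1])⟩
  cap z _ hz κ hκ := by
    refine frontier_annu_inter_subset hε hε1 hδ hδε
      ⟨egraph_mem_frontier_annu hε hε1 (Or.inr rfl) hκ (by linarith), Or.inl ?_⟩
    have hκε : ε ≤ κ := by rcases hκ with rfl | rfl <;> linarith
    have : 0 < √(κ ^ 2 - ‖z‖ ^ 2) := Real.sqrt_pos.2 (by nlinarith [norm_nonneg z])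
    rw [egraph_zero]
    linarith

theorem nonempty_tunnel {ε δ : ℝ} (hε : 0 < ε) (hε1 : ε < 1) : (tunnel m ε δ).Nonempty := by
  have hn : ‖econs (-((1 + ε) / 2)) (0 : Euc m)‖ = (1 + ε) / 2 := by
    have h := norm_econs_sq (-((1 + ε) / 2)) (0 : Euc m)
    refine (sq_eq_sq₀ (norm_nonneg _) (by positivity)).1 ?_
    rw [h]; simp
  refine ⟨econs (-((1 + ε) / 2)) 0, ?_, ?_, Or.inl ?_⟩
  · rw [hn]; linarith
  · rw [hn]; linarith
  · rw [econs_zero]; linarith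
end

section

open scoped unitInterval

variable {m : ℕ}

theorem norm_econs_neg {r : ℝ} (hr : 0 ≤ r) : ‖econs (-r) (0 : Euc m)‖ = r := by
  have h := norm_econs_sq (-r) (0 : Euc m)
  refine (sq_eq_sq₀ (norm_nonneg _) hr).1 ?_
  rw [h]; simp

theorem econs_neg_mem_tunnel {ε δ r : ℝ} (hε : 0 < ε) (hr : ε < r) (hr1 : r < 1) :
    econs (-r) (0 : Euc m) ∈ tunnel m ε δ := by
  refine ⟨?_, ?_, Or.inl ?_⟩
  · rwa [norm_econs_neg (hε.trans hr).le]
  · rwa [norm_econs_neg (hε.trans hr).le]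
  · rw [econs_zero]; linarith

/-- The direction obtained by tilting `x` towards the negative first axis. -/
noncomputable def tilt (t : ℝ) (x : Euc (m + 1)) : Euc (m + 1) := (1 - t) • x - t • econs 1 0

theorem continuous_tilt : Continuous fun p : ℝ × Euc (m + 1) => tilt p.1 p.2 := by
  unfold tilt; fun_prop

theorem tilt_ne_zero {ε δ t : ℝ} (hε : 0 < ε) (hδ : 0 < δ) (ht : 0 ≤ t) (ht1 : t ≤ 1)
    {x : Euc (m + 1)} (hx : x ∈ tunnel m ε δ) : tilt t x ≠ 0 := by
  intro h
  have h0 : (1 - t) * x 0 - t = 0 := by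
    have := congrArg (fun y : Euc (m + 1) => y 0) h
    simpa [tilt] using this
  have h1 : (1 - t) • etail x = 0 := by
    have := congrArg etail h
    rw [map_zero, tilt, map_sub, map_smul, map_smul, etail_econs] at this
    simpa using this
  have ht' : t < 1 := by
    by_contra! hc
    obtain rfl : t = 1 := le_antisymm ht1 hc
    norm_num at h0
  have h2 : etail x = 0 := (smul_eq_zero.1 h1).resolve_left (by linarith)
  have h3 : x 0 ≤ 0 := hx.2.2.resolve_right (by rw [h2]; simpa using hδ.le)
  have h4 : x 0 = 0 := by nlinarith
  have h5 := norm_sq_eq_add x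
  rw [h4, h2] at h5
  have h6 : ‖x‖ = 0 := by simpa using h5
  linarith [hx.1]

theorem tilt_mem_tunnel {ε δ t : ℝ} (hε : 0 < ε) (hδ : 0 < δ) (ht : 0 ≤ t) (ht1 : t ≤ 1)
    {x : Euc (m + 1)} (hx : x ∈ tunnel m ε δ) :
    (‖x‖ * ‖tilt t x‖⁻¹) • tilt t x ∈ tunnel m ε δ := by
  have hv : 0 < ‖tilt t x‖ := norm_pos_iff.2 (tilt_ne_zero hε hδ ht ht1 hx)
  have hn : ‖(‖x‖ * ‖tilt t x‖⁻¹) • tilt t x‖ = ‖x‖ := by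
    rw [norm_smul, Real.norm_of_nonneg (by positivity), inv_mul_cancel_right₀ hv.ne']
  have hx0 : 0 < ‖x‖ := hε.trans hx.1
  refine ⟨by rw [hn]; exact hx.1, by rw [hn]; exact hx.2.1, ?_⟩
  have hv0 : tilt t x 0 = (1 - t) * x 0 - t := by simp [tilt]
  have hvt : etail (tilt t x) = (1 - t) • etail x := by
    rw [tilt, map_sub, map_smul, map_smul, etail_econs]; simp
  by_cases hc : tilt t x 0 ≤ 0
  · left
    rw [PiLp.smul_apply, smul_eq_mul]
    exact mul_nonpos_of_nonneg_of_nonpos (by positivity) hc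
  right
  rw [not_le, hv0] at hc
  have ht' : 0 < 1 - t := by
    rcases ht1.lt_or_eq with h | h
    · linarith
    · rw [h] at hc; norm_num at hc
  have hx00 : 0 < x 0 := by
    by_contra! h; nlinarith
  have hδx : δ < ‖etail x‖ := hx.2.2.resolve_left (not_le.2 hx00)
  have hle : ‖tilt t x‖ ≤ (1 - t) * ‖x‖ := by
    refine le_of_sq_le_sq ?_ (by positivity)
    rw [norm_sq_eq_add, hv0, hvt, norm_smul, Real.norm_of_nonneg ht'.le, mul_pow, mul_pow,
      norm_sq_eq_add x, mul_add]
    have : ((1 - t) * x 0 - t) ^ 2 ≤ ((1 - t) * x 0) ^ 2 := by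
      refine pow_le_pow_left₀ hc.le (by linarith) 2
    nlinarith
  rw [map_smul, hvt, smul_smul, norm_smul, Real.norm_of_nonneg (by positivity)]
  have h1 : 1 ≤ ‖x‖ * ‖tilt t x‖⁻¹ * (1 - t) := by
    rw [mul_right_comm, mul_comm ‖x‖, ← div_eq_mul_inv, one_le_div hv]
    exact hle
  nlinarith [norm_nonneg (etail x)]

theorem contractibleSpace_tunnel {ε δ : ℝ} (hε : 0 < ε) (hε1 : ε < 1) (hδ : 0 < δ) :
    ContractibleSpace (tunnel m ε δ) := by
  have hseg : ∀ (t : I) (x : tunnel m ε δ),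
      econs (-((1 - (t : ℝ)) * ‖(x : Euc (m + 1))‖ + t * ((1 + ε) / 2))) (0 : Euc m) ∈
        tunnel m ε δ := fun t x => by
    have h1 := x.2.1
    have h2 := x.2.2.1
    refine econs_neg_mem_tunnel hε ?_ ?_ <;> nlinarith [t.2.1, t.2.2]
  have haxis : ∀ x : tunnel m ε δ, econs (-‖(x : Euc (m + 1))‖) (0 : Euc m) ∈ tunnel m ε δ :=
    fun x => econs_neg_mem_tunnel hε x.2.1 x.2.2.1
  let p : tunnel m ε δ := ⟨econs (-((1 + ε) / 2)) 0,
    econs_neg_mem_tunnel hε (by linarith) (by linarith)⟩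
  let a : C(tunnel m ε δ, tunnel m ε δ) :=
    ⟨fun x => ⟨econs (-‖(x : Euc (m + 1))‖) 0, haxis x⟩, by
      refine Continuous.subtype_mk ?_ _
      fun_prop⟩
  have ht0 : ∀ (t : I) (x : tunnel m ε δ), ‖tilt (t : ℝ) (x : Euc (m + 1))‖ ≠ 0 := fun t x =>
    norm_ne_zero_iff.2 (tilt_ne_zero hε hδ t.2.1 t.2.2 x.2)
  have hct : Continuous fun q : I × tunnel m ε δ => tilt (q.1 : ℝ) (q.2 : Euc (m + 1)) :=
    continuous_tilt.comp (by fun_prop :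
      Continuous fun q : I × tunnel m ε δ => ((q.1 : ℝ), (q.2 : Euc (m + 1))))
  let h1 : ContinuousMap.Homotopy (ContinuousMap.id _) a :=
    { toFun := fun q => ⟨(‖(q.2 : Euc (m + 1))‖ * ‖tilt (q.1 : ℝ) (q.2 : Euc (m + 1))‖⁻¹) •
          tilt (q.1 : ℝ) (q.2 : Euc (m + 1)), tilt_mem_tunnel hε hδ q.1.2.1 q.1.2.2 q.2.2⟩
      continuous_toFun := by
        have hcn : Continuous fun q : I × tunnel m ε δ => ‖(q.2 : Euc (m + 1))‖ := by fun_prop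
        exact ((hcn.mul (hct.norm.inv₀ fun q => ht0 q.1 q.2)).smul hct).subtype_mk _
      map_zero_left := fun x => by
        have hx : ‖(x : Euc (m + 1))‖ ≠ 0 := (hε.trans x.2.1).ne'
        refine Subtype.ext ?_
        simp [tilt, hx]
      map_one_left := fun x => by
        have hn : ‖econs 1 (0 : Euc m)‖ = 1 := by
          have h := norm_econs_sq 1 (0 : Euc m)
          exact (sq_eq_sq₀ (norm_nonneg _) zero_le_one).1 (by rw [h]; simp)
        refine Subtype.ext ?_
        change (‖(x : Euc (m + 1))‖ * ‖tilt ((1 : I) : ℝ) (x : Euc (m + 1))‖⁻¹) •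
          tilt ((1 : I) : ℝ) (x : Euc (m + 1)) = econs (-‖(x : Euc (m + 1))‖) 0
        have e : tilt ((1 : I) : ℝ) (x : Euc (m + 1)) = - econs 1 0 := by simp [tilt]
        rw [e, norm_neg, hn]
        ext i; refine Fin.cases ?_ (fun j => ?_) i <;> simp }
  let h2 : ContinuousMap.Homotopy a (ContinuousMap.const _ p) :=
    { toFun := fun q => ⟨_, hseg q.1 q.2⟩
      continuous_toFun := by
        refine Continuous.subtype_mk ?_ _
        fun_prop
      map_zero_left := fun x => Subtype.ext (by simp [a])
      map_one_left := fun x => Subtype.ext (by simp [p]) }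
  rw [contractible_iff_id_nullhomotopic]
  exact ⟨p, ⟨h1.trans h2⟩⟩
end

section
variable {m : ℕ}

/-- The Rayleigh quotients whose infimum is the first nonzero Steklov eigenvalue. -/
def rayleighSet (Ω : Set (Euc (m + 1))) : Set ℝ :=
  { q : ℝ | ∃ f : Euc (m + 1) → ℝ, ContDiff ℝ (⊤ : ℕ∞) f ∧
    (∫ x in frontier Ω, f x ∂(μH[m])) = 0 ∧
    (0 < ∫ x in frontier Ω, (f x) ^ 2 ∂(μH[m])) ∧
    q = (∫ x in Ω, ‖gradient f x‖ ^ 2) / (∫ x in frontier Ω, (f x) ^ 2 ∂(μH[m])) }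

theorem stekSigma1_eq (Ω : Set (Euc (m + 1))) : stekSigma1 Ω = sInf (rayleighSet Ω) := by
  have h : ((m + 1 : ℕ) : ℝ) - 1 = m := by push_cast; ring
  unfold stekSigma1 rayleighSet
  rw [h]

theorem nonneg_of_mem_rayleighSet {Ω : Set (Euc (m + 1))} {q : ℝ} (hq : q ∈ rayleighSet Ω) :
    0 ≤ q := by
  obtain ⟨f, -, -, -, rfl⟩ := hq
  exact div_nonneg (integral_nonneg fun x => by positivity) (integral_nonneg fun x => by positivity)

theorem bddBelow_rayleighSet (Ω : Set (Euc (m + 1))) : BddBelow (rayleighSet Ω) :=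
  ⟨0, fun _ hq => nonneg_of_mem_rayleighSet hq⟩

theorem integrableOn_of_subset_closedBall {S : Set (Euc (m + 1))} {μ : Measure (Euc (m + 1))}
    (hS : S ⊆ Metric.closedBall 0 1) (hμ : μ S ≠ ∞) (hSm : MeasurableSet S)
    {h : Euc (m + 1) → ℝ} (hh : Continuous h) : IntegrableOn h S μ := by
  obtain ⟨M, hM⟩ := (isCompact_closedBall (0 : Euc (m + 1)) 1).exists_bound_of_continuousOn
    hh.continuousOn
  exact Measure.integrableOn_of_bounded hμ hh.aestronglyMeasurable
    ((ae_restrict_iff' hSm).2 (Eventually.of_forall fun x hx => hM x (hS hx)))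

/-- The variance-type denominator of a function over the frontier of `Ω`. -/
noncomputable def fvar (Ω : Set (Euc (m + 1))) (f : Euc (m + 1) → ℝ) : ℝ :=
  (∫ x in frontier Ω, (f x) ^ 2 ∂(μH[m])) -
    (∫ x in frontier Ω, f x ∂(μH[m])) ^ 2 / (μH[m]).real (frontier Ω)

theorem fvar_eq {Ω : Set (Euc (m + 1))} (hΩ : frontier Ω ⊆ Metric.closedBall 0 1)
    (hμ : μH[m] (frontier Ω) ≠ ∞) (hP0 : (μH[m]).real (frontier Ω) ≠ 0) {f : Euc (m + 1) → ℝ}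
    (hf : Continuous f) {a : ℝ}
    (ha : a = (∫ x in frontier Ω, f x ∂(μH[m])) / (μH[m]).real (frontier Ω)) :
    ∫ x in frontier Ω, (f x - a) ∂(μH[m]) = 0 ∧
      ∫ x in frontier Ω, (f x - a) ^ 2 ∂(μH[m]) = fvar Ω f := by
  set P := (μH[m]).real (frontier Ω) with hP
  have hms : MeasurableSet (frontier Ω) := isClosed_frontier.measurableSet
  have hi1 : IntegrableOn f (frontier Ω) μH[m] :=
    integrableOn_of_subset_closedBall hΩ hμ hms hf
  have hi2 : IntegrableOn (fun x => f x ^ 2) (frontier Ω) μH[m] :=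
    integrableOn_of_subset_closedBall hΩ hμ hms (hf.pow 2)
  have hic : ∀ c : ℝ, IntegrableOn (fun _ => c) (frontier Ω) μH[m] := fun c =>
    integrableOn_const hμ
  constructor
  · rw [integral_sub hi1 (hic a), setIntegral_const, smul_eq_mul, ← hP, ha]
    field_simp; ring
  · have e : ∀ x, (f x - a) ^ 2 = f x ^ 2 - (2 * a) * f x + a ^ 2 := fun x => by ring
    simp_rw [e]
    have hi3 : IntegrableOn (fun x => f x ^ 2 - (2 * a) * f x) (frontier Ω) μH[m] :=
      hi2.sub (hi1.const_mul _)
    rw [integral_add hi3 (hic _), integral_sub hi2 (hi1.const_mul _),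
      integral_const_mul, setIntegral_const, smul_eq_mul, ← hP, fvar, ← hP, ha]
    field_simp; ring

theorem div_fvar_mem_rayleighSet {Ω : Set (Euc (m + 1))} (hΩ : frontier Ω ⊆ Metric.closedBall 0 1)
    (hμ : μH[m] (frontier Ω) ≠ ∞) {f : Euc (m + 1) → ℝ} (hf : ContDiff ℝ (⊤ : ℕ∞) f)
    (hv : 0 < fvar Ω f) : (∫ x in Ω, ‖gradient f x‖ ^ 2) / fvar Ω f ∈ rayleighSet Ω := by
  set a := (∫ x in frontier Ω, f x ∂(μH[m])) / (μH[m]).real (frontier Ω) with ha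
  have hP0 : (μH[m]).real (frontier Ω) ≠ 0 := by
    intro h
    have h0 : μH[m] (frontier Ω) = 0 := by rwa [measureReal_eq_zero_iff hμ] at h
    have : (μH[m]).restrict (frontier Ω) = 0 := Measure.restrict_eq_zero.2 h0
    simp [fvar, this] at hv
  obtain ⟨h1, h2⟩ := fvar_eq hΩ hμ hP0 hf.continuous ha
  have hg : ∀ x, gradient (fun y => f y - a) x = gradient f x := fun x => by
    unfold gradient; rw [fderiv_sub_const]
  refine ⟨fun x => f x - a, hf.sub contDiff_const, h1, by rwa [h2], ?_⟩
  simp_rw [hg]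
  rw [h2]

theorem bdry_eq_ofReal {Ω : Set (Euc (m + 1))} (hΩ : frontier Ω ⊆ Metric.closedBall 0 1)
    (hμ : μH[m] (frontier Ω) ≠ ∞) {f : Euc (m + 1) → ℝ} (hf : Continuous f) :
    bdry Ω f = ENNReal.ofReal (∫ x in frontier Ω, (f x) ^ 2 ∂(μH[m])) := by
  have hi : IntegrableOn (fun x => f x ^ 2) (frontier Ω) μH[m] := integrableOn_of_subset_closedBall
    hΩ hμ isClosed_frontier.measurableSet (hf.pow 2)
  rw [ofReal_integral_eq_lintegral_ofReal hi (Eventually.of_forall fun x => by positivity)]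
  refine lintegral_congr fun x => ?_
  rw [← ofReal_norm, ← ENNReal.ofReal_pow (norm_nonneg _), Real.norm_eq_abs, sq_abs]

theorem ener_eq_ofReal {Ω : Set (Euc (m + 1))} (hΩ : Ω ⊆ Metric.closedBall 0 1)
    (hms : MeasurableSet Ω) {f : Euc (m + 1) → ℝ} (hf : ContDiff ℝ 1 f) :
    ener Ω f = ENNReal.ofReal (∫ x in Ω, ‖gradient f x‖ ^ 2) := by
  have hv : volume Ω ≠ ∞ := ((measure_mono hΩ).trans_lt
    (isCompact_closedBall (0 : Euc (m + 1)) 1).measure_lt_top).ne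
  have hi : IntegrableOn (fun x => ‖gradient f x‖ ^ 2) Ω volume := integrableOn_of_subset_closedBall
    hΩ hv hms ((continuous_gradient hf).norm.pow 2)
  rw [ofReal_integral_eq_lintegral_ofReal hi (Eventually.of_forall fun x => by positivity)]
  refine lintegral_congr fun x => ?_
  rw [← ofReal_norm, ← ENNReal.ofReal_pow (norm_nonneg _)]
theorem exists_egraph_eq {ε : ℝ} (hε : 0 < ε) (hε1 : ε < 1) {x : Euc (m + 1)}
    (hx : x ∈ frontier (annu m ε)) (hxε : ‖etail x‖ < ε) : ∃ κ, (κ = ε ∨ κ = 1) ∧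
      ((0 < x 0 ∧ egraph 1 κ (etail x) = x) ∨ (x 0 < 0 ∧ egraph (-1) κ (etail x) = x)) := by
  have hn := norm_sq_eq_add x
  rw [frontier_annu hε hε1] at hx
  have hκ : ‖x‖ = ε ∨ ‖x‖ = 1 := hx
  refine ⟨‖x‖, hκ, ?_⟩
  have hge : ε ≤ ‖x‖ := by rcases hκ with h | h <;> rw [h]; exact hε1.le
  have hs : ‖x‖ ^ 2 - ‖etail x‖ ^ 2 = x 0 ^ 2 := by linarith
  have h0 : x 0 ≠ 0 := by
    intro h
    rw [h] at hn
    nlinarith [norm_nonneg (etail x)]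
  rcases lt_or_gt_of_ne h0 with h | h
  · refine Or.inr ⟨h, ?_⟩
    rw [egraph, hs, Real.sqrt_sq_eq_abs, abs_of_neg h, neg_one_mul, neg_neg, econs_etail]
  · refine Or.inl ⟨h, ?_⟩
    rw [egraph, hs, Real.sqrt_sq_eq_abs, abs_of_pos h, one_mul, econs_etail]

theorem exists_hausdorffMeasure_annu_near_le (hm : m ≠ 0) {ε : ℝ} (hε : 0 < ε) (hε1 : ε < 1) :
    ∃ C : ℝ≥0∞, C ≠ ∞ ∧ ∀ {R : ℝ}, 0 < R → R ≤ ε / 4 →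
      μH[m] (frontier (annu m ε) ∩ {x | ‖etail x‖ < R}) ≤ C * ENNReal.ofReal R := by
  obtain ⟨C, hC, H⟩ := exists_lintegral_egraph_image_le m
  have hb : volume (Metric.ball (0 : Euc m) 1) ≠ ∞ := measure_ball_lt_top.ne
  refine ⟨4 * (C * volume (Metric.ball (0 : Euc m) 1)), by finiteness, ?_⟩
  intro R hR hRε
  have hcap : ∀ s κ : ℝ, (s = 1 ∨ s = -1) → (κ = ε ∨ κ = 1) →
      μH[m] (egraph s κ '' Metric.ball (0 : Euc m) R) ≤
        C * volume (Metric.ball (0 : Euc m) 1) * ENNReal.ofReal R := fun s κ hs hκ => by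
    have hκε : ε ≤ κ := by rcases hκ with rfl | rfl <;> linarith
    have h1 := H hs (hε.trans_le hκε) (P := Metric.ball (0 : Euc m) R)
      (Metric.ball_subset_closedBall.trans (Metric.closedBall_subset_closedBall (by linarith)))
      (h := fun _ => 1) measurable_const
    rw [setLIntegral_one, setLIntegral_one, Measure.addHaar_ball_of_pos _ _ hR] at h1
    refine h1.trans ?_
    rw [mul_comm (ENNReal.ofReal _), ← mul_assoc]
    refine mul_le_mul_right (ENNReal.ofReal_le_ofReal ?_) _
    rw [finrank_euclideanSpace_fin]
    exact pow_le_of_le_one hR.le (by linarith) hm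
  have hsub : frontier (annu m ε) ∩ {x | ‖etail x‖ < R} ⊆
      (egraph 1 ε '' Metric.ball (0 : Euc m) R ∪ egraph 1 1 '' Metric.ball (0 : Euc m) R) ∪
      (egraph (-1) ε '' Metric.ball (0 : Euc m) R ∪ egraph (-1) 1 '' Metric.ball (0 : Euc m) R) := by
    rintro x ⟨hx, hxR⟩
    have hxR' : etail x ∈ Metric.ball (0 : Euc m) R := by simpa using hxR
    obtain ⟨κ, hκ, h⟩ := exists_egraph_eq hε hε1 hx
      (lt_of_lt_of_le hxR (by linarith : R ≤ ε))
    rcases h with ⟨-, h⟩ | ⟨-, h⟩ <;> rcases hκ with rfl | rfl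
    · exact Or.inl (Or.inl ⟨_, hxR', h⟩)
    · exact Or.inl (Or.inr ⟨_, hxR', h⟩)
    · exact Or.inr (Or.inl ⟨_, hxR', h⟩)
    · exact Or.inr (Or.inr ⟨_, hxR', h⟩)
  set D := C * volume (Metric.ball (0 : Euc m) 1) * ENNReal.ofReal R with hD
  calc _ ≤ (D + D) + (D + D) := by
        refine (measure_mono hsub).trans ((measure_union_le _ _).trans (add_le_add ?_ ?_))
        · exact (measure_union_le _ _).trans (add_le_add (hcap _ _ (by simp) (by simp))
            (hcap _ _ (by simp) (by simp)))
        · exact (measure_union_le _ _).trans (add_le_add (hcap _ _ (by simp) (by simp))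
            (hcap _ _ (by simp) (by simp)))
    _ = _ := by rw [hD]; ring

theorem exists_hausdorffMeasure_lateral_le (hm : 2 ≤ m) {ε : ℝ} (hε : 0 < ε) (hε1 : ε < 1) :
    ∃ C : ℝ≥0∞, C ≠ ∞ ∧ ∀ {δ : ℝ}, 0 < δ → δ < ε →
      μH[m] {x : Euc (m + 1) | ‖etail x‖ = δ ∧ 0 < x 0 ∧ ε ≤ ‖x‖ ∧ ‖x‖ ≤ 1} ≤
        C * ENNReal.ofReal δ := by
  obtain ⟨C, hC, H⟩ := exists_lateral_le_ringInt (m := m) (by omega) hε hε1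
  set S := (volume : Measure (Euc m)).toSphere univ with hS
  have hS' : S ≠ ∞ := measure_ne_top _ _
  refine ⟨C * S, by finiteness, ?_⟩
  intro δ hδ hδε
  have h := H hδ hδε (h := fun _ => 1) measurable_const
  have hr : ringInt ε 1 (fun _ : Euc (m + 1) => (1 : ℝ≥0∞)) δ = S := by
    simp [ringInt, hS]
  rw [setLIntegral_one, hr] at h
  refine h.trans ?_
  rw [mul_comm (ENNReal.ofReal _), ← mul_assoc]
  refine mul_le_mul_right (ENNReal.ofReal_le_ofReal ?_) _
  exact pow_le_of_le_one hδ.le (by linarith) (by omega)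

theorem mul_one_add_log_le_sqrt {ε δ : ℝ} (hε1 : ε < 1) (hδ : 0 < δ) (hδε : δ < ε) :
    δ * (1 + Real.log (ε / δ)) ≤ 3 * √δ := by
  set r := √δ with hr
  have hr0 : 0 < r := Real.sqrt_pos.2 hδ
  have hδr : δ = r ^ 2 := (Real.sq_sqrt hδ.le).symm
  have hr1 : r ≤ 1 := Real.sqrt_le_one.2 (by linarith)
  have h1 : Real.log (ε / δ) ≤ 2 * (1 / r - 1) := by
    calc Real.log (ε / δ) ≤ Real.log ((1 / r) ^ 2) := by
          refine Real.log_le_log (div_pos (hδ.trans hδε) hδ) ?_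
          rw [div_pow, one_pow, ← hδr]
          gcongr
      _ = 2 * Real.log (1 / r) := by rw [Real.log_pow]; norm_num
      _ ≤ _ := by
          have := Real.log_le_sub_one_of_pos (by positivity : 0 < 1 / r)
          linarith
  calc δ * (1 + Real.log (ε / δ)) ≤ δ * (1 + 2 * (1 / r - 1)) := by gcongr
    _ = 2 * r - r ^ 2 := by rw [hδr]; field_simp; ring
    _ ≤ _ := by nlinarith

/-- The boundary mass of `f` near the axis is a small multiple of its total energy. -/
theorem exists_near_le (hm : 2 ≤ m) {ε : ℝ} (hε : 0 < ε) (hε1 : ε < 1) : ∃ C : ℝ≥0∞, C ≠ ∞ ∧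
    ∀ {δ R : ℝ} {f : Euc (m + 1) → ℝ}, 0 < δ → δ < R → R ≤ ε / 4 → ContDiff ℝ 1 f →
      ∫⁻ x in frontier (tunnel m ε δ) ∩ {x | ‖etail x‖ < R}, ‖f x‖ₑ ^ 2 ∂μH[m] ≤
        C * ENNReal.ofReal √R * (ener (tunnel m ε δ) f + bdry (tunnel m ε δ) f) := by
  obtain ⟨C, hC, H⟩ := exists_cap_le hm hε hε1
  obtain ⟨C', hC', H'⟩ := exists_lateral_le hm hε hε1
  refine ⟨3 * C' + 4 * C, by finiteness, ?_⟩
  intro δ R f hδ hδR hRε hf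
  have hδε : δ < ε / 4 := hδR.trans_le hRε
  have hR : 0 < R := hδ.trans hδR
  set EB := ener (tunnel m ε δ) f + bdry (tunnel m ε δ) f with hEB
  have hplus := containsShell_tunnel_one (m := m) hε hε1 hδ hδε
  have hminus := containsShell_tunnel_neg_one (m := m) hε hε1 hδ hδε
  set Lat := {x : Euc (m + 1) | ‖etail x‖ = δ ∧ 0 < x 0 ∧ ε ≤ ‖x‖ ∧ ‖x‖ ≤ 1} with hLat
  set Z : ℝ → Set (Euc m) := fun ρ₀ => {z | ρ₀ < ‖z‖ ∧ ‖z‖ < R} with hZ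
  have hsub : frontier (tunnel m ε δ) ∩ {x | ‖etail x‖ < R} ⊆
      Lat ∪ ((egraph 1 ε '' Z δ ∪ egraph 1 1 '' Z δ) ∪
        (egraph (-1) ε '' Z (-1) ∪ egraph (-1) 1 '' Z (-1))) := by
    rintro x ⟨hx, hxR⟩
    rcases frontier_tunnel_subset hε hε1 hδ hδε hx with ⟨hxA, hxT⟩ | h
    swap
    · exact Or.inl h
    obtain ⟨κ, hκ, h⟩ := exists_egraph_eq hε hε1 hxA
      (lt_of_lt_of_le hxR (by linarith : R ≤ ε))
    rcases h with ⟨h0, h⟩ | ⟨h0, h⟩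
    · have h1 : δ ≤ ‖etail x‖ := hxT.resolve_left (not_le.2 h0)
      rcases h1.eq_or_lt with h2 | h2
      · refine Or.inl ⟨h2.symm, h0, ?_⟩
        rw [frontier_annu hε hε1] at hxA
        rcases hxA with h | h <;> rw [h]
        · exact ⟨le_rfl, hε1.le⟩
        · exact ⟨hε1.le, le_rfl⟩
      · refine Or.inr (Or.inl ?_)
        rcases hκ with rfl | rfl
        · exact Or.inl ⟨_, ⟨h2, hxR⟩, h⟩
        · exact Or.inr ⟨_, ⟨h2, hxR⟩, h⟩
    · have h2 : -1 < ‖etail x‖ := by linarith [norm_nonneg (etail x)]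
      refine Or.inr (Or.inr ?_)
      rcases hκ with rfl | rfl
      · exact Or.inl ⟨_, ⟨h2, hxR⟩, h⟩
      · exact Or.inr ⟨_, ⟨h2, hxR⟩, h⟩
  have hL : ∫⁻ x in Lat, ‖f x‖ₑ ^ 2 ∂μH[m] ≤ C' * (3 * ENNReal.ofReal √R) * EB := by
    refine (H' hplus hf hδ le_rfl hδε.le).trans ?_
    refine mul_le_mul_left (mul_le_mul_right ?_ _) _
    rw [show (3 : ℝ≥0∞) = ENNReal.ofReal 3 by simp, ← ENNReal.ofReal_mul (by norm_num)]
    refine ENNReal.ofReal_le_ofReal ((mul_one_add_log_le_sqrt hε1 hδ (by linarith)).trans ?_)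
    gcongr
  set D := C * ENNReal.ofReal √R * EB with hD
  calc _ ≤ C' * (3 * ENNReal.ofReal √R) * EB + ((D + D) + (D + D)) := by
        refine (lintegral_mono_set hsub).trans ((lintegral_union_le _ _ _).trans
          (add_le_add hL ((lintegral_union_le _ _ _).trans (add_le_add ?_ ?_))))
        · exact (lintegral_union_le _ _ _).trans (add_le_add
            (H (Or.inl rfl) hplus hf (Or.inl rfl) hR hRε)
            (H (Or.inl rfl) hplus hf (Or.inr rfl) hR hRε))
        · exact (lintegral_union_le _ _ _).trans (add_le_add
            (H (Or.inr rfl) hminus hf (Or.inl rfl) hR hRε)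
            (H (Or.inr rfl) hminus hf (Or.inr rfl) hR hRε))
    _ = _ := by rw [hD]; ring

/-- The weighted mass of `f` inside the domain near the axis. -/
theorem exists_weighted_tunnel_le (hm : 2 ≤ m) {ε : ℝ} (hε : 0 < ε) (hε1 : ε < 1) :
    ∃ C : ℝ≥0∞, C ≠ ∞ ∧ ∀ {δ δ₁ R : ℝ} {f : Euc (m + 1) → ℝ}, 0 < δ → δ < δ₁ → δ₁ < R → R ≤ ε / 4 →
      ContDiff ℝ 1 f → ∀ {φ : ℝ → ℝ≥0∞}, Measurable φ →
      ∫⁻ x in annu m ε ∩ {x | ‖etail x‖ ∈ Ioo δ₁ R}, φ ‖etail x‖ * ‖f x‖ₑ ^ 2 ≤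
        C * (∫⁻ ρ in Ioo δ₁ R, ENNReal.ofReal (ρ * (1 + Real.log (ε / ρ))) * φ ρ) *
          (ener (tunnel m ε δ) f + bdry (tunnel m ε δ) f) := by
  obtain ⟨C, hC, H⟩ := exists_weighted_le hm hε hε1
  refine ⟨C + C, by finiteness, ?_⟩
  intro δ δ₁ R f hδ hδ₁ hR hRε hf φ hφ
  have hδε : δ < ε / 4 := (hδ₁.trans hR).trans_le hRε
  have hsub : annu m ε ∩ {x | ‖etail x‖ ∈ Ioo δ₁ R} ⊆
      {x | ‖etail x‖ ∈ Ioo δ₁ R ∧ 0 < 1 * x 0 ∧ ε < ‖x‖ ∧ ‖x‖ < 1} ∪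
      {x | ‖etail x‖ ∈ Ioo δ₁ R ∧ 0 < -1 * x 0 ∧ ε < ‖x‖ ∧ ‖x‖ < 1} := by
    rintro x ⟨hx, hxR⟩
    have h0 : x 0 ≠ 0 := by
      intro h
      have hn := norm_sq_eq_add x
      rw [h] at hn
      nlinarith [norm_nonneg (etail x), hxR.2, hx.1]
    rcases lt_or_gt_of_ne h0 with h | h
    · exact Or.inr ⟨hxR, by linarith, hx⟩
    · exact Or.inl ⟨hxR, by linarith, hx⟩
  refine (lintegral_mono_set hsub).trans ((lintegral_union_le _ _ _).trans ?_)
  rw [add_mul, add_mul]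
  exact add_le_add
    (H (Or.inl rfl) (containsShell_tunnel_one hε hε1 hδ hδε) hf (hδ.trans hδ₁) hδ₁.le hRε hφ)
    (H (Or.inr rfl) (containsShell_tunnel_neg_one hε hε1 hδ hδε) hf (hδ.trans hδ₁)
      (by linarith) hRε hφ)
theorem frontier_annu_subset {ε : ℝ} (hε : 0 < ε) (hε1 : ε < 1) :
    frontier (annu m ε) ⊆ Metric.closedBall 0 1 := by
  rw [frontier_annu hε hε1]
  rintro x (h | h) <;> rw [mem_closedBall_zero_iff, h]
  exact hε1.le

theorem hausdorffMeasure_frontier_annu_ne_top (hm : m ≠ 0) {ε : ℝ} (hε : 0 < ε) (hε1 : ε < 1) :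
    μH[m] (frontier (annu m ε)) ≠ ∞ := by
  have h : frontier (annu m ε) ⊆ Metric.sphere 0 ε ∪ Metric.sphere 0 1 := by
    rw [frontier_annu hε hε1]
    rintro x (h | h)
    · exact Or.inl (by simpa using h)
    · exact Or.inr (by simpa using h)
  refine ne_top_of_le_ne_top ?_ (measure_mono h)
  exact measure_union_ne_top (hausdorffMeasure_sphere_lt_top hm hε).ne
    (hausdorffMeasure_sphere_lt_top hm zero_lt_one).ne

theorem frontier_tunnel_subset_closedBall {ε δ : ℝ} (hε : 0 < ε) (hε1 : ε < 1) (hδ : 0 < δ)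
    (hδε : δ < ε / 4) : frontier (tunnel m ε δ) ⊆ Metric.closedBall 0 1 := by
  intro x hx
  rcases frontier_tunnel_subset hε hε1 hδ hδε hx with h | h
  · exact frontier_annu_subset hε hε1 h.1
  · exact mem_closedBall_zero_iff.2 h.2.2.2

theorem hausdorffMeasure_frontier_tunnel_ne_top (hm : 2 ≤ m) {ε δ : ℝ} (hε : 0 < ε) (hε1 : ε < 1)
    (hδ : 0 < δ) (hδε : δ < ε / 4) : μH[m] (frontier (tunnel m ε δ)) ≠ ∞ := by
  obtain ⟨C, hC, H⟩ := exists_hausdorffMeasure_lateral_le hm hε hε1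
  refine ne_top_of_le_ne_top ?_ (measure_mono (frontier_tunnel_subset hε hε1 hδ hδε))
  refine measure_union_ne_top (ne_top_of_le_ne_top
    (hausdorffMeasure_frontier_annu_ne_top (by omega) hε hε1) (measure_mono inter_subset_left)) ?_
  exact ne_top_of_le_ne_top (by finiteness) (H hδ (by linarith))

theorem frontier_tunnel_inter_eq {ε δ ρ : ℝ} (hε : 0 < ε) (hε1 : ε < 1) (hδ : 0 < δ)
    (hδε : δ < ε / 4) (hρ : δ < ρ) :
    frontier (tunnel m ε δ) \ {x | ‖etail x‖ < ρ} = frontier (annu m ε) \ {x | ‖etail x‖ < ρ} := by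
  ext x
  constructor
  · rintro ⟨hx, hxρ⟩
    have hxρ' : ρ ≤ ‖etail x‖ := not_lt.1 hxρ
    refine ⟨?_, hxρ⟩
    rcases frontier_tunnel_subset hε hε1 hδ hδε hx with h | h
    · exact h.1
    · exact absurd h.1 (by linarith)
  · rintro ⟨hx, hxρ⟩
    have hxρ' : ρ ≤ ‖etail x‖ := not_lt.1 hxρ
    exact ⟨frontier_annu_inter_subset hε hε1 hδ hδε ⟨hx, Or.inr (by linarith)⟩, hxρ⟩

theorem exists_hausdorffMeasure_near_le (hm : 2 ≤ m) {ε : ℝ} (hε : 0 < ε) (hε1 : ε < 1) :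
    ∃ C : ℝ, 0 < C ∧ ∀ {R : ℝ}, 0 < R → R ≤ ε / 4 →
      (μH[m]).real (frontier (annu m ε) ∩ {x | ‖etail x‖ < R}) ≤ C * R ∧
      ∀ {δ : ℝ}, 0 < δ → δ < R →
        (μH[m]).real (frontier (tunnel m ε δ) ∩ {x | ‖etail x‖ < R}) ≤ C * R := by
  obtain ⟨C, hC, H⟩ := exists_hausdorffMeasure_annu_near_le (m := m) (by omega) hε hε1
  obtain ⟨C', hC', H'⟩ := exists_hausdorffMeasure_lateral_le hm hε hε1
  have hCC : C + C' ≠ ∞ := by finiteness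
  have key : ∀ {s : Set (Euc (m + 1))} {R : ℝ}, 0 < R →
      μH[m] s ≤ (C + C') * ENNReal.ofReal R → (μH[m]).real s ≤ ((C + C').toReal + 1) * R := by
    intro s R hR h
    have h1 : (C + C') * ENNReal.ofReal R = ENNReal.ofReal ((C + C').toReal * R) := by
      rw [ENNReal.ofReal_mul ENNReal.toReal_nonneg, ENNReal.ofReal_toReal hCC]
    rw [h1] at h
    refine (ENNReal.toReal_le_of_le_ofReal (by positivity) h).trans ?_
    gcongr
    linarith
  refine ⟨(C + C').toReal + 1, by positivity, fun {R} hR hRε => ⟨key hR ?_, fun {δ} hδ hδR =>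
    key hR ?_⟩⟩
  · exact (H hR hRε).trans (mul_le_mul_left le_self_add _)
  · have hsub : frontier (tunnel m ε δ) ∩ {x | ‖etail x‖ < R} ⊆
        (frontier (annu m ε) ∩ {x | ‖etail x‖ < R}) ∪
          {x | ‖etail x‖ = δ ∧ 0 < x 0 ∧ ε ≤ ‖x‖ ∧ ‖x‖ ≤ 1} := by
      rintro x ⟨hx, hxR⟩
      rcases frontier_tunnel_subset hε hε1 hδ (hδR.trans_le hRε) hx with h | h
      · exact Or.inl ⟨h.1, hxR⟩
      · exact Or.inr h
    refine (measure_mono hsub).trans ((measure_union_le _ _).trans ?_)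
    rw [add_mul]
    refine add_le_add (H hR hRε) ((H' hδ (by linarith)).trans (mul_le_mul_right ?_ _))
    exact ENNReal.ofReal_le_ofReal hδR.le

theorem tendsto_integral_frontier_tunnel (hm : 2 ≤ m) {ε : ℝ} (hε : 0 < ε) (hε1 : ε < 1)
    {h : Euc (m + 1) → ℝ} (hh : Continuous h) :
    Tendsto (fun δ => ∫ x in frontier (tunnel m ε δ), h x ∂μH[m]) (𝓝[>] 0)
      (𝓝 (∫ x in frontier (annu m ε), h x ∂μH[m])) := by
  obtain ⟨C, hC, H⟩ := exists_hausdorffMeasure_near_le hm hε hε1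
  obtain ⟨M, hM⟩ := (isCompact_closedBall (0 : Euc (m + 1)) 1).exists_bound_of_continuousOn
    hh.continuousOn
  have hM0 : 0 ≤ M := (norm_nonneg _).trans (hM 0 (by simp))
  rw [tendsto_iff_norm_sub_tendsto_zero]
  have hlim : Tendsto (fun δ : ℝ => 4 * M * C * δ) (𝓝[>] 0) (𝓝 0) := by
    have : Tendsto (fun δ : ℝ => 4 * M * C * δ) (𝓝 0) (𝓝 (4 * M * C * 0)) :=
      tendsto_id.const_mul _
    rw [mul_zero] at this
    exact this.mono_left nhdsWithin_le_nhds
  refine squeeze_zero' (Eventually.of_forall fun _ => norm_nonneg _) ?_ hlim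
  filter_upwards [Ioo_mem_nhdsGT (by positivity : (0 : ℝ) < ε / 8)] with δ hδ
  have hδ0 : 0 < δ := hδ.1
  have hδε : δ < ε / 4 := by linarith [hδ.2]
  obtain ⟨hA, hT⟩ := H (R := 2 * δ) (by linarith) (by linarith [hδ.2])
  specialize hT hδ0 (by linarith)
  set N := {x : Euc (m + 1) | ‖etail x‖ < 2 * δ} with hN
  have hNm : MeasurableSet N := measurableSet_lt (by fun_prop) measurable_const
  have hfA := hausdorffMeasure_frontier_annu_ne_top (m := m) (by omega) hε hε1
  have hfT := hausdorffMeasure_frontier_tunnel_ne_top hm hε hε1 hδ0 hδε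
  have hsA := frontier_annu_subset (m := m) hε hε1
  have hsT := frontier_tunnel_subset_closedBall (m := m) hε hε1 hδ0 hδε
  rw [← integral_inter_add_sdiff hNm (integrableOn_of_subset_closedBall hsT hfT
    isClosed_frontier.measurableSet hh), ← integral_inter_add_sdiff hNm
    (integrableOn_of_subset_closedBall hsA hfA isClosed_frontier.measurableSet hh),
    frontier_tunnel_inter_eq hε hε1 hδ0 hδε (by linarith : δ < 2 * δ), add_sub_add_right_eq_sub]
  have b1 : ‖∫ x in frontier (tunnel m ε δ) ∩ N, h x ∂μH[m]‖ ≤ M * (C * (2 * δ)) :=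
    (norm_setIntegral_le_of_norm_le_const (ne_top_of_le_ne_top hfT (measure_mono inter_subset_left)
      ).lt_top (fun x hx => hM x (hsT hx.1))).trans (by gcongr)
  have b2 : ‖∫ x in frontier (annu m ε) ∩ N, h x ∂μH[m]‖ ≤ M * (C * (2 * δ)) :=
    (norm_setIntegral_le_of_norm_le_const (ne_top_of_le_ne_top hfA (measure_mono inter_subset_left)
      ).lt_top (fun x hx => hM x (hsA hx.1))).trans (by gcongr)
  refine (norm_sub_le _ _).trans ?_
  linarith

theorem tendsto_hausdorffMeasure_frontier_tunnel (hm : 2 ≤ m) {ε : ℝ} (hε : 0 < ε) (hε1 : ε < 1) :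
    Tendsto (fun δ => (μH[m]).real (frontier (tunnel m ε δ))) (𝓝[>] 0)
      (𝓝 ((μH[m]).real (frontier (annu m ε)))) := by
  simpa using tendsto_integral_frontier_tunnel hm hε hε1 (continuous_const (y := (1 : ℝ)))

theorem setLIntegral_frontier_annu_ne_zero {ε s : ℝ} (hε : 0 < ε) (hε1 : ε < 1)
    (hs : s = 1 ∨ s = -1) {h : Euc (m + 1) → ℝ≥0∞} (hh : Measurable h)
    (hpos : ∀ z : Euc m, ‖z‖ < 1 → h (egraph s 1 z) ≠ 0) :
    ∫⁻ x in frontier (annu m ε), h x ∂μH[m] ≠ 0 := by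
  obtain ⟨C, hC, H⟩ := exists_lintegral_egraph_le m
  have hsub : egraph s 1 '' Metric.ball (0 : Euc m) 1 ⊆ frontier (annu m ε) := by
    rintro _ ⟨z, hz, rfl⟩
    rw [frontier_annu hε hε1]
    exact Or.inr (norm_egraph hs zero_le_one (mem_ball_zero_iff.1 hz).le)
  intro h0
  have h1 := H hsub hh
  rw [h0, mul_zero] at h1
  have h2 : 0 < ∫⁻ z in Metric.ball (0 : Euc m) 1, h (egraph s 1 z) := by
    refine (setLIntegral_pos_iff (hh.comp (continuous_egraph s 1).measurable)).2 ?_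
    refine lt_of_lt_of_le (Metric.measure_ball_pos volume (0 : Euc m) zero_lt_one)
      (measure_mono fun z hz => ⟨hpos z (mem_ball_zero_iff.1 hz), hz⟩)
  exact absurd h1 (not_le.2 h2)

theorem measureReal_frontier_annu_pos (hm : m ≠ 0) {ε : ℝ} (hε : 0 < ε) (hε1 : ε < 1) :
    0 < (μH[m]).real (frontier (annu m ε)) := by
  have h := setLIntegral_frontier_annu_ne_zero (m := m) hε hε1 (Or.inl rfl)
    (h := fun _ => 1) measurable_const (fun _ _ => one_ne_zero)
  rw [setLIntegral_one] at h
  exact ENNReal.toReal_pos h (hausdorffMeasure_frontier_annu_ne_top hm hε hε1)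

theorem rayleighSet_annu_nonempty (hm : m ≠ 0) {ε : ℝ} (hε : 0 < ε) (hε1 : ε < 1) :
    (rayleighSet (annu m ε)).Nonempty := by
  have hf : ContDiff ℝ (⊤ : ℕ∞) (fun x : Euc (m + 1) => x 0) := by fun_prop
  have hμ := hausdorffMeasure_frontier_annu_ne_top hm hε hε1
  have hs := frontier_annu_subset (m := m) hε hε1
  set a := (∫ x in frontier (annu m ε), x 0 ∂(μH[m])) / (μH[m]).real (frontier (annu m ε)) with ha
  obtain ⟨-, h2⟩ := fvar_eq hs hμ (measureReal_frontier_annu_pos hm hε hε1).ne' hf.continuous ha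
  have hfa : ContDiff ℝ 1 (fun x : Euc (m + 1) => x 0 - a) := by fun_prop
  refine ⟨_, div_fvar_mem_rayleighSet hs hμ hf ?_⟩
  rw [← h2]
  have hb := bdry_eq_ofReal hs hμ hfa.continuous
  have hb0 : bdry (annu m ε) (fun x => x 0 - a) ≠ 0 := by
    have hsq : ∀ z : Euc m, ‖z‖ < 1 → 0 < √(1 ^ 2 - ‖z‖ ^ 2) := fun z hz =>
      Real.sqrt_pos.2 (by nlinarith [norm_nonneg z])
    rcases le_or_gt a 0 with h0 | h0
    · refine setLIntegral_frontier_annu_ne_zero hε hε1 (Or.inl rfl) (measurable_enorm_sq hfa)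
        fun z hz => ?_
      have := hsq z hz
      refine pow_ne_zero 2 (enorm_ne_zero.2 ?_)
      change egraph 1 1 z 0 - a ≠ 0
      rw [egraph_zero]
      linarith
    · refine setLIntegral_frontier_annu_ne_zero hε hε1 (Or.inr rfl) (measurable_enorm_sq hfa)
        fun z hz => ?_
      have := hsq z hz
      refine pow_ne_zero 2 (enorm_ne_zero.2 ?_)
      change egraph (-1) 1 z 0 - a ≠ 0
      rw [egraph_zero]
      linarith
  rw [hb] at hb0
  exact ENNReal.ofReal_pos.1 (pos_iff_ne_zero.2 hb0)
theorem annu_subset_closedBall {ε : ℝ} : annu m ε ⊆ Metric.closedBall 0 1 :=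
  fun _ hx => mem_closedBall_zero_iff.2 hx.2.le

theorem tunnel_subset_annu {ε δ : ℝ} : tunnel m ε δ ⊆ annu m ε := fun _ hx => ⟨hx.1, hx.2.1⟩

theorem integrableOn_norm_gradient_sq_annu {ε : ℝ} {f : Euc (m + 1) → ℝ} (hf : ContDiff ℝ 1 f) :
    IntegrableOn (fun x => ‖gradient f x‖ ^ 2) (annu m ε) :=
  integrableOn_of_subset_closedBall annu_subset_closedBall
    ((measure_mono annu_subset_closedBall).trans_lt
      (isCompact_closedBall (0 : Euc (m + 1)) 1).measure_lt_top).ne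
    (isOpen_annu ε).measurableSet ((continuous_gradient hf).norm.pow 2)

theorem eventually_exists_rayleighSet_tunnel_lt (hm : 2 ≤ m) {ε : ℝ} (hε : 0 < ε) (hε1 : ε < 1)
    {q b : ℝ} (hq : q ∈ rayleighSet (annu m ε)) (hqb : q < b) :
    ∀ᶠ δ in 𝓝[>] 0, ∃ q' ∈ rayleighSet (tunnel m ε δ), q' < b := by
  obtain ⟨f, hf, hf0, hf2, rfl⟩ := hq
  have hf1 : ContDiff ℝ 1 f := hf.of_le (by exact_mod_cast le_top)
  have hlim : Tendsto (fun δ => fvar (tunnel m ε δ) f) (𝓝[>] 0)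
      (𝓝 (∫ x in frontier (annu m ε), (f x) ^ 2 ∂(μH[m]))) := by
    have h := (tendsto_integral_frontier_tunnel hm hε hε1 (hf.continuous.pow 2)).sub
      (((tendsto_integral_frontier_tunnel hm hε hε1 hf.continuous).pow 2).div
      (tendsto_hausdorffMeasure_frontier_tunnel hm hε hε1)
      (measureReal_frontier_annu_pos (m := m) (by omega) hε hε1).ne')
    rw [hf0] at h
    simpa [fvar] using h
  have hquot : Tendsto (fun δ => (∫ x in annu m ε, ‖gradient f x‖ ^ 2) / fvar (tunnel m ε δ) f)
      (𝓝[>] 0) (𝓝 ((∫ x in annu m ε, ‖gradient f x‖ ^ 2) /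
        ∫ x in frontier (annu m ε), (f x) ^ 2 ∂(μH[m]))) :=
    tendsto_const_nhds.div hlim hf2.ne'
  filter_upwards [hlim.eventually (lt_mem_nhds hf2), hquot.eventually (gt_mem_nhds hqb),
    Ioo_mem_nhdsGT (by positivity : (0 : ℝ) < ε / 4)] with δ h1 h2 hδ
  refine ⟨_, div_fvar_mem_rayleighSet (frontier_tunnel_subset_closedBall hε hε1 hδ.1 hδ.2)
    (hausdorffMeasure_frontier_tunnel_ne_top hm hε hε1 hδ.1 hδ.2) hf h1, lt_of_le_of_lt ?_ h2⟩
  exact div_le_div_of_nonneg_right (setIntegral_mono_set (integrableOn_norm_gradient_sq_annu hf1)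
    (Eventually.of_forall fun x => by positivity) tunnel_subset_annu.eventuallyLE) h1.le

theorem sq_setIntegral_le {S : Set (Euc (m + 1))} {μ : Measure (Euc (m + 1))}
    (hμ : μ S ≠ ∞) {u : Euc (m + 1) → ℝ} (hu : IntegrableOn u S μ)
    (hu2 : IntegrableOn (fun x => u x ^ 2) S μ) :
    (∫ x in S, u x ∂μ) ^ 2 ≤ μ.real S * ∫ x in S, u x ^ 2 ∂μ := by
  have h : ∀ t : ℝ, 0 ≤ μ.real S * (t * t) + (-2 * ∫ x in S, u x ∂μ) * t +
      ∫ x in S, u x ^ 2 ∂μ := fun t => by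
    have h0 : 0 ≤ ∫ x in S, (t * t + (-2 * t) * u x + u x ^ 2) ∂μ :=
      integral_nonneg fun x => by
        simp only [Pi.zero_apply]
        nlinarith [sq_nonneg (t - u x)]
    have hc : IntegrableOn (fun _ => t * t) S μ := integrableOn_const hμ
    have hc2 : IntegrableOn (fun x => t * t + (-2 * t) * u x) S μ := hc.add (hu.const_mul _)
    have e1 : ∫ _ in S, t * t ∂μ = μ.real S * (t * t) := by rw [setIntegral_const, smul_eq_mul]
    have e2 : ∫ x in S, (-2 * t) * u x ∂μ = (-2 * t) * ∫ x in S, u x ∂μ := integral_const_mul _ _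
    rw [integral_add hc2 hu2, integral_add hc (hu.const_mul _), e1, e2] at h0
    linarith
  have := discrim_le_zero h
  rw [discrim] at this
  linarith

theorem contDiff_comp_norm_etail {χ : ℝ → ℝ} {δ₁ : ℝ} (hδ₁ : 0 < δ₁) (hχ : ContDiff ℝ (⊤ : ℕ∞) χ)
    (h0 : ∀ ρ ≤ δ₁, χ ρ = 0) : ContDiff ℝ (⊤ : ℕ∞) fun x : Euc (m + 1) => χ ‖etail x‖ := by
  rw [contDiff_iff_contDiffAt]
  intro x
  by_cases hx : etail x = 0
  · refine (contDiffAt_const (c := (0 : ℝ))).congr_of_eventuallyEq ?_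
    have hc : Continuous fun x : Euc (m + 1) => ‖etail x‖ := by fun_prop
    filter_upwards [(isOpen_lt hc continuous_const).mem_nhds
      (show ‖etail x‖ < δ₁ by rw [hx]; simpa using hδ₁)] with y hy
    exact h0 _ (le_of_lt hy)
  · exact hχ.contDiffAt.comp x ((etail.contDiff.contDiffAt).norm ℝ hx)

theorem norm_fderiv_comp_norm_etail_le {χ : ℝ → ℝ} {δ₁ : ℝ} (hδ₁ : 0 < δ₁)
    (hχ : ContDiff ℝ (⊤ : ℕ∞) χ) (h0 : ∀ ρ ≤ δ₁, χ ρ = 0) (x : Euc (m + 1)) :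
    ‖fderiv ℝ (fun x : Euc (m + 1) => χ ‖etail x‖) x‖ ≤ |deriv χ ‖etail x‖| := by
  by_cases hx : etail x = 0
  · have : (fun x : Euc (m + 1) => χ ‖etail x‖) =ᶠ[𝓝 x] fun _ => (0 : ℝ) := by
      have hc : Continuous fun x : Euc (m + 1) => ‖etail x‖ := by fun_prop
      filter_upwards [(isOpen_lt hc continuous_const).mem_nhds
        (show ‖etail x‖ < δ₁ by rw [hx]; simpa using hδ₁)] with y hy
      exact h0 _ (le_of_lt hy)
    rw [this.fderiv_eq]
    simp
  · have hd : DifferentiableAt ℝ (fun x : Euc (m + 1) => ‖etail x‖) x :=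
      (etail.differentiableAt).norm ℝ hx
    have hχd : HasDerivAt χ (deriv χ ‖etail x‖) ‖etail x‖ :=
      (hχ.differentiable (by simp) _).hasDerivAt
    have h1 := hχd.comp_hasFDerivAt x hd.hasFDerivAt
    have h2 : ‖fderiv ℝ (fun x : Euc (m + 1) => ‖etail x‖) x‖ ≤ 1 := by
      simpa using norm_fderiv_le_of_lipschitz ℝ (lipschitzWith_norm_etail (m := m)) (x₀ := x)
    change ‖fderiv ℝ (χ ∘ fun x : Euc (m + 1) => ‖etail x‖) x‖ ≤ _
    rw [h1.fderiv, norm_smul, Real.norm_eq_abs]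
    exact mul_le_of_le_one_right (abs_nonneg _) h2

theorem norm_gradient_cutoff_sq_le {χ : ℝ → ℝ} {δ₁ η : ℝ} (hη : 0 < η) (hδ₁ : 0 < δ₁)
    (hχ : ContDiff ℝ (⊤ : ℕ∞) χ) (h0 : ∀ ρ ≤ δ₁, χ ρ = 0) {f : Euc (m + 1) → ℝ}
    (hf : ContDiff ℝ 1 f) (x : Euc (m + 1)) :
    ‖gradient (fun y => χ ‖etail y‖ * f y) x‖ ^ 2 ≤
      (1 + η) * (χ ‖etail x‖ ^ 2 * ‖gradient f x‖ ^ 2) +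
        (1 + 1 / η) * (deriv χ ‖etail x‖ ^ 2 * f x ^ 2) := by
  rw [norm_gradient_eq, norm_gradient_eq]
  have hψ : DifferentiableAt ℝ (fun x : Euc (m + 1) => χ ‖etail x‖) x :=
    (contDiff_comp_norm_etail hδ₁ hχ h0).differentiable (by simp) x
  have hfd : DifferentiableAt ℝ f x := hf.differentiable (by simp) x
  rw [fderiv_fun_mul hψ hfd]
  have h1 : ‖χ ‖etail x‖ • fderiv ℝ f x +
      f x • fderiv ℝ (fun x : Euc (m + 1) => χ ‖etail x‖) x‖ ≤
      |χ ‖etail x‖| * ‖fderiv ℝ f x‖ + |f x| * |deriv χ ‖etail x‖| := by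
    refine (norm_add_le _ _).trans ?_
    rw [norm_smul, norm_smul, Real.norm_eq_abs, Real.norm_eq_abs]
    gcongr
    exact norm_fderiv_comp_norm_etail_le hδ₁ hχ h0 x
  have h2 : ∀ a b : ℝ, (a + b) ^ 2 ≤ (1 + η) * a ^ 2 + (1 + 1 / η) * b ^ 2 := fun a b => by
    have e : (1 + η) * a ^ 2 + (1 + 1 / η) * b ^ 2 - (a + b) ^ 2 = (η * a - b) ^ 2 / η := by
      field_simp; ring
    have : 0 ≤ (η * a - b) ^ 2 / η := by positivity
    linarith
  calc _ ≤ (|χ ‖etail x‖| * ‖fderiv ℝ f x‖ + |f x| * |deriv χ ‖etail x‖|) ^ 2 := by gcongr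
    _ ≤ _ := h2 _ _
    _ = _ := by rw [mul_pow, mul_pow, sq_abs, sq_abs, sq_abs, mul_comm (f x ^ 2)]
theorem deriv_cutoff_eq_zero {χ : ℝ → ℝ} {δ₁ R ρ : ℝ} (h01 : ∀ ρ, 0 ≤ χ ρ ∧ χ ρ ≤ 1)
    (h0 : ∀ ρ ≤ δ₁, χ ρ = 0) (h1 : ∀ ρ, R ≤ ρ → χ ρ = 1) (hρ : ρ ∉ Ioo δ₁ R) :
    deriv χ ρ = 0 := by
  rcases le_or_gt ρ δ₁ with h | h
  · refine IsLocalMin.deriv_eq_zero (Eventually.of_forall fun y => ?_)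
    rw [h0 _ h]
    exact (h01 y).1
  · have hR : R ≤ ρ := not_lt.1 fun h' => hρ ⟨h, h'⟩
    refine IsLocalMax.deriv_eq_zero (Eventually.of_forall fun y => ?_)
    rw [h1 _ hR]
    exact (h01 y).2

theorem enorm_sq_eq_ofReal {V : Type*} [SeminormedAddCommGroup V] (v : V) :
    ‖v‖ₑ ^ 2 = ENNReal.ofReal (‖v‖ ^ 2) := by
  rw [ENNReal.ofReal_pow (norm_nonneg _), ofReal_norm]

theorem ener_cutoff_le {ε η δ δ₁ R : ℝ} {χ : ℝ → ℝ} {f : Euc (m + 1) → ℝ} (hε : 0 < ε)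
    (hη : 0 < η) (hδ : 0 < δ) (hδ₁ : δ < δ₁) (hR : δ₁ < R) (hRε : R ≤ ε / 4)
    (hχ : ContDiff ℝ (⊤ : ℕ∞) χ) (h01 : ∀ ρ, 0 ≤ χ ρ ∧ χ ρ ≤ 1) (h0 : ∀ ρ ≤ δ₁, χ ρ = 0)
    (h1 : ∀ ρ, R ≤ ρ → χ ρ = 1) (hf : ContDiff ℝ 1 f) :
    ener (annu m ε) (fun y => χ ‖etail y‖ * f y) ≤
      ENNReal.ofReal (1 + η) * ener (tunnel m ε δ) f + ENNReal.ofReal (1 + 1 / η) *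
        ∫⁻ x in annu m ε ∩ {x | ‖etail x‖ ∈ Ioo δ₁ R}, ‖deriv χ ‖etail x‖‖ₑ ^ 2 * ‖f x‖ₑ ^ 2 := by
  have hTm : MeasurableSet (tunnel m ε δ) :=
    (isOpen_tunnel hε hδ ((hδ₁.trans hR).trans_le hRε)).measurableSet
  have hc : Continuous fun x : Euc (m + 1) => ‖etail x‖ := by fun_prop
  set N : Set (Euc (m + 1)) := {x | ‖etail x‖ ∈ Ioo δ₁ R} with hN
  have hNm : MeasurableSet N := (isOpen_Ioo.preimage hc).measurableSet
  have hχ' : Continuous (deriv χ) := hχ.continuous_deriv (by simp)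
  have hgm := measurable_enorm_gradient_sq hf
  have hpt : ∀ x ∈ annu m ε, ‖gradient (fun y => χ ‖etail y‖ * f y) x‖ₑ ^ 2 ≤
      (tunnel m ε δ).indicator (fun x => ENNReal.ofReal (1 + η) * ‖gradient f x‖ₑ ^ 2) x +
      N.indicator (fun x => ENNReal.ofReal (1 + 1 / η) *
        (‖deriv χ ‖etail x‖‖ₑ ^ 2 * ‖f x‖ₑ ^ 2)) x := by
    intro x hx
    rw [enorm_sq_eq_ofReal]
    refine (ENNReal.ofReal_le_ofReal (norm_gradient_cutoff_sq_le hη (hδ.trans hδ₁) hχ h0 hf x)).trans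
      (ENNReal.ofReal_add_le.trans (add_le_add ?_ ?_))
    · by_cases hxT : x ∈ tunnel m ε δ
      · rw [indicator_of_mem hxT, enorm_sq_eq_ofReal, ← ENNReal.ofReal_mul (by positivity)]
        refine ENNReal.ofReal_le_ofReal (mul_le_mul_of_nonneg_left ?_ (by positivity))
        exact mul_le_of_le_one_left (by positivity) (pow_le_one₀ (h01 _).1 (h01 _).2)
      · have : ‖etail x‖ ≤ δ := not_lt.1 fun h => hxT ⟨hx.1, hx.2, Or.inr h⟩
        rw [h0 _ (this.trans hδ₁.le)]
        simp
    · by_cases hxN : x ∈ N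
      · rw [indicator_of_mem hxN, enorm_sq_eq_ofReal, enorm_sq_eq_ofReal,
          ← ENNReal.ofReal_mul (by positivity), ← ENNReal.ofReal_mul (by positivity),
          Real.norm_eq_abs, Real.norm_eq_abs, sq_abs, sq_abs]
      · rw [deriv_cutoff_eq_zero h01 h0 h1 hxN]
        simp
  calc ener (annu m ε) (fun y => χ ‖etail y‖ * f y)
      ≤ ∫⁻ x in annu m ε, ((tunnel m ε δ).indicator
          (fun x => ENNReal.ofReal (1 + η) * ‖gradient f x‖ₑ ^ 2) x +
        N.indicator (fun x => ENNReal.ofReal (1 + 1 / η) *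
          (‖deriv χ ‖etail x‖‖ₑ ^ 2 * ‖f x‖ₑ ^ 2)) x) :=
        setLIntegral_mono' (isOpen_annu ε).measurableSet hpt
    _ = _ := by
      rw [lintegral_add_left ((hgm.const_mul _).indicator hTm), setLIntegral_indicator hTm,
        setLIntegral_indicator hNm, inter_eq_left.2 tunnel_subset_annu, inter_comm N,
        lintegral_const_mul _ hgm, lintegral_const_mul', ener]
      exact ENNReal.ofReal_ne_top

theorem exists_integral_cutoff_le (hm : 2 ≤ m) {ε : ℝ} (hε : 0 < ε) (hε1 : ε < 1) :
    ∃ K : ℝ, 0 ≤ K ∧ ∀ {η η' δ δ₁ R : ℝ} {χ : ℝ → ℝ} {f : Euc (m + 1) → ℝ}, 0 < η → 0 ≤ η' →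
      0 < δ → δ < δ₁ → δ₁ < R → R ≤ ε / 4 →
      ContDiff ℝ (⊤ : ℕ∞) χ → (∀ ρ, 0 ≤ χ ρ ∧ χ ρ ≤ 1) → (∀ ρ ≤ δ₁, χ ρ = 0) →
      (∀ ρ, R ≤ ρ → χ ρ = 1) →
      ∫⁻ ρ in Ioo δ₁ R, ENNReal.ofReal (ρ * (1 + Real.log (ε / ρ))) * ‖deriv χ ρ‖ₑ ^ 2 ≤
        ENNReal.ofReal η' →
      ContDiff ℝ 1 f →
      ∫ x in annu m ε, ‖gradient (fun y => χ ‖etail y‖ * f y) x‖ ^ 2 ≤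
        (1 + η) * (∫ x in tunnel m ε δ, ‖gradient f x‖ ^ 2) +
        (1 + 1 / η) * (K * η' * ((∫ x in tunnel m ε δ, ‖gradient f x‖ ^ 2) +
          ∫ x in frontier (tunnel m ε δ), f x ^ 2 ∂μH[m])) := by
  obtain ⟨C, hC, H⟩ := exists_weighted_tunnel_le hm hε hε1
  refine ⟨C.toReal, ENNReal.toReal_nonneg, ?_⟩
  intro η η' δ δ₁ R χ f hη hη' hδ hδ₁ hR hRε hχ h01 h0 h1 hχη hf
  have hδε : δ < ε / 4 := (hδ₁.trans hR).trans_le hRε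
  have hχ' : Continuous (deriv χ) := hχ.continuous_deriv (by simp)
  have hg : ContDiff ℝ 1 fun y : Euc (m + 1) => χ ‖etail y‖ * f y :=
    ((contDiff_comp_norm_etail (hδ.trans hδ₁) hχ h0).of_le (by exact_mod_cast le_top)).mul hf
  have hb := ener_cutoff_le hε hη hδ hδ₁ hR hRε hχ h01 h0 h1 hf
  have hw := (H hδ hδ₁ hR hRε hf (φ := fun ρ => ‖deriv χ ρ‖ₑ ^ 2) (by fun_prop)).trans
    (mul_le_mul_left (mul_le_mul_right hχη C) _)
  have hE : 0 ≤ ∫ x in tunnel m ε δ, ‖gradient f x‖ ^ 2 := integral_nonneg fun x => by positivity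
  have hB : 0 ≤ ∫ x in frontier (tunnel m ε δ), f x ^ 2 ∂μH[m] :=
    integral_nonneg fun x => by positivity
  rw [bdry_eq_ofReal (frontier_tunnel_subset_closedBall hε hε1 hδ hδε)
    (hausdorffMeasure_frontier_tunnel_ne_top hm hε hε1 hδ hδε) hf.continuous] at hw
  rw [ener_eq_ofReal annu_subset_closedBall (isOpen_annu ε).measurableSet hg] at hb
  rw [ener_eq_ofReal (tunnel_subset_annu.trans annu_subset_closedBall)
    (isOpen_tunnel hε hδ hδε).measurableSet hf] at hb hw
  have h := hb.trans (add_le_add_right (mul_le_mul_right hw _) _)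
  rw [← ENNReal.ofReal_toReal hC, ← ENNReal.ofReal_add hE hB, ← ENNReal.ofReal_mul (by positivity),
    ← ENNReal.ofReal_mul (by positivity), ← ENNReal.ofReal_mul (by positivity),
    ← ENNReal.ofReal_mul (by positivity), ← ENNReal.ofReal_add (by positivity) (by positivity)] at h
  exact (ENNReal.ofReal_le_ofReal_iff (by positivity)).1 h

theorem exists_fvar_cutoff_ge (hm : 2 ≤ m) {ε : ℝ} (hε : 0 < ε) (hε1 : ε < 1) :
    ∃ K : ℝ, 0 ≤ K ∧ ∀ {δ δ₁ R : ℝ} {χ : ℝ → ℝ} {f : Euc (m + 1) → ℝ},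
      0 < δ → δ < δ₁ → δ₁ < R → R ≤ ε / 4 →
      ContDiff ℝ (⊤ : ℕ∞) χ → (∀ ρ, 0 ≤ χ ρ ∧ χ ρ ≤ 1) → (∀ ρ ≤ δ₁, χ ρ = 0) →
      (∀ ρ, R ≤ ρ → χ ρ = 1) → ContDiff ℝ 1 f →
      ∫ x in frontier (tunnel m ε δ), f x ∂μH[m] = 0 →
      (∫ x in frontier (tunnel m ε δ), f x ^ 2 ∂μH[m]) -
        K * √R * ((∫ x in tunnel m ε δ, ‖gradient f x‖ ^ 2) +
          ∫ x in frontier (tunnel m ε δ), f x ^ 2 ∂μH[m]) -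
        K * R * (∫ x in frontier (tunnel m ε δ), f x ^ 2 ∂μH[m]) ≤
      fvar (annu m ε) (fun y => χ ‖etail y‖ * f y) := by
  obtain ⟨C, hC, H⟩ := exists_near_le hm hε hε1
  obtain ⟨C', hC', H'⟩ := exists_hausdorffMeasure_near_le hm hε hε1
  have hP := measureReal_frontier_annu_pos (m := m) (by omega) hε hε1
  set P := (μH[m]).real (frontier (annu m ε)) with hPdef
  refine ⟨C.toReal + C' / P, by positivity, ?_⟩
  intro δ δ₁ R χ f hδ hδ₁ hR hRε hχ h01 h0 h1 hf hmean
  have hδε : δ < ε / 4 := (hδ₁.trans hR).trans_le hRε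
  have hR0 : 0 < R := hδ.trans (hδ₁.trans hR)
  have hc : Continuous fun x : Euc (m + 1) => ‖etail x‖ := by fun_prop
  have hNm : ∀ ρ : ℝ, MeasurableSet {x : Euc (m + 1) | ‖etail x‖ < ρ} := fun ρ =>
    (isOpen_lt hc continuous_const).measurableSet
  set T := frontier (tunnel m ε δ) with hT
  set A := frontier (annu m ε) with hA
  have hTm : MeasurableSet T := isClosed_frontier.measurableSet
  have hAm : MeasurableSet A := isClosed_frontier.measurableSet
  have hTs := frontier_tunnel_subset_closedBall (m := m) hε hε1 hδ hδε
  have hTf := hausdorffMeasure_frontier_tunnel_ne_top hm hε hε1 hδ hδε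
  have hAf := hausdorffMeasure_frontier_annu_ne_top (m := m) (by omega) hε hε1
  have hTi : ∀ {h : Euc (m + 1) → ℝ}, Continuous h → IntegrableOn h T μH[m] := fun hh =>
    integrableOn_of_subset_closedBall hTs hTf hTm hh
  have hAi : ∀ {h : Euc (m + 1) → ℝ}, Continuous h → IntegrableOn h A μH[m] := fun hh =>
    integrableOn_of_subset_closedBall (frontier_annu_subset hε hε1) hAf hAm hh
  set g : Euc (m + 1) → ℝ := fun y => χ ‖etail y‖ * f y with hg
  have hgc : Continuous g := (hχ.continuous.comp hc).mul hf.continuous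
  have hfc := hf.continuous
  set E := ∫ x in tunnel m ε δ, ‖gradient f x‖ ^ 2 with hEdef
  set B := ∫ x in T, f x ^ 2 ∂μH[m] with hBdef
  have hE : 0 ≤ E := integral_nonneg fun x => by positivity
  have hB : 0 ≤ B := integral_nonneg fun x => by positivity
  have hsplit : ∀ {S : Set (Euc (m + 1))} (ρ : ℝ) {h : Euc (m + 1) → ℝ}, IntegrableOn h S μH[m] →
      ∫ x in S, h x ∂μH[m] = (∫ x in S ∩ {x | ‖etail x‖ < ρ}, h x ∂μH[m]) +
        ∫ x in S \ {x | ‖etail x‖ < ρ}, h x ∂μH[m] := fun ρ h hi =>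
    (integral_inter_add_sdiff (hNm ρ) hi).symm
  have hfi : IntegrableOn (fun x => f x ^ 2) T μH[m] := hTi (hfc.pow 2)
  have hgi : IntegrableOn (fun x => g x ^ 2) A μH[m] := hAi (hgc.pow 2)
  have hgf : IntegrableOn (fun x => g x - f x) T μH[m] := hTi (hgc.sub hfc)
  have hnear : ∫ x in T ∩ {x | ‖etail x‖ < R}, f x ^ 2 ∂μH[m] ≤ C.toReal * √R * (E + B) := by
    have h := H hδ (hδ₁.trans hR) hRε hf
    rw [bdry_eq_ofReal hTs hTf hf.continuous,
      ener_eq_ofReal (tunnel_subset_annu.trans annu_subset_closedBall)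
      (isOpen_tunnel hε hδ hδε).measurableSet hf, ← ENNReal.ofReal_add hE hB,
      ← ENNReal.ofReal_toReal hC, ← ENNReal.ofReal_mul (by positivity),
      ← ENNReal.ofReal_mul (by positivity)] at h
    simp_rw [enorm_sq_eq_ofReal, Real.norm_eq_abs, sq_abs] at h
    rw [← ofReal_integral_eq_lintegral_ofReal (hfi.mono_set inter_subset_left)
      (Eventually.of_forall fun x => by positivity)] at h
    exact (ENNReal.ofReal_le_ofReal_iff (by positivity)).1 h
  have hsq : B - C.toReal * √R * (E + B) ≤ ∫ x in A, g x ^ 2 ∂μH[m] := by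
    have e1 := hsplit R hfi
    have e2 := hsplit R hgi
    have e3 : ∫ x in A \ {x | ‖etail x‖ < R}, g x ^ 2 ∂μH[m] =
        ∫ x in T \ {x | ‖etail x‖ < R}, f x ^ 2 ∂μH[m] := by
      rw [hT, hA, frontier_tunnel_inter_eq hε hε1 hδ hδε (hδ₁.trans hR)]
      refine setIntegral_congr_fun (hAm.diff (hNm R)) fun x hx => ?_
      simp only [hg]
      rw [h1 _ (not_lt.1 hx.2), one_mul]
    have e4 : 0 ≤ ∫ x in A ∩ {x | ‖etail x‖ < R}, g x ^ 2 ∂μH[m] :=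
      integral_nonneg fun x => by positivity
    linarith
  have hmn : ∫ x in A, g x ∂μH[m] = ∫ x in T ∩ {x | ‖etail x‖ < R}, (g x - f x) ∂μH[m] := by
    have hz : ∀ S : Set (Euc (m + 1)), MeasurableSet S →
        ∫ x in S ∩ {x | ‖etail x‖ < δ₁}, g x ∂μH[m] = 0 := fun S hS => by
      rw [setIntegral_congr_fun (g := fun _ => 0) (hS.inter (hNm δ₁)) fun x hx => ?_,
        integral_zero]
      simp only [hg]
      rw [h0 _ (le_of_lt hx.2), zero_mul]
    have e1 := hsplit δ₁ (hAi hgc)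
    have e2 := hsplit δ₁ (hTi hgc)
    rw [hz _ hAm] at e1
    rw [hz _ hTm, frontier_tunnel_inter_eq hε hε1 hδ hδε hδ₁] at e2
    have e3 : ∫ x in T, (g x - f x) ∂μH[m] = ∫ x in T, g x ∂μH[m] := by
      rw [integral_sub (hTi hgc) (hTi hfc), hmean, sub_zero]
    have e4 := hsplit R hgf
    have e5 : ∫ x in T \ {x | ‖etail x‖ < R}, (g x - f x) ∂μH[m] = 0 := by
      rw [setIntegral_congr_fun (g := fun _ => 0) (hTm.diff (hNm R)) fun x hx => ?_,
        integral_zero]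
      simp only [hg]
      rw [h1 _ (not_lt.1 hx.2), one_mul, sub_self]
    linarith
  have hmn2 : (∫ x in A, g x ∂μH[m]) ^ 2 ≤ C' * R * B := by
    rw [hmn]
    have hfin : μH[m] (T ∩ {x | ‖etail x‖ < R}) ≠ ∞ :=
      ((measure_mono inter_subset_left).trans_lt (lt_top_iff_ne_top.2 hTf)).ne
    have hi : IntegrableOn (fun x => (g x - f x) ^ 2) T μH[m] := hTi ((hgc.sub hfc).pow 2)
    refine (sq_setIntegral_le hfin (hgf.mono_set inter_subset_left)
      (hi.mono_set inter_subset_left)).trans ?_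
    refine mul_le_mul ((H' hR0 hRε).2 hδ (hδ₁.trans hR)) ?_
      (integral_nonneg fun x => by positivity) (by positivity)
    calc ∫ x in T ∩ {x | ‖etail x‖ < R}, (g x - f x) ^ 2 ∂μH[m]
        ≤ ∫ x in T, (g x - f x) ^ 2 ∂μH[m] := setIntegral_mono_set hi
          (Eventually.of_forall fun x => by positivity) inter_subset_left.eventuallyLE
      _ ≤ B := by
        refine integral_mono hi hfi fun x => ?_
        have e : (g x - f x) ^ 2 = (1 - χ ‖etail x‖) ^ 2 * f x ^ 2 := by simp only [hg]; ring
        have hχx := h01 ‖etail x‖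
        simp only [e]
        exact mul_le_of_le_one_left (by positivity)
          (pow_le_one₀ (by linarith) (by linarith))
  have hdiv : (∫ x in A, g x ∂μH[m]) ^ 2 / P ≤ C' * R * B / P :=
    div_le_div_of_nonneg_right hmn2 hP.le
  have hx1 : 0 ≤ C' / P * √R * (E + B) := by positivity
  have hx2 : 0 ≤ C.toReal * R * B := by positivity
  have hx3 : C' * R * B / P = C' / P * R * B := by ring
  rw [fvar, ← hA, ← hPdef]
  linarith
theorem eventually_le_rayleighSet_tunnel (hm : 2 ≤ m) {ε : ℝ} (hε : 0 < ε) (hε1 : ε < 1) {b : ℝ}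
    (hb : b < stekSigma1 (annu m ε)) :
    ∀ᶠ δ in 𝓝[>] 0, ∀ q ∈ rayleighSet (tunnel m ε δ), b ≤ q := by
  rcases le_or_gt b 0 with hb0 | hb0
  · exact Eventually.of_forall fun δ q hq => hb0.trans (nonneg_of_mem_rayleighSet hq)
  obtain ⟨K, hK, H⟩ := exists_integral_cutoff_le hm hε hε1
  obtain ⟨K', hK', H'⟩ := exists_fvar_cutoff_ge hm hε hε1
  set σ := stekSigma1 (annu m ε) with hσ
  have hd : 0 < σ - b := sub_pos.2 hb
  have hσ0 : 0 < σ := hb0.trans hb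
  set η := (σ - b) / (4 * (b + 1)) with hη
  have hη0 : 0 < η := by positivity
  have ha : 0 < min (1 / 2) ((σ - b) / (4 * (σ + 1))) := lt_min (by norm_num) (by positivity)
  obtain ⟨R, hRa, hR0, hRε⟩ : ∃ R : ℝ,
      K' * √R * (b + 1) + K' * R < min (1 / 2) ((σ - b) / (4 * (σ + 1))) ∧ 0 < R ∧ R < ε / 4 := by
    have hc : Continuous fun R : ℝ => K' * √R * (b + 1) + K' * R := by fun_prop
    have h := (hc.tendsto 0).mono_left (nhdsWithin_le_nhds (s := Ioi 0))
    simp only [Real.sqrt_zero, mul_zero, zero_mul, add_zero] at h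
    exact ((h.eventually (gt_mem_nhds ha)).and
      (Ioo_mem_nhdsGT (by positivity : (0 : ℝ) < ε / 4))).exists
  obtain ⟨η', hη'd, hη'0⟩ : ∃ η' : ℝ,
      (1 + 1 / η) * (K * η' * (b + 1)) < (σ - b) / 4 ∧ 0 < η' := by
    have hc : Continuous fun η' : ℝ => (1 + 1 / η) * (K * η' * (b + 1)) := by fun_prop
    have h := (hc.tendsto 0).mono_left (nhdsWithin_le_nhds (s := Ioi 0))
    simp only [mul_zero, zero_mul] at h
    exact ((h.eventually (gt_mem_nhds (by positivity))).and self_mem_nhdsWithin).exists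
  obtain ⟨χ, δ₁, hδ₁, hδ₁R, hχ, h01, h0, h1, hχη⟩ := exists_log_cutoff hε hR0 hRε.le hη'0
  filter_upwards [Ioo_mem_nhdsGT hδ₁] with δ hδ q hq
  obtain ⟨f, hf, hf0, hB, rfl⟩ := hq
  have hf1 : ContDiff ℝ 1 f := hf.of_le (by exact_mod_cast le_top)
  have hnum := H hη0 hη'0.le hδ.1 hδ.2 hδ₁R hRε.le hχ h01 h0 h1 hχη hf1
  have hden := H' hδ.1 hδ.2 hδ₁R hRε.le hχ h01 h0 h1 hf1 hf0
  have hg : ContDiff ℝ (⊤ : ℕ∞) fun y : Euc (m + 1) => χ ‖etail y‖ * f y :=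
    (contDiff_comp_norm_etail hδ₁ hχ h0).mul hf
  have hmem := fun hv => csInf_le (bddBelow_rayleighSet _) (div_fvar_mem_rayleighSet
    (frontier_annu_subset hε hε1) (hausdorffMeasure_frontier_annu_ne_top (m := m) (by omega) hε hε1)
    hg hv)
  rw [← stekSigma1_eq, ← hσ] at hmem
  set E := ∫ x in tunnel m ε δ, ‖gradient f x‖ ^ 2
  set B := ∫ x in frontier (tunnel m ε δ), f x ^ 2 ∂μH[m]
  by_contra! hq
  have hE : 0 ≤ E := integral_nonneg fun x => by positivity
  have hEB : E < b * B := (div_lt_iff₀ hB).1 hq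
  have hden2 : B * (1 - min (1 / 2) ((σ - b) / (4 * (σ + 1)))) ≤
      fvar (annu m ε) fun y => χ ‖etail y‖ * f y := by
    refine le_trans ?_ hden
    have e1 : K' * √R * (E + B) ≤ K' * √R * ((b + 1) * B) :=
      mul_le_mul_of_nonneg_left (by linarith) (by positivity)
    have e2 := mul_le_mul_of_nonneg_left hRa.le hB.le
    linarith
  have hnum2 : ∫ x in annu m ε, ‖gradient (fun y => χ ‖etail y‖ * f y) x‖ ^ 2 ≤
      B * (b + (σ - b) / 2) := by
    refine hnum.trans ?_
    have e1 : (1 + 1 / η) * (K * η' * (E + B)) ≤ (1 + 1 / η) * (K * η' * ((b + 1) * B)) := by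
      gcongr
      linarith
    have e2 := mul_le_mul_of_nonneg_left hη'd.le hB.le
    have e3 : (1 + η) * E ≤ (1 + η) * (b * B) := by gcongr
    have e4 : η * b ≤ (σ - b) / 4 := by
      rw [hη, div_mul_eq_mul_div, div_le_div_iff₀ (by positivity) (by norm_num)]
      nlinarith
    have e5 := mul_le_mul_of_nonneg_left e4 hB.le
    linarith
  have ha1 : min (1 / 2) ((σ - b) / (4 * (σ + 1))) ≤ 1 / 2 := min_le_left _ _
  have ha2 : σ * min (1 / 2) ((σ - b) / (4 * (σ + 1))) ≤ (σ - b) / 4 := by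
    refine (mul_le_mul_of_nonneg_left (min_le_right _ _) hσ0.le).trans ?_
    rw [mul_div_assoc', div_le_div_iff₀ (by positivity) (by norm_num)]
    nlinarith
  have hv : 0 < fvar (annu m ε) fun y => χ ‖etail y‖ * f y :=
    lt_of_lt_of_le (mul_pos hB (by linarith)) hden2
  have h2 := (le_div_iff₀ hv).1 (hmem hv)
  have h3 : B * (σ * (1 - min (1 / 2) ((σ - b) / (4 * (σ + 1))))) ≤ B * (b + (σ - b) / 2) :=
    calc _ = σ * (B * (1 - min (1 / 2) ((σ - b) / (4 * (σ + 1))))) := by ring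
      _ ≤ _ := (mul_le_mul_of_nonneg_left hden2 hσ0.le).trans (h2.trans hnum2)
  have h4 := le_of_mul_le_mul_left h3 hB
  linarith

theorem tendsto_stekSigma1_tunnel (hm : 2 ≤ m) {ε : ℝ} (hε : 0 < ε) (hε1 : ε < 1) :
    Tendsto (fun δ => stekSigma1 (tunnel m ε δ)) (𝓝[>] 0) (𝓝 (stekSigma1 (annu m ε))) := by
  have hne := rayleighSet_annu_nonempty (m := m) (by omega) hε hε1
  refine tendsto_order.2 ⟨fun a ha => ?_, fun b hb => ?_⟩
  · obtain ⟨b, hab, hb⟩ := exists_between ha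
    obtain ⟨q, hq⟩ := hne
    filter_upwards [eventually_le_rayleighSet_tunnel hm hε hε1 hb,
      eventually_exists_rayleighSet_tunnel_lt hm hε hε1 hq (lt_add_one q)] with δ h1 h2
    obtain ⟨q', hq', -⟩ := h2
    rw [stekSigma1_eq]
    exact hab.trans_le (le_csInf ⟨q', hq'⟩ h1)
  · rw [stekSigma1_eq] at hb
    obtain ⟨q, hq, hqb⟩ := exists_lt_of_csInf_lt hne hb
    filter_upwards [eventually_exists_rayleighSet_tunnel_lt hm hε hε1 hq hqb] with δ h
    obtain ⟨q', hq', hqb'⟩ := h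
    rw [stekSigma1_eq]
    exact (csInf_le (bddBelow_rayleighSet _) hq').trans_lt hqb'
end

end

/-- Removing a shrinking tube around the segment `γ = {t e₁ : ε/2 ≤ t ≤ 1}` from the annulus
`A_ε = {ε < ‖x‖ < 1}` yields contractible domains `Ω_δ` with
`σ₁(Ω_δ) → σ₁(A_ε)` and `H^{n-1}(∂Ω_δ) → H^{n-1}(∂A_ε)` as `δ → 0⁺`. -/
theorem stmt15 {n : ℕ} (hn : 3 ≤ n) (ε : ℝ) (hε : 0 < ε) (hε1 : ε < 1)
    (γ : Set (EuclideanSpace ℝ (Fin n)))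
    (hγ : γ = {x | ∃ t : ℝ, ε / 2 ≤ t ∧ t ≤ 1 ∧
      x = t • EuclideanSpace.single (⟨0, by omega⟩ : Fin n) (1 : ℝ)})
    (Aε : Set (EuclideanSpace ℝ (Fin n)))
    (hA : Aε = {x | ε < ‖x‖ ∧ ‖x‖ < 1})
    (Ω : ℝ → Set (EuclideanSpace ℝ (Fin n)))
    (hΩ : ∀ δ : ℝ, Ω δ = {x ∈ Aε | δ < Metric.infDist x γ}) :
    (∃ δ₀ > (0 : ℝ), ∀ δ ∈ Set.Ioo (0 : ℝ) δ₀,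
      (Ω δ).Nonempty ∧ IsOpen (Ω δ) ∧ ContractibleSpace ↥(Ω δ)) ∧
    Tendsto (fun δ : ℝ => stekSigma1 (Ω δ)) (nhdsWithin 0 (Set.Ioi 0))
      (nhds (stekSigma1 Aε)) ∧
    Tendsto (fun δ : ℝ => (μH[(n : ℝ) - 1] (frontier (Ω δ))).toReal)
      (nhdsWithin 0 (Set.Ioi 0)) (nhds ((μH[(n : ℝ) - 1] (frontier Aε)).toReal)) := by
  obtain ⟨m, rfl⟩ : ∃ m, n = m + 1 := ⟨n - 1, by omega⟩
  have hm : 2 ≤ m := by omega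
  have hcast : ((m + 1 : ℕ) : ℝ) - 1 = m := by push_cast; ring
  have hAe : Aε = annu m ε := hA
  have hT : ∀ δ, 0 < δ → δ < ε / 4 → Ω δ = tunnel m ε δ := fun δ h0 h1 => by
    rw [hΩ, hγ, hAe, tunnel_eq hε h0 h1]
    rfl
  have hev : ∀ᶠ δ in nhdsWithin 0 (Set.Ioi 0), tunnel m ε δ = Ω δ := by
    filter_upwards [Ioo_mem_nhdsGT (by positivity : (0 : ℝ) < ε / 4)] with δ hδ
    exact (hT δ hδ.1 hδ.2).symm
  refine ⟨⟨ε / 4, by positivity, fun δ hδ => ?_⟩, ?_, ?_⟩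
  · rw [hT δ hδ.1 hδ.2]
    exact ⟨nonempty_tunnel hε hε1, isOpen_tunnel hε hδ.1 hδ.2, contractibleSpace_tunnel hε hε1 hδ.1⟩
  · rw [hAe]
    exact (tendsto_stekSigma1_tunnel hm hε hε1).congr' (hev.mono fun δ h => by rw [h])
  · rw [hAe, hcast]
    exact (tendsto_hausdorffMeasure_frontier_tunnel hm hε hε1).congr'
      (hev.mono fun δ h => by rw [h]; rfl)
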